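/- arXiv:1912.11388 — 3 statements merged into one kernel-verified Lean document; each statement's English description precedes it below -/
import Mathlib

section
/- For every integer n ≥ 45, the weak circular repetition threshold for n letters equals n/(n−1); that is, the infimum of the set of real numbers r > 1 such that for every natural number N there exists a word w over A_n with |w| ≥ N whose circular word ⟨w⟩ is r-free, is equal to n/(n−1). -/
/-- `p` is a period of the word `w`: `p` is positive and `w[i] = w[i+p]`
whenever both indices are within `w`. -/
def HasPeriod {α : Type*} (w : List α) (p : ℕ) : Prop :=
  0 < p ∧ ∀ i : ℕ, i + p < w.length → w[i]? = w[i + p]?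

/-- `u` is a factor of the circular word `⟨w⟩`, i.e. a factor of some conjugate of `w`. -/
def IsCircularFactor {α : Type*} (u w : List α) : Prop :=
  ∃ x y : List α, w = x ++ y ∧ u <:+: (y ++ x)

/-- The circular word `⟨w⟩` is `r`-free: no factor of `⟨w⟩` has an exponent `≥ r`. -/
def CircularRFree {α : Type*} (r : ℝ) (w : List α) : Prop :=
  ∀ u : List α, ∀ p : ℕ, IsCircularFactor u w → HasPeriod u p →
    (u.length : ℝ) / (p : ℝ) < r

/-- If every repetition of the periodic sequence `W` with shift `d` has overlap `E` satisfying
`E * (n - 1) ≤ d`, then the circular word it spells is `r`-free for every `r > n / (n - 1)`. -/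
theorem circularRFree_of_periodic {n T : ℕ} (hn : 2 ≤ n) (W : ℕ → Fin n)
    (hT : ∀ i, W (i + T) = W i)
    (hW : ∀ s d E, 1 ≤ d → 1 ≤ E → d + E ≤ T → (∀ k < E, W (s + k) = W (s + k + d)) →
      E * (n - 1) ≤ d)
    {r : ℝ} (hr : (n : ℝ) / ((n : ℝ) - 1) < r) :
    CircularRFree r ((List.range T).map W) := by
  rintro u p ⟨x, y, hxy, a, b, hab⟩ ⟨hp, hper⟩
  have hn1 : (0 : ℝ) < (n : ℝ) - 1 := by
    have : (2 : ℝ) ≤ n := by exact_mod_cast hn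
    linarith
  have hp0 : (0 : ℝ) < p := by exact_mod_cast hp
  have hlen : x.length + y.length = T := by
    have := congrArg List.length hxy
    simpa using this.symm
  have hlen' : a.length + u.length + b.length = T := by
    have := congrArg List.length hab
    simp only [List.length_append] at this
    omega
  have hxyk : ∀ k < T, (x ++ y)[k]? = some (W k) := by
    intro k hk
    rw [← hxy]
    simp [hk]
  have hyx : ∀ k < T, (y ++ x)[k]? = some (W (x.length + k)) := by
    intro k hk
    by_cases h : k < y.length
    · rw [List.getElem?_append_left h, ← hxyk _ (by omega),
        List.getElem?_append_right (by omega)]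
      congr 1
      omega
    · rw [List.getElem?_append_right (by omega)]
      have h1 := hxyk (k - y.length) (by omega)
      rw [List.getElem?_append_left (by omega)] at h1
      rw [h1, ← hT]
      congr 2
      omega
  have hu : ∀ k < u.length, u[k]? = some (W (x.length + a.length + k)) := by
    intro k hk
    have h1 := hyx (a.length + k) (by omega)
    rw [← hab, List.getElem?_append_left (by simp; omega),
      List.getElem?_append_right (by omega)] at h1
    rw [Nat.add_assoc, ← h1]
    congr 1
    omega
  have h1n : (1 : ℝ) < (n : ℝ) / ((n : ℝ) - 1) := by
    rw [lt_div_iff₀ hn1]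
    linarith
  rcases Nat.lt_or_ge p u.length with h | h
  · have key := hW (x.length + a.length) p (u.length - p) hp (by omega) (by omega) (by
      intro k hk
      have h1 := hper k (by omega)
      rw [hu k (by omega), hu (k + p) (by omega)] at h1
      have h2 := Option.some.inj h1
      rw [h2, Nat.add_assoc _ k p])
    refine lt_of_le_of_lt ?_ hr
    rw [div_le_div_iff₀ hp0 hn1]
    have key' : ((u.length : ℝ) - p) * ((n : ℝ) - 1) ≤ p := by
      have := (Nat.cast_le (α := ℝ)).2 key
      rw [Nat.cast_mul, Nat.cast_sub h.le, Nat.cast_sub (by omega : 1 ≤ n), Nat.cast_one] at this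
      exact this
    nlinarith
  · refine lt_of_le_of_lt ?_ (h1n.trans hr)
    rw [div_le_one hp0]
    exact_mod_cast h

/-- A word of length at least `2 * n` over `n` letters is not `n / (n - 1)`-free. -/
theorem le_of_circularRFree {n : ℕ} (hn : 2 ≤ n) {r : ℝ} (hr2 : r ≤ 2) {w : List (Fin n)}
    (hw : 2 * n ≤ w.length) (h : CircularRFree r w) : (n : ℝ) / ((n : ℝ) - 1) ≤ r := by
  have hn1 : (0 : ℝ) < (n : ℝ) - 1 := by
    have : (2 : ℝ) ≤ n := by exact_mod_cast hn
    linarith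
  have hfac : ∀ s l, s + l ≤ w.length → IsCircularFactor ((w.drop s).take l) w := by
    intro s l _
    refine ⟨[], w, by simp, ?_⟩
    rw [List.append_nil]
    exact (List.take_prefix l _).isInfix.trans (List.drop_suffix s w).isInfix
  by_contra! hlt
  have hne : ∀ i j, i < j → j < i + n → j < w.length → w[i]? ≠ w[j]? := by
    intro i j hij hj hjw heq
    have h1 := h ((w.drop i).take (j - i + 1)) (j - i) (hfac _ _ (by omega)) ⟨by omega, by
      intro k hk
      simp only [List.length_take, List.length_drop] at hk
      obtain rfl : k = 0 := by omega
      simp only [List.getElem?_take, List.getElem?_drop]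
      rw [if_pos (by omega), if_pos (by omega)]
      simpa [show i + (j - i) = j by omega] using heq⟩
    have hl : ((w.drop i).take (j - i + 1)).length = j - i + 1 := by
      simp only [List.length_take, List.length_drop]; omega
    rw [hl] at h1
    have hd : (0 : ℝ) < ((j - i : ℕ) : ℝ) := by exact_mod_cast (by omega : 0 < j - i)
    have hd' : ((j - i : ℕ) : ℝ) ≤ (n : ℝ) - 1 := by
      have : ((j - i + 1 : ℕ) : ℝ) ≤ n := by exact_mod_cast (by omega : j - i + 1 ≤ n)
      push_cast at this
      linarith
    have h2 : (n : ℝ) / ((n : ℝ) - 1) ≤ ((j - i + 1 : ℕ) : ℝ) / ((j - i : ℕ) : ℝ) := by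
      rw [div_le_div_iff₀ hn1 hd]
      push_cast at hd' hd ⊢
      nlinarith
    linarith
  have hper : ∀ i, i + n < w.length → w[i]? = w[i + n]? := by
    intro i hi
    have hinj : Function.Injective (fun k : Fin n => w[i + 1 + k.1]'(by omega)) := by
      intro k l hkl
      by_contra hc
      rcases Nat.lt_or_gt_of_ne (fun e => hc (Fin.ext e)) with hlt' | hlt'
      · refine hne (i + 1 + k) (i + 1 + l) (by omega) (by omega) (by omega) ?_
        rw [List.getElem?_eq_getElem (by omega), List.getElem?_eq_getElem (by omega)]
        exact congrArg some hkl
      · refine hne (i + 1 + l) (i + 1 + k) (by omega) (by omega) (by omega) ?_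
        rw [List.getElem?_eq_getElem (by omega), List.getElem?_eq_getElem (by omega)]
        exact congrArg some hkl.symm
    obtain ⟨k, hk⟩ := (Finite.injective_iff_surjective.1 hinj) (w[i]'(by omega))
    have hk' : w[i]? = w[i + 1 + k.1]? := by
      rw [List.getElem?_eq_getElem (by omega), List.getElem?_eq_getElem (by omega)]
      exact congrArg some hk.symm
    by_cases hkn : k.1 + 1 = n
    · rw [hk']
      congr 1
      omega
    · exact absurd hk' (hne _ _ (by omega) (by omega) (by omega))
  have h1 := h ((w.drop 0).take (2 * n)) n (hfac _ _ (by omega)) ⟨by omega, by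
    intro k hk
    simp only [List.length_take, List.length_drop] at hk
    simp only [List.getElem?_take, List.getElem?_drop]
    rw [if_pos (by omega), if_pos (by omega)]
    simpa using hper k (by omega)⟩
  have hl : ((w.drop 0).take (2 * n)).length = 2 * n := by
    simp only [List.length_take, List.length_drop]; omega
  rw [hl] at h1
  have hn0 : (0 : ℝ) < n := by linarith
  have : ((2 * n : ℕ) : ℝ) / n = 2 := by
    push_cast
    field_simp
  linarith

/-- The exponent of `2` in `b`, capped at `K`. -/
def rulerLevel (K b : ℕ) : ℕ := Nat.findGreatest (fun k => 2 ^ k ∣ b) K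

/-- The number of `x ∈ [b, b + q)` with `P x`. -/
def windowCount (P : ℕ → Prop) [DecidablePred P] (b q : ℕ) : ℕ :=
  ((Finset.Ico b (b + q)).filter P).card

section ruler

variable {K b q : ℕ}

theorem rulerLevel_le (K b : ℕ) : rulerLevel K b ≤ K := Nat.findGreatest_le K

theorem le_rulerLevel_iff {k : ℕ} (hk : k ≤ K) : k ≤ rulerLevel K b ↔ 2 ^ k ∣ b := by
  constructor
  · intro h
    have h0 : 2 ^ rulerLevel K b ∣ b :=
      Nat.findGreatest_spec (P := fun k => 2 ^ k ∣ b) (Nat.zero_le K) (by simp)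
    exact (pow_dvd_pow 2 h).trans h0
  · intro h
    exact Nat.le_findGreatest hk h

theorem windowCount_congr_of_mem {P Q : ℕ → Prop} [DecidablePred P] [DecidablePred Q]
    (h : ∀ x, b ≤ x → x < b + q → (P x ↔ Q x)) : windowCount P b q = windowCount Q b q := by
  unfold windowCount
  congr 1
  exact Finset.filter_congr fun x hx => h x (Finset.mem_Ico.1 hx).1 (Finset.mem_Ico.1 hx).2

theorem windowCount_congr {P Q : ℕ → Prop} [DecidablePred P] [DecidablePred Q]
    (h : ∀ x, P x ↔ Q x) : windowCount P b q = windowCount Q b q :=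
  windowCount_congr_of_mem fun x _ _ => h x

theorem windowCount_mono {P Q : ℕ → Prop} [DecidablePred P] [DecidablePred Q]
    (h : ∀ x, P x → Q x) : windowCount P b q ≤ windowCount Q b q :=
  Finset.card_le_card fun x hx => by
    simp only [Finset.mem_filter] at hx ⊢
    exact ⟨hx.1, h x hx.2⟩

theorem windowCount_or {P Q : ℕ → Prop} [DecidablePred P] [DecidablePred Q]
    (h : ∀ x, P x → ¬ Q x) :
    windowCount (fun x => P x ∨ Q x) b q = windowCount P b q + windowCount Q b q := by
  unfold windowCount
  rw [Finset.filter_or, Finset.card_union_of_disjoint]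
  rw [Finset.disjoint_filter]
  exact fun x _ => h x

theorem windowCount_succ (P : ℕ → Prop) [DecidablePred P] :
    windowCount P b (q + 1) = windowCount P b q + if P (b + q) then 1 else 0 := by
  unfold windowCount
  rw [← Nat.add_assoc, ← Finset.insert_Ico_right_eq_Ico_add_one (by omega),
    Finset.filter_insert]
  split_ifs with h
  · rw [Finset.card_insert_of_notMem (by simp)]
  · simp

theorem windowCount_eq_of_mono {P Q : ℕ → Prop} [DecidablePred P] [DecidablePred Q]
    (h : ∀ x, P x → Q x) (hc : windowCount Q b q ≤ windowCount P b q) {x : ℕ} (hb : b ≤ x)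
    (hx : x < b + q) (hQ : Q x) : P x := by
  have hs : (Finset.Ico b (b + q)).filter P = (Finset.Ico b (b + q)).filter Q := by
    refine Finset.eq_of_subset_of_card_le (fun x hx => ?_) hc
    simp only [Finset.mem_filter] at hx ⊢
    exact ⟨hx.1, h x hx.2⟩
  have : x ∈ (Finset.Ico b (b + q)).filter P := by
    rw [hs]
    simp only [Finset.mem_filter, Finset.mem_Ico]
    exact ⟨⟨hb, hx⟩, hQ⟩
  exact (Finset.mem_filter.1 this).2

/-- The number of multiples of `2 ^ k` in `[b, b + q)`. -/
abbrev multipleCount (k b q : ℕ) : ℕ := windowCount (fun x => 2 ^ k ∣ x) b q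

theorem multipleCount_add (k b q : ℕ) :
    multipleCount k b q + (b + 2 ^ k - 1) / 2 ^ k = (b + q + 2 ^ k - 1) / 2 ^ k := by
  induction q with
  | zero => simp [multipleCount, windowCount]
  | succ q ih =>
    have hd : 0 < 2 ^ k := by positivity
    have h1 : b + (q + 1) + 2 ^ k - 1 = (b + q + 2 ^ k - 1) + 1 := by omega
    have h2 : b + q + 2 ^ k - 1 + 1 = b + q + 2 ^ k := by omega
    rw [h1, Nat.succ_div, ← ih, multipleCount, windowCount_succ, h2]
    simp only [Nat.dvd_add_self_right]
    ring

theorem multipleCount_bounds (k b q : ℕ) :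
    2 ^ k * multipleCount k b q + 1 ≤ q + 2 ^ k ∧
      q + 1 ≤ 2 ^ k * multipleCount k b q + 2 ^ k := by
  have h := multipleCount_add k b q
  have hd : 0 < 2 ^ k := by positivity
  generalize 2 ^ k = d at *
  have h1 := Nat.div_add_mod (b + d - 1) d
  have h2 := Nat.div_add_mod (b + q + d - 1) d
  have h3 := Nat.mod_lt (b + d - 1) hd
  have h4 := Nat.mod_lt (b + q + d - 1) hd
  rw [← h, mul_add] at h2
  omega

theorem multipleCount_succ (k b q : ℕ) :
    2 * multipleCount (k + 1) b q ≤ multipleCount k b q + 1 ∧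
      multipleCount k b q ≤ 2 * multipleCount (k + 1) b q + 1 := by
  have h := multipleCount_add k b q
  have h' := multipleCount_add (k + 1) b q
  have hd : 0 < 2 ^ k := by positivity
  have hU : ∀ x, (x + 2 ^ (k + 1) - 1) / 2 ^ (k + 1) = ((x + 2 ^ k - 1) / 2 ^ k + 1) / 2 := by
    intro x
    rw [pow_succ, ← Nat.div_div_eq_div_mul, ← Nat.add_div_right _ hd]
    congr 2
    omega
  rw [hU, hU] at h'
  omega

theorem multipleCount_eq {k j : ℕ} (hq : q = 2 ^ k * j) : multipleCount k b q = j := by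
  have hd : 0 < 2 ^ k := by positivity
  have h := multipleCount_add k b q
  have h1 : b + q + 2 ^ k - 1 = (b + 2 ^ k - 1) + 2 ^ k * j := by omega
  rw [h1, Nat.add_mul_div_left _ _ hd] at h
  omega

theorem windowCount_level {k : ℕ} (hk : k < K) :
    windowCount (fun x => rulerLevel K x = k) b q + multipleCount (k + 1) b q =
      multipleCount k b q := by
  rw [multipleCount, ← windowCount_or]
  · refine windowCount_congr fun x => ?_
    rw [← le_rulerLevel_iff hk, ← le_rulerLevel_iff hk.le]
    omega
  · intro x hx
    rw [← le_rulerLevel_iff hk]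
    omega

theorem windowCount_level_top :
    windowCount (fun x => rulerLevel K x = K) b q = multipleCount K b q := by
  refine windowCount_congr fun x => ?_
  rw [← le_rulerLevel_iff le_rfl]
  have := rulerLevel_le K x
  omega

theorem windowCount_level_of_dvd {κ k j : ℕ} (hκ : κ ≤ K) (hk : k < κ) (hq : q = 2 ^ κ * j) :
    windowCount (fun x => rulerLevel K x = k) b q = 2 ^ (κ - k - 1) * j := by
  have h := windowCount_level (K := K) (b := b) (q := q) (k := k) (by omega)
  have h1 : q = 2 ^ k * (2 * (2 ^ (κ - k - 1) * j)) := by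
    rw [hq, show κ = k + 1 + (κ - k - 1) by omega, pow_add, pow_succ,
      show k + 1 + (κ - k - 1) - k - 1 = κ - k - 1 by omega]
    ring
  have h2 : q = 2 ^ (k + 1) * (2 ^ (κ - k - 1) * j) := by
    rw [h1, pow_succ]; ring
  rw [multipleCount_eq h1, multipleCount_eq h2] at h
  omega

theorem four_dvd_windowCount {t κ : ℕ} (P : ℕ → Prop) [DecidablePred P] (ht : t + 2 ≤ κ)
    (hκ : κ ≤ K) (hq : 2 ^ κ ∣ q) :
    4 ∣ windowCount (fun x => rulerLevel K x < t ∧ P (rulerLevel K x)) b q := by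
  obtain ⟨j, hj⟩ := hq
  induction t with
  | zero => simp [windowCount]
  | succ t ih =>
    have h1 : windowCount (fun x => rulerLevel K x < t + 1 ∧ P (rulerLevel K x)) b q =
        windowCount (fun x => rulerLevel K x < t ∧ P (rulerLevel K x)) b q +
          windowCount (fun x => rulerLevel K x = t ∧ P t) b q := by
      rw [← windowCount_or]
      · refine windowCount_congr fun x => ?_
        constructor
        · rintro ⟨h, h'⟩
          rcases Nat.lt_succ_iff_lt_or_eq.1 h with h'' | h''
          · exact Or.inl ⟨h'', h'⟩
          · exact Or.inr ⟨h'', h'' ▸ h'⟩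
        · rintro (⟨h, h'⟩ | ⟨h, h'⟩)
          · exact ⟨by omega, h'⟩
          · exact ⟨by omega, h.symm ▸ h'⟩
      · intro x h h'
        omega
    rw [h1]
    refine dvd_add (ih (by omega)) ?_
    by_cases hP : P t
    · rw [show windowCount (fun x => rulerLevel K x = t ∧ P t) b q =
          windowCount (fun x => rulerLevel K x = t) b q from windowCount_congr (by simp [hP]),
        windowCount_level_of_dvd hκ (by omega) hj]
      refine Dvd.dvd.mul_right ?_ j
      exact pow_dvd_pow 2 (by omega : 2 ≤ κ - t - 1)
    · simp [windowCount, hP]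

/-- The number of `x ∈ [b, b + q)` of class `a`, the class being the level modulo `M`. -/
abbrev classCount (K M a b q : ℕ) : ℕ := windowCount (fun x => rulerLevel K x % M = a) b q

theorem four_dvd_classCount {M : ℕ} (a : ℕ) (hq : 2 ^ (K + 2) ∣ q) :
    4 ∣ classCount K M a b q := by
  have h2 : 2 ^ K ∣ q := (pow_dvd_pow 2 (by omega)).trans hq
  obtain ⟨j, hj⟩ := hq
  have key : ∀ k ≤ K, 4 ∣ windowCount (fun x => rulerLevel K x = k) b q := by
    intro k hk
    have hj' : q = 2 ^ K * (4 * j) := by rw [hj, pow_add]; ring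
    rcases hk.lt_or_eq with h | rfl
    · rw [windowCount_level_of_dvd le_rfl h hj']
      exact Dvd.intro_left (2 ^ (K - k - 1) * j) (by ring)
    · rw [windowCount_level_top, multipleCount_eq hj']
      exact Dvd.intro _ rfl
  unfold classCount windowCount
  rw [Finset.card_eq_sum_card_fiberwise (f := fun x => rulerLevel K x) (t := Finset.range (K + 1))
    (fun x _ => by simpa using Nat.lt_succ_of_le (rulerLevel_le K x))]
  refine Finset.dvd_sum fun k hk => ?_
  rw [Finset.filter_filter]
  by_cases h : k % M = a
  · rw [Finset.filter_congr (q := fun x => rulerLevel K x = k)]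
    · exact key k (by simpa [Nat.lt_succ_iff] using hk)
    · exact fun x _ => ⟨fun h => h.2, fun h' => ⟨h' ▸ h, h'⟩⟩
  · rw [Finset.filter_false_of_mem]
    · simp
    · rintro x _ ⟨h1, rfl⟩
      exact h h1

theorem classCount_zero_modEq {m : ℕ} (hq : 4 ∣ q)
    (hker : ∀ a, 1 ≤ a → a ≤ m → classCount K (m + 1) a b q % 4 = q % 4) :
    4 ∣ classCount K (m + 1) 0 b q := by
  have hsum : ∑ a ∈ Finset.range (m + 1), classCount K (m + 1) a b q = q := by
    unfold classCount windowCount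
    rw [← Finset.card_eq_sum_card_fiberwise]
    · simp
    · intro x _
      simpa using Nat.mod_lt _ (Nat.succ_pos m)
  rw [Finset.sum_range_succ'] at hsum
  have h1 : 4 ∣ ∑ a ∈ Finset.range m, classCount K (m + 1) (a + 1) b q := by
    refine Finset.dvd_sum fun a ha => ?_
    have := hker (a + 1) (by omega) (by simp at ha; omega)
    omega
  rw [← hsum] at hq
  exact (Nat.dvd_add_right h1).1 hq

theorem rulerLevel_of_mod_eq {M a x : ℕ} (h : rulerLevel K x % M = a) :
    a ≤ rulerLevel K x :=
  h ▸ Nat.mod_le _ _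

theorem not_kernel_of_two_pow_top {m j : ℕ} (hm : 2 ≤ m) (hK : 2 ≤ K) (hKm : K % (m + 1) ≠ 0)
    (hq : q = 2 ^ K * j) (hj : 1 ≤ j) (hj4 : j < 4)
    (hker : ∀ a, 1 ≤ a → a ≤ m → classCount K (m + 1) a b q % 4 = q % 4) : False := by
  have h4 : 4 ∣ q := hq ▸ (pow_dvd_pow 2 hK).mul_right j
  have hlt : K % (m + 1) < m + 1 := Nat.mod_lt K (Nat.succ_pos m)
  have hk := hker (K % (m + 1)) (by omega) (by omega)
  have h1 : classCount K (m + 1) (K % (m + 1)) b q =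
      windowCount (fun x => rulerLevel K x < K - 2 ∧ rulerLevel K x % (m + 1) = K % (m + 1)) b q +
        windowCount (fun x => rulerLevel K x = K) b q := by
    rw [← windowCount_or]
    · refine windowCount_congr fun x => ?_
      have h2 := rulerLevel_le K x
      constructor
      · intro h
        by_cases h3 : rulerLevel K x < K - 2
        · exact Or.inl ⟨h3, h⟩
        · right
          by_contra h5
          have h6 : K = rulerLevel K x + 1 ∨ K = rulerLevel K x + 2 := by omega
          have h7 : (rulerLevel K x) ≡ K [MOD (m + 1)] := h
          rw [Nat.modEq_iff_dvd' h2] at h7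
          have := Nat.le_of_dvd (by omega) h7
          omega
      · rintro (h | h)
        · exact h.2
        · rw [h]
    · intro x hx
      omega
  have h2 := four_dvd_windowCount (K := K) (κ := K) (t := K - 2) (b := b) (q := q)
    (fun k => k % (m + 1) = K % (m + 1)) (by omega) le_rfl ⟨j, hq⟩
  rw [windowCount_level_top, multipleCount_eq hq] at h1
  omega

theorem dvd_of_class_eq {t x : ℕ} (hK : t + 2 ≤ K)
    (hx : rulerLevel K x % (t + 4) = t + 3 ∨ rulerLevel K x % (t + 4) = t + 2) :
    2 ^ (t + 2) ∣ x := by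
  rw [← le_rulerLevel_iff hK]
  rcases hx with h | h
  · have := rulerLevel_of_mod_eq h
    omega
  · exact rulerLevel_of_mod_eq h

theorem classCount_add_classCount_le {t : ℕ} (hK : t + 2 ≤ K) :
    classCount K (t + 4) (t + 3) b q + classCount K (t + 4) (t + 2) b q ≤
      multipleCount (t + 2) b q := by
  rw [classCount, classCount, ← windowCount_or (by intro x hx; omega)]
  exact windowCount_mono fun x hx => dvd_of_class_eq hK hx

theorem classCount_add_multipleCount {t a : ℕ} (hK : t + 2 ≤ K)
    (hc : multipleCount (t + 2) b q ≤
      classCount K (t + 4) (t + 3) b q + classCount K (t + 4) (t + 2) b q) (ha : a < t + 2) :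
    classCount K (t + 4) a b q + multipleCount (a + 1) b q = multipleCount a b q := by
  rw [← windowCount_level (K := K) (k := a) (by omega)]
  congr 1
  refine windowCount_congr_of_mem fun x hb hx => ⟨fun h => ?_, fun h => ?_⟩
  · by_contra h1
    have h2 := Nat.div_add_mod (rulerLevel K x) (t + 4)
    have h3 : 2 ^ (t + 2) ∣ x := by
      rw [← le_rulerLevel_iff hK]
      have h4 : rulerLevel K x / (t + 4) ≠ 0 := by
        intro h5
        rw [h5] at h2
        omega
      have := Nat.le_mul_of_pos_right (t + 4) (Nat.pos_of_ne_zero h4)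
      omega
    rw [classCount, classCount, ← windowCount_or (by intro x hx; omega)] at hc
    have := windowCount_eq_of_mono (fun x hx => dvd_of_class_eq hK hx) hc hb hx h3
    omega
  · rw [h]
    exact Nat.mod_eq_of_lt (by omega)

theorem multipleCount_le_of_lt {k l : ℕ} (h : q < 2 ^ k * l) : multipleCount k b q ≤ l := by
  have := (multipleCount_bounds k b q).1
  by_contra! h'
  have := Nat.mul_le_mul_left (2 ^ k) h'
  have h2 : 2 ^ k * (l + 1) = 2 ^ k * l + 2 ^ k := by ring
  simp only [Nat.succ_eq_add_one, h2] at this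
  omega

theorem not_kernel_of_odd {m : ℕ} (hm : 4 ≤ m) (hK : m + 1 ≤ K) (hq2 : q % 2 = 1)
    (hq : q < 2 ^ m)
    (hker : ∀ a, 1 ≤ a → a ≤ m → classCount K (m + 1) a b q % 4 = q % 4) : False := by
  obtain ⟨t, rfl⟩ : ∃ t, m = t + 3 := ⟨m - 3, by omega⟩
  simp only [Nat.add_assoc, Nat.reduceAdd] at hker
  have k0 := hker (t + 3) (by omega) (by omega)
  have k1 := hker (t + 2) (by omega) (by omega)
  have k2 := hker (t + 1) (by omega) (by omega)
  have k3 := hker t (by omega) (by omega)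
  have hN : multipleCount (t + 2) b q ≤ 2 :=
    multipleCount_le_of_lt (hq.trans_eq (pow_succ _ _))
  have hle := classCount_add_classCount_le (K := K) (b := b) (q := q) (t := t) (by omega)
  have h1 := classCount_add_multipleCount (K := K) (b := b) (q := q) (t := t) (a := t + 1)
    (by omega) (by omega) (by omega)
  have h2 := classCount_add_multipleCount (K := K) (b := b) (q := q) (t := t) (a := t)
    (by omega) (by omega) (by omega)
  have h3 := multipleCount_succ (t + 1) b q
  have h4 := multipleCount_succ t b q
  simp only [Nat.add_assoc, Nat.reduceAdd] at h1 h3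
  omega

theorem not_kernel_of_two_mod_four {m : ℕ} (hm : 4 ≤ m) (hK : m + 1 ≤ K) (hq2 : q % 4 = 2)
    (hq : q < 2 ^ (m + 1))
    (hker : ∀ a, 1 ≤ a → a ≤ m → classCount K (m + 1) a b q % 4 = q % 4) : False := by
  obtain ⟨t, rfl⟩ : ∃ t, m = t + 3 := ⟨m - 3, by omega⟩
  simp only [Nat.add_assoc, Nat.reduceAdd] at hker
  have k0 := hker (t + 3) (by omega) (by omega)
  have k1 := hker (t + 2) (by omega) (by omega)
  have k2 := hker (t + 1) (by omega) (by omega)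
  have hN : multipleCount (t + 2) b q ≤ 4 :=
    multipleCount_le_of_lt (hq.trans_eq (by ring))
  have hle := classCount_add_classCount_le (K := K) (b := b) (q := q) (t := t) (by omega)
  have h1 := classCount_add_multipleCount (K := K) (b := b) (q := q) (t := t) (a := t + 1)
    (by omega) (by omega) (by omega)
  have h3 := multipleCount_succ (t + 1) b q
  simp only [Nat.add_assoc, Nat.reduceAdd] at h1 h3
  omega

theorem not_kernel_of_four_dvd {m κ j : ℕ} (hm : 2 ≤ m) (hκ : 2 ≤ κ) (hκK : κ < K)
    (hq : q = 2 ^ κ * j) (hj : j % 2 = 1) (hj2 : j ≤ 2 ^ m)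
    (hker : ∀ a, 1 ≤ a → a ≤ m → classCount K (m + 1) a b q % 4 = q % 4) : False := by
  obtain ⟨s, rfl⟩ : ∃ s, κ = s + 2 := ⟨κ - 2, by omega⟩
  have h4 : 4 ∣ q := hq ▸ (pow_dvd_pow 2 hκ).mul_right j
  have hzero := classCount_zero_modEq h4 hker
  have hall : ∀ a, a ≤ m → 4 ∣ classCount K (m + 1) a b q := by
    intro a ha
    rcases Nat.eq_zero_or_pos a with rfl | h
    · exact hzero
    · have := hker a h ha
      omega
  have hmod : ∀ {x y : ℕ}, x % (m + 1) = y % (m + 1) → x < y → x + (m + 1) ≤ y := by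
    intro x y h hxy
    have h1 : x ≡ y [MOD (m + 1)] := h
    rw [Nat.modEq_iff_dvd' hxy.le] at h1
    have := Nat.le_of_dvd (by omega) h1
    omega
  have hsplit : ∀ u, u = s ∨ u = s + 1 → classCount K (m + 1) (u % (m + 1)) b q =
      windowCount (fun x => rulerLevel K x < s ∧ rulerLevel K x % (m + 1) = u % (m + 1)) b q +
        (windowCount (fun x => rulerLevel K x = u) b q +
          windowCount (fun x => s + m + 1 ≤ rulerLevel K x ∧
            rulerLevel K x % (m + 1) = u % (m + 1)) b q) := by
    intro u hu
    rw [classCount, ← windowCount_or (by intro x hx; omega),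
      ← windowCount_or (by intro x hx; omega)]
    refine windowCount_congr fun x => ⟨fun h => ?_, ?_⟩
    · rcases Nat.lt_trichotomy (rulerLevel K x) u with h1 | h1 | h1
      · have := hmod h h1
        left; exact ⟨by omega, h⟩
      · right; left; exact h1
      · have := hmod h.symm h1
        right; right; exact ⟨by omega, h⟩
    · rintro (h | h | h)
      · exact h.2
      · rw [h]
      · exact h.2
  have h0 := hsplit s (Or.inl rfl)
  have h1 := hsplit (s + 1) (Or.inr rfl)
  have d0 := hall (s % (m + 1)) (Nat.lt_succ_iff.1 (Nat.mod_lt _ (Nat.succ_pos m)))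
  have d1 := hall ((s + 1) % (m + 1)) (Nat.lt_succ_iff.1 (Nat.mod_lt _ (Nat.succ_pos m)))
  have e0 := four_dvd_windowCount (K := K) (κ := s + 2) (t := s) (b := b) (q := q)
    (fun k => k % (m + 1) = s % (m + 1)) le_rfl hκK.le ⟨j, hq⟩
  have e1 := four_dvd_windowCount (K := K) (κ := s + 2) (t := s) (b := b) (q := q)
    (fun k => k % (m + 1) = (s + 1) % (m + 1)) le_rfl hκK.le ⟨j, hq⟩
  rw [windowCount_level_of_dvd hκK.le (by omega) hq,
    show s + 2 - s - 1 = 1 by omega, pow_one] at h0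
  rw [windowCount_level_of_dvd hκK.le (by omega) hq,
    show s + 2 - (s + 1) - 1 = 0 by omega, pow_zero, one_mul] at h1
  have hg : windowCount (fun x => s + m + 1 ≤ rulerLevel K x ∧
        rulerLevel K x % (m + 1) = s % (m + 1)) b q +
      windowCount (fun x => s + m + 1 ≤ rulerLevel K x ∧
        rulerLevel K x % (m + 1) = (s + 1) % (m + 1)) b q ≤ multipleCount (s + m + 1) b q := by
    rw [← windowCount_or]
    · refine windowCount_mono fun x hx => ?_
      have hx' : s + m + 1 ≤ rulerLevel K x := by omega
      rwa [le_rulerLevel_iff (hx'.trans (rulerLevel_le K x))] at hx'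
    · rintro x ⟨-, h⟩ ⟨-, h'⟩
      have := hmod (h.symm.trans h') (Nat.lt_succ_self s)
      omega
  have hb := (multipleCount_bounds (s + m + 1) b q).1
  have h3 : 3 ≤ multipleCount (s + m + 1) b q := by omega
  have h5 := Nat.mul_le_mul_left (2 ^ (s + m + 1)) h3
  have h6 : 2 ^ (s + m + 1) * 2 = 2 ^ (s + 2) * 2 ^ m := by ring
  have h7 := Nat.mul_le_mul_left (2 ^ (s + 2)) hj2
  omega

theorem not_kernel {m w κ j : ℕ} (hm : 7 ≤ m) (hw : 2 * w + 4 ≤ 2 ^ m) (hK : m + 1 ≤ K)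
    (hκK : κ < K) (hq : q = 2 ^ κ * j) (hj : j % 2 = 1) (hqw : q ≤ 2 * w * 2 ^ κ + 3)
    (hker : ∀ a, 1 ≤ a → a ≤ m → classCount K (m + 1) a b q % 4 = q % 4) : False := by
  match κ, hκK, hq, hqw with
  | 0, _, hq, hqw => exact not_kernel_of_odd (by omega) hK (by omega) (by omega) hker
  | 1, _, hq, hqw =>
    refine not_kernel_of_two_mod_four (by omega) hK (by omega) ?_ hker
    rw [pow_succ]
    omega
  | κ + 2, hκK, hq, hqw =>
    refine not_kernel_of_four_dvd (by omega) (by omega) hκK hq hj ?_ hker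
    by_contra! h
    have h1 := Nat.mul_le_mul_left (2 ^ (κ + 2)) (by omega : 2 * w + 1 ≤ j)
    have h2 : 2 ^ (κ + 2) = 4 * 2 ^ κ := by ring
    have h3 : 0 < 2 ^ κ := by positivity
    have h4 : 2 ^ (κ + 2) * (2 * w + 1) = 2 * w * 2 ^ (κ + 2) + 2 ^ (κ + 2) := by ring
    omega

theorem rulerLevel_two_pow_mul {κ x : ℕ} (hκ : κ < K) (hx : x % 2 = 1) :
    rulerLevel K (2 ^ κ * x) = κ := by
  refine le_antisymm ?_ ((le_rulerLevel_iff hκ.le).2 (Dvd.intro x rfl))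
  by_contra! h
  rw [← Nat.succ_le_iff, le_rulerLevel_iff hκ, pow_succ] at h
  have := (Nat.mul_dvd_mul_iff_left (by positivity : 0 < 2 ^ κ)).1 h
  omega

theorem two_pow_dvd_of_class_eq {M κ x y : ℕ} (hκ : κ < K) (hx : x % 2 = 1) (hy : y % 2 = 0)
    (h : rulerLevel K (2 ^ κ * x) % M = rulerLevel K (2 ^ κ * y) % M) : 2 ^ M ∣ y := by
  rw [rulerLevel_two_pow_mul hκ hx] at h
  have h1 : κ + 1 ≤ rulerLevel K (2 ^ κ * y) := by
    rw [le_rulerLevel_iff hκ, pow_succ]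
    exact Nat.mul_dvd_mul_left _ (by omega)
  have h2 : κ ≡ rulerLevel K (2 ^ κ * y) [MOD M] := h
  rw [Nat.modEq_iff_dvd' (by omega)] at h2
  have h3 := Nat.le_of_dvd (by omega) h2
  have h4 : κ + M ≤ rulerLevel K (2 ^ κ * y) := by omega
  rw [le_rulerLevel_iff (h4.trans (rulerLevel_le _ _)), pow_add] at h4
  exact (Nat.mul_dvd_mul_iff_left (by positivity)).1 h4

/-- A window of length `q` satisfying all the counting congruences is followed by fewer than about
`q / w` positions at which the class is preserved under the shift by `q`. -/
theorem not_long_kernel {m w e : ℕ} (hm : 7 ≤ m) (hw1 : 1 ≤ w) (hw : 2 * w + 4 ≤ 2 ^ m)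
    (hK : m + 1 ≤ K) (hKm : K % (m + 1) ≠ 0) (hq : 4 ≤ q) (hqK : q < 4 * 2 ^ K)
    (hqe : q ≤ (e + 1) * w + 3)
    (hker : ∀ a, 1 ≤ a → a ≤ m → classCount K (m + 1) a b q % 4 = q % 4)
    (hcls : ∀ x, b ≤ x → x < b + e →
      rulerLevel K x % (m + 1) = rulerLevel K (x + q) % (m + 1)) : False := by
  obtain ⟨κ, j, hj, hqj⟩ := Nat.exists_eq_two_pow_mul_odd (by omega : q ≠ 0)
  rw [Nat.odd_iff] at hj
  rcases Nat.lt_or_ge κ K with hκ | hκ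
  · by_cases hqw : q ≤ 2 * w * 2 ^ κ + 3
    · exact not_kernel hm hw hK hκ hqj hj hqw hker
    push Not at hqw
    have hP : 0 < 2 ^ κ := by positivity
    obtain ⟨x, hx1, hx2⟩ : ∃ x, b ≤ 2 ^ κ * x ∧ 2 ^ κ * x < b + 2 ^ κ := by
      refine ⟨(b + 2 ^ κ - 1) / 2 ^ κ, ?_⟩
      have h1 := Nat.div_add_mod (b + 2 ^ κ - 1) (2 ^ κ)
      have h2 := Nat.mod_lt (b + 2 ^ κ - 1) hP
      omega
    have he : 2 * 2 ^ κ ≤ e := by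
      by_contra! h
      have := Nat.mul_le_mul_right w (by omega : e + 1 ≤ 2 * 2 ^ κ)
      have h2 : 2 * 2 ^ κ * w = 2 * w * 2 ^ κ := by ring
      omega
    have hc : ∀ y, b ≤ 2 ^ κ * y → 2 ^ κ * y < b + e →
        (y % 2 = 0 → 2 ^ (m + 1) ∣ y) ∧ (y % 2 = 1 → 2 ^ (m + 1) ∣ y + j) := by
      intro y h1 h2
      have h3 := hcls _ h1 h2
      rw [hqj, ← mul_add] at h3
      exact ⟨fun h => two_pow_dvd_of_class_eq hκ (by omega) h h3.symm,
        fun h => two_pow_dvd_of_class_eq hκ h (by omega) h3⟩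
    have h8 : 8 ∣ 2 ^ (m + 1) := by
      rw [show m + 1 = 3 + (m - 2) by omega, pow_add]
      exact Dvd.intro _ rfl
    have m1 : 2 ^ κ * (x + 1) = 2 ^ κ * x + 2 ^ κ := by ring
    have m2 : 2 ^ κ * (x + 2) = 2 ^ κ * x + 2 * 2 ^ κ := by ring
    have c0 := hc x hx1 (by omega)
    have c1 := hc (x + 1) (by omega) (by omega)
    have hj1 : 2 ^ (m + 1) ≤ j + 1 := by
      rcases Nat.mod_two_eq_zero_or_one x with h | h
      · have a0 := c0.1 h
        have a1 := c1.2 (by omega)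
        rw [add_assoc] at a1
        have := Nat.le_of_dvd (by omega) ((Nat.dvd_add_right a0).1 a1)
        omega
      · have a0 := c0.2 h
        have a1 := c1.1 (by omega)
        have hj2 : 2 ≤ j := by
          by_contra! h'
          obtain rfl : j = 1 := by omega
          have := Nat.mul_le_mul_right (2 ^ κ) hw1
          have h2 : 2 * w * 2 ^ κ = 2 * (w * 2 ^ κ) := by ring
          omega
        have h2 : x + j = x + 1 + (j - 1) := by omega
        rw [h2] at a0
        have := Nat.le_of_dvd (by omega) ((Nat.dvd_add_right a1).1 a0)
        omega
    have he3 : e < 3 * 2 ^ κ := by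
      by_contra! h
      have c2 := hc (x + 2) (by omega) (by omega)
      rcases Nat.mod_two_eq_zero_or_one x with h | h
      · have a0 := c0.1 h
        have a1 := c2.1 (by omega)
        have := Nat.le_of_dvd (by omega) ((Nat.dvd_add_right a0).1 a1)
        omega
      · have a0 := c0.2 h
        have a1 := c2.2 (by omega)
        rw [add_right_comm] at a1
        have := Nat.le_of_dvd (by omega) ((Nat.dvd_add_right a0).1 a1)
        omega
    have h1 := Nat.mul_le_mul_right w (by omega : e + 1 ≤ 3 * 2 ^ κ)
    have h2 : 2 ^ (m + 1) = 2 * 2 ^ m := by ring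
    have h3 := Nat.mul_le_mul_left (2 ^ κ) (by omega : 3 * w + 4 ≤ j)
    have h4 : 2 ^ κ * (3 * w + 4) = 3 * 2 ^ κ * w + 4 * 2 ^ κ := by ring
    omega
  · have h1 : q = 2 ^ K * (2 ^ (κ - K) * j) := by
      rw [← mul_assoc, ← pow_add, hqj]
      congr 2
      omega
    refine not_kernel_of_two_pow_top (by omega) (by omega) hKm h1 ?_ ?_ hker
    · by_contra! h
      obtain h0 : 2 ^ (κ - K) * j = 0 := by omega
      rw [h0] at h1
      omega
    · by_contra! h
      have := Nat.mul_le_mul_left (2 ^ K) h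
      omega

end ruler

/-- `k` is the conveyor index found at row `ρ` in column `2 * h`. -/
def ConveyorIndex (r ρ h k : ℤ) : Prop :=
  0 ≤ k ∧ k ≤ r ∧ (k = h - ρ ∨ k = h - ρ + (r + 1) ∨ k = h - ρ - (r + 1))

/-- The slot types before and after the start of a block of a letter seen in two cells; the first
two constructors are letters that keep their slot. -/
inductive MatchKind
  | zero | conveyor | zeroZero | zeroConveyor | conveyorConveyor | conveyorZero

open MatchKind in
/-- The ways in which the cells `(ρ, c)` and `(ρ', c')`, with rows counted from the start of a
block, can carry the same letter when the places in `F` are rotated at the start of that block. -/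
inductive LocalMatch (r m : ℤ) (F : ℤ → Prop) (ρ c ρ' c' : ℤ) : MatchKind → Prop
  | zero (h : ℤ) (hc : c = 2 * h + 1) (hc' : c' = c)
      (hF : ∀ p, 0 ≤ p → p < m → F p → ρ < 0 → 0 ≤ ρ' → c ≠ 6 * p + 3 ∧ c ≠ 6 * p + 5) :
      LocalMatch r m F ρ c ρ' c' zero
  | conveyor (h h' k : ℤ) (hc : c = 2 * h) (hc' : c' = 2 * h') (hk : ConveyorIndex r ρ h k)
      (hk' : ConveyorIndex r ρ' h' k)
      (hF : ∀ p, 0 ≤ p → p < m → F p → ρ < 0 → 0 ≤ ρ' → k ≠ 3 * p + 2 ∧ k ≠ 3 * p + 3) :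
      LocalMatch r m F ρ c ρ' c' conveyor
  | zeroZero (p : ℤ) (hp : 0 ≤ p) (hpm : p < m) (hF : F p) (hρ : ρ < 0) (hρ' : 0 ≤ ρ')
      (hc : c = 6 * p + 3) (hc' : c' = 6 * p + 5) :
      LocalMatch r m F ρ c ρ' c' zeroZero
  | zeroConveyor (p h' : ℤ) (hp : 0 ≤ p) (hpm : p < m) (hF : F p) (hρ : ρ < 0) (hρ' : 0 ≤ ρ')
      (hc : c = 6 * p + 5) (hc' : c' = 2 * h') (hk' : ConveyorIndex r ρ' h' (3 * p + 3)) :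
      LocalMatch r m F ρ c ρ' c' zeroConveyor
  | conveyorConveyor (p h h' : ℤ) (hp : 0 ≤ p) (hpm : p < m) (hF : F p) (hρ : ρ < 0) (hρ' : 0 ≤ ρ')
      (hc : c = 2 * h) (hk : ConveyorIndex r ρ h (3 * p + 3))
      (hc' : c' = 2 * h') (hk' : ConveyorIndex r ρ' h' (3 * p + 2)) :
      LocalMatch r m F ρ c ρ' c' conveyorConveyor
  | conveyorZero (p h : ℤ) (hp : 0 ≤ p) (hpm : p < m) (hF : F p) (hρ : ρ < 0) (hρ' : 0 ≤ ρ')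
      (hc : c = 2 * h) (hk : ConveyorIndex r ρ h (3 * p + 2)) (hc' : c' = 6 * p + 3) :
      LocalMatch r m F ρ c ρ' c' conveyorZero

/-- The cell `(ρ', c')` is `D` full rows and `e` columns after the cell `(ρ, c)`. -/
def CellShift (w D e ρ c ρ' c' : ℤ) : Prop :=
  0 ≤ c ∧ c < w ∧ 0 ≤ c' ∧ c' < w ∧
    ((ρ' = ρ + D ∧ c' = c + e) ∨ (ρ' = ρ + D + 1 ∧ c' = c + e - w))

section localMatch

variable {w r m D e : ℤ} {F : ℤ → Prop} {ρ c ρ' c' ρ₁ c₁ ρ₁' c₁' ρ₂ c₂ ρ₂' c₂' : ℤ}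
  {κ κ₁ κ₂ : MatchKind}

theorem LocalMatch.one_le (hr : w = 2 * r ∨ w + 1 = 2 * r) (hρ : -(r + 1) ≤ ρ) (hr5 : 5 ≤ r)
    (hD : 0 ≤ D) (hew : e < w) (hDe : 0 < D + e)
    (hs : CellShift w D e ρ c ρ' c') (h : LocalMatch r m F ρ c ρ' c' κ) : 1 ≤ D := by
  by_contra! hD1
  obtain rfl : D = 0 := by omega
  obtain ⟨_, _, _, _, _⟩ := hs
  rcases h with ⟨_, _, _, hF⟩ | ⟨_, _, _, _, _, ⟨_, _, _⟩, ⟨_, _, _⟩, hF⟩ |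
    ⟨p, hp, hpm, hf, _, _, _⟩ | ⟨p, _, hp, hpm, hf, _, _, _, _, ⟨_, _, _⟩⟩ |
    ⟨p, _, _, hp, hpm, hf, _, _, _, ⟨_, _, _⟩, _, ⟨_, _, _⟩⟩ |
    ⟨p, _, hp, hpm, hf, _, _, _, ⟨_, _, _⟩, _⟩ <;> omega

/-- The cell `(ρ₁, c₁)` follows the cell `(ρ, c)`. -/
def CellSucc (w ρ c ρ₁ c₁ : ℤ) : Prop :=
  (ρ₁ = ρ ∧ c₁ = c + 1) ∨ (ρ₁ = ρ + 1 ∧ c + 1 = w ∧ c₁ = 0)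

set_option maxHeartbeats 4000000 in
theorem LocalMatch.two_le (hr : w = 2 * r ∨ w + 1 = 2 * r) (hmw : 6 * m + 2 ≤ w)
    (hρ : -(r + 1) ≤ ρ) (hρr : ρ + 5 ≤ r) (hr5 : 5 ≤ r)
    (hD : 0 ≤ D) (he : 0 ≤ e) (hew : e < w) (hDe : 0 < D + e)
    (hs : CellShift w D e ρ c ρ' c') (hs₁ : CellShift w D e ρ₁ c₁ ρ₁' c₁')
    (hsucc : CellSucc w ρ c ρ₁ c₁) (hsucc' : CellSucc w ρ' c' ρ₁' c₁')
    (h : LocalMatch r m F ρ c ρ' c' κ) (h₁ : LocalMatch r m F ρ₁ c₁ ρ₁' c₁' κ₁) :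
    2 ≤ D := by
  have hD1 := h.one_le hr hρ hr5 hD hew hDe hs
  by_contra! hD2
  obtain rfl : D = 1 := by omega
  obtain ⟨_, _, _, _, _⟩ := hs
  obtain ⟨_, _, _, _, _⟩ := hs₁
  rcases hsucc with ⟨rfl, rfl⟩ | ⟨rfl, _, rfl⟩ <;>
  rcases hsucc' with ⟨rfl, rfl⟩ | ⟨rfl, _, rfl⟩ <;>
  rcases h with ⟨_, _, _, hF⟩ | ⟨_, _, _, _, _, ⟨_, _, _⟩, ⟨_, _, _⟩, hF⟩ |
    ⟨p, hp, hpm, hf, _, _, _⟩ | ⟨p, _, hp, hpm, hf, _, _, _, _, ⟨_, _, _⟩⟩ |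
    ⟨p, _, _, hp, hpm, hf, _, _, _, ⟨_, _, _⟩, _, ⟨_, _, _⟩⟩ |
    ⟨p, _, hp, hpm, hf, _, _, _, ⟨_, _, _⟩, _⟩ <;>
  rcases h₁ with ⟨_, _, _, hF₁⟩ | ⟨_, _, _, _, _, ⟨_, _, _⟩, ⟨_, _, _⟩, hF₁⟩ |
    ⟨p₁, hp₁, hpm₁, hf₁, _, _, _⟩ | ⟨p₁, _, hp₁, hpm₁, hf₁, _, _, _, _, ⟨_, _, _⟩⟩ |
    ⟨p₁, _, _, hp₁, hpm₁, hf₁, _, _, _, ⟨_, _, _⟩, _, ⟨_, _, _⟩⟩ |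
    ⟨p₁, _, hp₁, hpm₁, hf₁, _, _, _, ⟨_, _, _⟩, _⟩ <;>
  first
  | omega
  | (have := hF₁ p hp hpm hf; omega)
  | (have := hF p₁ hp₁ hpm₁ hf₁; omega)

open MatchKind in
/-- The pairs of kinds that can occur at consecutive cells when the shift is at least two rows. -/
inductive AdjacentKinds : MatchKind → MatchKind → Prop
  | conveyor_conveyorZero : AdjacentKinds conveyor conveyorZero
  | zeroZero_conveyorConveyor : AdjacentKinds zeroZero conveyorConveyor
  | zeroConveyor_conveyor : AdjacentKinds zeroConveyor conveyor
  | zeroConveyor_conveyorZero : AdjacentKinds zeroConveyor conveyorZero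
  | conveyorConveyor_zeroZero : AdjacentKinds conveyorConveyor zeroZero
  | conveyorConveyor_zeroConveyor : AdjacentKinds conveyorConveyor zeroConveyor
  | conveyorZero_conveyorConveyor : AdjacentKinds conveyorZero conveyorConveyor

set_option maxHeartbeats 4000000 in
theorem LocalMatch.adjacentKinds (hr : w = 2 * r ∨ w + 1 = 2 * r) (hmw : 6 * m + 2 ≤ w)
    (hρ : -(r + 1) ≤ ρ) (hρr : ρ + 5 ≤ r) (hr5 : 5 ≤ r)
    (he : 0 ≤ e) (hew : e < w) (hD2 : 2 ≤ D) (hD : D ≤ 4)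
    (hs : CellShift w D e ρ c ρ' c') (hs₁ : CellShift w D e ρ₁ c₁ ρ₁' c₁')
    (hsucc : CellSucc w ρ c ρ₁ c₁) (hsucc' : CellSucc w ρ' c' ρ₁' c₁')
    (h : LocalMatch r m F ρ c ρ' c' κ) (h₁ : LocalMatch r m F ρ₁ c₁ ρ₁' c₁' κ₁) :
    AdjacentKinds κ κ₁ := by
  obtain ⟨_, _, _, _, _⟩ := hs
  obtain ⟨_, _, _, _, _⟩ := hs₁
  rcases hsucc with ⟨rfl, rfl⟩ | ⟨rfl, _, rfl⟩ <;>
  rcases hsucc' with ⟨rfl, rfl⟩ | ⟨rfl, _, rfl⟩ <;>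
  rcases h with ⟨_, _, _, hF⟩ | ⟨_, _, _, _, _, ⟨_, _, _⟩, ⟨_, _, _⟩, hF⟩ |
    ⟨p, hp, hpm, hf, _, _, _⟩ | ⟨p, _, hp, hpm, hf, _, _, _, _, ⟨_, _, _⟩⟩ |
    ⟨p, _, _, hp, hpm, hf, _, _, _, ⟨_, _, _⟩, _, ⟨_, _, _⟩⟩ |
    ⟨p, _, hp, hpm, hf, _, _, _, ⟨_, _, _⟩, _⟩ <;>
  rcases h₁ with ⟨_, _, _, hF₁⟩ | ⟨_, _, _, _, _, ⟨_, _, _⟩, ⟨_, _, _⟩, hF₁⟩ |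
    ⟨p₁, hp₁, hpm₁, hf₁, _, _, _⟩ | ⟨p₁, _, hp₁, hpm₁, hf₁, _, _, _, _, ⟨_, _, _⟩⟩ |
    ⟨p₁, _, _, hp₁, hpm₁, hf₁, _, _, _, ⟨_, _, _⟩, _, ⟨_, _, _⟩⟩ |
    ⟨p₁, _, hp₁, hpm₁, hf₁, _, _, _, ⟨_, _, _⟩, _⟩ <;>
  first
  | constructor
  | (exfalso; omega)

set_option maxHeartbeats 4000000 in
theorem LocalMatch.not_three (hr : w = 2 * r ∨ w + 1 = 2 * r) (hmw : 6 * m + 2 ≤ w)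
    (hρ : -(r + 1) ≤ ρ) (hρr : ρ + 5 ≤ r) (hr5 : 5 ≤ r)
    (he : 0 ≤ e) (hew : e < w) (hD2 : 2 ≤ D) (hD : D ≤ 4) (hρr₁ : ρ₁ + 5 ≤ r)
    (hs : CellShift w D e ρ c ρ' c') (hs₁ : CellShift w D e ρ₁ c₁ ρ₁' c₁')
    (hsucc : CellSucc w ρ c ρ₁ c₁) (hsucc' : CellSucc w ρ' c' ρ₁' c₁')
    (h : LocalMatch r m F ρ c ρ' c' κ) (h₁ : LocalMatch r m F ρ₁ c₁ ρ₁' c₁' κ₁)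
    (hs₂ : CellShift w D e ρ₂ c₂ ρ₂' c₂') (hsucc₁ : CellSucc w ρ₁ c₁ ρ₂ c₂)
    (hsucc₁' : CellSucc w ρ₁' c₁' ρ₂' c₂')
    (h₂ : LocalMatch r m F ρ₂ c₂ ρ₂' c₂' κ₂) : False := by
  have a := h.adjacentKinds hr hmw hρ hρr hr5 he hew hD2 hD hs hs₁ hsucc hsucc' h₁
  have a₁ := h₁.adjacentKinds hr hmw (by unfold CellSucc at hsucc; omega) hρr₁ hr5 he hew hD2 hD
    hs₁ hs₂ hsucc₁ hsucc₁' h₂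
  obtain ⟨_, _, _, _, _⟩ := hs
  obtain ⟨_, _, _, _, _⟩ := hs₁
  obtain ⟨_, _, _, _, _⟩ := hs₂
  cases a <;> cases a₁ <;>
  rcases hsucc with ⟨rfl, rfl⟩ | ⟨rfl, _, rfl⟩ <;>
  rcases hsucc' with ⟨rfl, rfl⟩ | ⟨rfl, _, rfl⟩ <;>
  rcases hsucc₁ with ⟨rfl, rfl⟩ | ⟨rfl, _, rfl⟩ <;>
  rcases hsucc₁' with ⟨rfl, rfl⟩ | ⟨rfl, _, rfl⟩ <;>
  rcases h with ⟨_, _, _, hF⟩ | ⟨_, _, _, _, _, ⟨_, _, _⟩, ⟨_, _, _⟩, hF⟩ |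
    ⟨p, hp, hpm, hf, _, _, _⟩ | ⟨p, _, hp, hpm, hf, _, _, _, _, ⟨_, _, _⟩⟩ |
    ⟨p, _, _, hp, hpm, hf, _, _, _, ⟨_, _, _⟩, _, ⟨_, _, _⟩⟩ |
    ⟨p, _, hp, hpm, hf, _, _, _, ⟨_, _, _⟩, _⟩ <;>
  rcases h₁ with ⟨_, _, _, hF₁⟩ | ⟨_, _, _, _, _, ⟨_, _, _⟩, ⟨_, _, _⟩, hF₁⟩ |
    ⟨p₁, hp₁, hpm₁, hf₁, _, _, _⟩ | ⟨p₁, _, hp₁, hpm₁, hf₁, _, _, _, _, ⟨_, _, _⟩⟩ |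
    ⟨p₁, _, _, hp₁, hpm₁, hf₁, _, _, _, ⟨_, _, _⟩, _, ⟨_, _, _⟩⟩ |
    ⟨p₁, _, hp₁, hpm₁, hf₁, _, _, _, ⟨_, _, _⟩, _⟩ <;>
  rcases h₂ with ⟨_, _, _, hF₂⟩ | ⟨_, _, _, _, _, ⟨_, _, _⟩, ⟨_, _, _⟩, hF₂⟩ |
    ⟨p₂, hp₂, hpm₂, hf₂, _, _, _⟩ | ⟨p₂, _, hp₂, hpm₂, hf₂, _, _, _, _, ⟨_, _, _⟩⟩ |
    ⟨p₂, _, _, hp₂, hpm₂, hf₂, _, _, _, ⟨_, _, _⟩, _, ⟨_, _, _⟩⟩ |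
    ⟨p₂, _, hp₂, hpm₂, hf₂, _, _, _, ⟨_, _, _⟩, _⟩ <;>
  omega

end localMatch

/-- The position of `u` in the cycle `1 → 3 → 4 → 2 → 1`. -/
def cyclePosition (u : ℕ) : ℕ := if u = 1 then 0 else if u = 2 then 3 else u - 2

/-- The letter in slot `u` when the letters in the slots `6 * p + 3, …, 6 * p + 6` have been
rotated `X p` times, for all `p < m`. -/
def rotatedLetter (m : ℕ) (X : ℕ → ℕ) (u : ℕ) : ℕ :=
  if 2 ≤ u ∧ u < 6 * m + 2 ∧ 1 ≤ (u - 2) % 6 ∧ (u - 2) % 6 ≤ 4 then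
    6 * ((u - 2) / 6) + 3 + (cyclePosition ((u - 2) % 6) + 3 * X ((u - 2) / 6)) % 4
  else u

/-- The slot read at position `i`: odd columns keep their own slot, even columns read a conveyor
of `r + 1` slots that advances by one column in each row. -/
def conveyorSlot (w r i : ℕ) : ℕ :=
  if i % w % 2 = 1 then i % w
  else if 2 * (i / w % (r + 1)) ≤ i % w then i % w - 2 * (i / w % (r + 1))
  else i % w + 2 * r + 2 - 2 * (i / w % (r + 1))

/-- The number of rotations of place `p` before block `b`. -/
def rotationCount (K m b p : ℕ) : ℕ :=
  windowCount (fun x => ¬ rulerLevel K x % (m + 1) = p + 1) 0 b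

/-- The conveyor word: blocks consist of `r + 1` rows of width `w`, and at the start of each block
all places but at most one, chosen by the ruler sequence, are rotated. -/
def conveyorWord (w r m K i : ℕ) : ℕ :=
  min w (rotatedLetter m (rotationCount K m (i / w / (r + 1))) (conveyorSlot w r i))

section letters

variable {w r m K : ℕ}

theorem rotatedLetter_eq_cases {X Y : ℕ → ℕ} {u v : ℕ}
    (h : rotatedLetter m X u = rotatedLetter m Y v) :
    (u = v ∧ ∀ p < m, ¬ (6 * p + 3 ≤ u ∧ u ≤ 6 * p + 6)) ∨
    ∃ p < m, 6 * p + 3 ≤ u ∧ u ≤ 6 * p + 6 ∧ 6 * p + 3 ≤ v ∧ v ≤ 6 * p + 6 ∧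
      (cyclePosition (u - 2 - 6 * p) + 3 * X p) % 4 =
        (cyclePosition (v - 2 - 6 * p) + 3 * Y p) % 4 := by
  unfold rotatedLetter at h
  split_ifs at h with hu hv hv
  · have hp : (u - 2) / 6 = (v - 2) / 6 := by omega
    refine Or.inr ⟨(u - 2) / 6, by omega, by omega, by omega, by omega, by omega, ?_⟩
    rw [show u - 2 - 6 * ((u - 2) / 6) = (u - 2) % 6 by omega]
    rw [hp] at h ⊢
    rw [show v - 2 - 6 * ((v - 2) / 6) = (v - 2) % 6 by omega]
    omega
  · exfalso; omega
  · exfalso; omega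
  · exact Or.inl ⟨h, fun p hp => by omega⟩

theorem conveyorSlot_spec (hw : 0 < w) (hr : w = 2 * r ∨ w + 1 = 2 * r) (i : ℕ) :
    (i % w % 2 = 1 ∧ conveyorSlot w r i = i % w) ∨
    (i % w % 2 = 0 ∧ conveyorSlot w r i % 2 = 0 ∧ conveyorSlot w r i ≤ 2 * r ∧
      (i % w = conveyorSlot w r i + 2 * (i / w % (r + 1)) ∨
        i % w + 2 * r + 2 = conveyorSlot w r i + 2 * (i / w % (r + 1)))) := by
  have hτ := Nat.mod_lt (i / w) (by omega : 0 < r + 1)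
  have hc := Nat.mod_lt i hw
  unfold conveyorSlot
  split_ifs <;> omega

theorem rotatedLetter_eq_of_conveyorWord_eq (hr : w = 2 * r ∨ w + 1 = 2 * r)
    (hmw : 6 * m + 2 ≤ w) {i j : ℕ} (h : conveyorWord w r m K i = conveyorWord w r m K j) :
    rotatedLetter m (rotationCount K m (i / w / (r + 1))) (conveyorSlot w r i) =
      rotatedLetter m (rotationCount K m (j / w / (r + 1))) (conveyorSlot w r j) := by
  have hw : 0 < w := by omega
  have key : ∀ i, rotatedLetter m (rotationCount K m (i / w / (r + 1))) (conveyorSlot w r i) < w ∨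
      rotatedLetter m (rotationCount K m (i / w / (r + 1))) (conveyorSlot w r i) = 2 * r := by
    intro i
    have h1 := conveyorSlot_spec hw hr i
    have h2 := Nat.mod_lt i hw
    unfold rotatedLetter
    split_ifs <;> omega
  have h1 := key i
  have h2 := key j
  unfold conveyorWord at h
  omega

theorem conveyorWord_eq_cases (hr : w = 2 * r ∨ w + 1 = 2 * r)
    (hmw : 6 * m + 2 ≤ w) {i j : ℕ} (h : conveyorWord w r m K i = conveyorWord w r m K j) :
    (conveyorSlot w r i = conveyorSlot w r j ∧
      ∀ p < m, ¬ (6 * p + 3 ≤ conveyorSlot w r i ∧ conveyorSlot w r i ≤ 6 * p + 6)) ∨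
    ∃ p < m, 6 * p + 3 ≤ conveyorSlot w r i ∧ conveyorSlot w r i ≤ 6 * p + 6 ∧
      6 * p + 3 ≤ conveyorSlot w r j ∧ conveyorSlot w r j ≤ 6 * p + 6 ∧
      (cyclePosition (conveyorSlot w r i - 2 - 6 * p) +
        3 * rotationCount K m (i / w / (r + 1)) p) % 4 =
      (cyclePosition (conveyorSlot w r j - 2 - 6 * p) +
        3 * rotationCount K m (j / w / (r + 1)) p) % 4 :=
  rotatedLetter_eq_cases (rotatedLetter_eq_of_conveyorWord_eq hr hmw h)

theorem windowCount_add (P : ℕ → Prop) [DecidablePred P] (b q l : ℕ) :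
    windowCount P b (q + l) = windowCount P b q + windowCount P (b + q) l := by
  induction l with
  | zero => simp [windowCount]
  | succ l ih => rw [← Nat.add_assoc, windowCount_succ, windowCount_succ, ih]; grind

theorem rotationCount_add (K m b q p : ℕ) :
    rotationCount K m (b + q) p + classCount K (m + 1) (p + 1) b q =
      rotationCount K m b p + q := by
  unfold rotationCount
  rw [windowCount_add, Nat.zero_add, Nat.add_assoc]
  congr 1
  unfold classCount windowCount
  rw [Nat.add_comm, Finset.card_filter_add_card_filter_not]
  simp

theorem rotationCount_succ (K m b p : ℕ) :
    rotationCount K m (b + 1) p =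
      rotationCount K m b p + if rulerLevel K b % (m + 1) = p + 1 then 0 else 1 := by
  unfold rotationCount
  rw [windowCount_succ, Nat.zero_add]
  split_ifs <;> rfl

theorem conveyorWord_add (hw : 0 < w) (i : ℕ) :
    conveyorWord w r m K (i + 4 * 2 ^ K * ((r + 1) * w)) = conveyorWord w r m K i := by
  have h1 : (i + 4 * 2 ^ K * ((r + 1) * w)) % w = i % w := by
    rw [← Nat.mul_assoc, Nat.add_mul_mod_self_right]
  have h2 : (i + 4 * 2 ^ K * ((r + 1) * w)) / w = i / w + 4 * 2 ^ K * (r + 1) := by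
    rw [← Nat.mul_assoc, Nat.add_mul_div_right _ _ hw]
  have hs : conveyorSlot w r (i + 4 * 2 ^ K * ((r + 1) * w)) = conveyorSlot w r i := by
    unfold conveyorSlot
    rw [h1, h2, Nat.add_mul_mod_self_right]
  have h3 : ∀ p, rotationCount K m (i / w / (r + 1) + 4 * 2 ^ K) p % 4 =
      rotationCount K m (i / w / (r + 1)) p % 4 := by
    intro p
    have h4 := rotationCount_add K m (i / w / (r + 1)) (4 * 2 ^ K) p
    have h5 : 4 ∣ classCount K (m + 1) (p + 1) (i / w / (r + 1)) (4 * 2 ^ K) :=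
      four_dvd_classCount _ ⟨1, by ring⟩
    omega
  unfold conveyorWord
  rw [hs, h2, Nat.add_mul_div_right _ _ (by omega : 0 < r + 1)]
  unfold rotatedLetter
  have h4 := h3 ((conveyorSlot w r i - 2) / 6)
  congr 2
  omega

theorem add_div_mod_cases (hw : 0 < w) (i d : ℕ) :
    ((i + d) / w = i / w + d / w ∧ (i + d) % w = i % w + d % w) ∨
      ((i + d) / w = i / w + d / w + 1 ∧ (i + d) % w + w = i % w + d % w) := by
  have h1 := Nat.add_div (a := i) (b := d) hw
  have h2 := Nat.add_mod_add_ite i d w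
  split_ifs at h1 h2 <;> omega

theorem add_div_mod_cases_of_lt {e : ℕ} (he : e < w) (i : ℕ) :
    ((i + e) / w = i / w ∧ (i + e) % w = i % w + e) ∨
      ((i + e) / w = i / w + 1 ∧ (i + e) % w + w = i % w + e) := by
  have h := add_div_mod_cases (w := w) (by omega) i e
  rwa [Nat.div_eq_of_lt he, Nat.mod_eq_of_lt he] at h

theorem cellShift_add (hw : 0 < w) (i d : ℕ) (q : ℤ) :
    CellShift w (d / w : ℕ) (d % w : ℕ) ((i / w : ℕ) - q) (i % w : ℕ)
      (((i + d) / w : ℕ) - q) ((i + d) % w : ℕ) := by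
  have h := add_div_mod_cases hw i d
  have h1 := Nat.mod_lt i hw
  have h2 := Nat.mod_lt (i + d) hw
  unfold CellShift
  omega

theorem cellSucc_add_one (hw : 1 < w) (i : ℕ) (q : ℤ) :
    CellSucc w ((i / w : ℕ) - q) (i % w : ℕ) (((i + 1) / w : ℕ) - q) ((i + 1) % w : ℕ) := by
  have h := add_div_mod_cases_of_lt hw i
  have h1 := Nat.mod_lt i (by omega : 0 < w)
  have h2 := Nat.mod_lt (i + 1) (by omega : 0 < w)
  unfold CellSucc
  omega

/-- Slot `u` is the one read at the cell `(ρ, c)`. -/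
def SlotCell (r : ℕ) (ρ : ℤ) (c u : ℕ) : Prop :=
  (c % 2 = 1 ∧ u = c) ∨
    (c % 2 = 0 ∧ u % 2 = 0 ∧ ConveyorIndex r ρ (c / 2 : ℕ) (u / 2 : ℕ))

theorem slotCell_conveyorSlot (hw : 0 < w) (hr : w = 2 * r ∨ w + 1 = 2 * r) (i : ℕ) {q : ℤ}
    (h : ((i / w : ℕ) : ℤ) - q = (i / w % (r + 1) : ℕ) ∨
      ((i / w : ℕ) : ℤ) - q + r + 1 = (i / w % (r + 1) : ℕ)) :
    SlotCell r ((i / w : ℕ) - q) (i % w) (conveyorSlot w r i) := by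
  have hs := conveyorSlot_spec hw hr i
  have hτ := Nat.mod_lt (i / w) (by omega : 0 < r + 1)
  generalize ((i / w : ℕ) : ℤ) - q = ρ at *
  generalize i / w % (r + 1) = τ at *
  generalize conveyorSlot w r i = u at *
  generalize i % w = c at *
  unfold SlotCell ConveyorIndex
  omega

theorem row_sub_eq_or {b i : ℕ} {q : ℤ} (hq : q = ((b : ℤ) + 1) * (r + 1))
    (hi : i / w / (r + 1) = b ∨ i / w / (r + 1) = b + 1) :
    (i / w / (r + 1) = b + 1 ∧ ((i / w : ℕ) : ℤ) - q = (i / w % (r + 1) : ℕ)) ∨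
      (i / w / (r + 1) = b ∧ ((i / w : ℕ) : ℤ) - q + r + 1 = (i / w % (r + 1) : ℕ)) := by
  have h1 := Nat.div_add_mod (i / w) (r + 1)
  rcases hi with hi | hi
  · refine Or.inr ⟨hi, ?_⟩
    rw [hi] at h1
    have h2 : (((r + 1) * b + i / w % (r + 1) : ℕ) : ℤ) = (i / w : ℕ) := by rw [h1]
    rw [← h2, hq]; push_cast; ring
  · refine Or.inl ⟨hi, ?_⟩
    rw [hi] at h1
    have h2 : (((r + 1) * (b + 1) + i / w % (r + 1) : ℕ) : ℤ) = (i / w : ℕ) := by rw [h1]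
    rw [← h2, hq]; push_cast; ring

theorem SlotCell.localMatch_of_eq {F : ℤ → Prop} {ρ ρ' : ℤ} {c c' u : ℕ} (h : SlotCell r ρ c u)
    (h' : SlotCell r ρ' c' u)
    (hF : ∀ p : ℤ, 0 ≤ p → p < m → F p → ρ < 0 → 0 ≤ ρ' → ¬ (6 * p + 3 ≤ u ∧ u ≤ 6 * p + 6)) :
    ∃ κ, LocalMatch r m F ρ c ρ' c' κ := by
  rcases h with ⟨h1, h2⟩ | ⟨h1, h2, h3⟩ <;> rcases h' with ⟨h1', h2'⟩ | ⟨h1', h2', h3'⟩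
  · refine ⟨_, LocalMatch.zero (c / 2 : ℕ) (by omega) (by omega) fun p h5 h6 h7 h8 h9 => ?_⟩
    have := hF p h5 h6 h7 h8 h9
    omega
  · omega
  · omega
  · refine ⟨_, LocalMatch.conveyor _ _ _ (by omega) (by omega) h3 h3' fun p h5 h6 h7 h8 h9 => ?_⟩
    have := hF p h5 h6 h7 h8 h9
    omega

theorem SlotCell.localMatch_of_rotation {F : ℤ → Prop} {ρ ρ' : ℤ} {p c c' u v : ℕ}
    (h : SlotCell r ρ c u) (h' : SlotCell r ρ' c' v) (hp : p < m) (hF : F p) (hρ : ρ < 0)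
    (hρ' : 0 ≤ ρ')
    (huv : (u = 6 * p + 3 ∧ v = 6 * p + 5) ∨ (u = 6 * p + 5 ∧ v = 6 * p + 6) ∨
        (u = 6 * p + 6 ∧ v = 6 * p + 4) ∨ (u = 6 * p + 4 ∧ v = 6 * p + 3)) :
    ∃ κ, LocalMatch r m F ρ c ρ' c' κ := by
  rcases h with ⟨h1, h2⟩ | ⟨h1, h2, h3⟩ <;> rcases h' with ⟨h1', h2'⟩ | ⟨h1', h2', h3'⟩
  · exact ⟨_, LocalMatch.zeroZero p (by omega) (by omega) hF hρ hρ' (by omega) (by omega)⟩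
  · refine ⟨_, LocalMatch.zeroConveyor p _ (by omega) (by omega) hF hρ hρ' (by omega)
      (by omega : (c' : ℤ) = 2 * (c' / 2 : ℕ)) ?_⟩
    rwa [show (3 * p + 3 : ℤ) = (v / 2 : ℕ) by omega]
  · refine ⟨_, LocalMatch.conveyorZero p _ (by omega) (by omega) hF hρ hρ'
      (by omega : (c : ℤ) = 2 * (c / 2 : ℕ)) ?_ (by omega)⟩
    rwa [show (3 * p + 2 : ℤ) = (u / 2 : ℕ) by omega]
  · refine ⟨_, LocalMatch.conveyorConveyor p _ _ (by omega) (by omega) hF hρ hρ'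
      (by omega : (c : ℤ) = 2 * (c / 2 : ℕ)) ?_ (by omega : (c' : ℤ) = 2 * (c' / 2 : ℕ)) ?_⟩
    · rwa [show (3 * p + 3 : ℤ) = (u / 2 : ℕ) by omega]
    · rwa [show (3 * p + 2 : ℤ) = (v / 2 : ℕ) by omega]

theorem cyclePosition_cases {p u v x y : ℕ} (hu : 6 * p + 3 ≤ u) (hu' : u ≤ 6 * p + 6)
    (hv : 6 * p + 3 ≤ v) (hv' : v ≤ 6 * p + 6)
    (h : (cyclePosition (u - 2 - 6 * p) + 3 * x) % 4 = (cyclePosition (v - 2 - 6 * p) + 3 * y) % 4) :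
    (x = y → u = v) ∧ (y = x + 1 →
      (u = 6 * p + 3 ∧ v = 6 * p + 5) ∨ (u = 6 * p + 5 ∧ v = 6 * p + 6) ∨
      (u = 6 * p + 6 ∧ v = 6 * p + 4) ∨ (u = 6 * p + 4 ∧ v = 6 * p + 3)) ∧
    (u = v → x % 4 = y % 4) := by
  unfold cyclePosition at h
  split_ifs at h <;> omega

theorem exists_localMatch (hr : w = 2 * r ∨ w + 1 = 2 * r) (hmw : 6 * m + 2 ≤ w) {b i j : ℕ}
    {q : ℤ} (hq : q = ((b : ℤ) + 1) * (r + 1))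
    (hi : i / w / (r + 1) = b ∨ i / w / (r + 1) = b + 1)
    (hj : j / w / (r + 1) = b ∨ j / w / (r + 1) = b + 1) (hij : i ≤ j)
    (h : conveyorWord w r m K i = conveyorWord w r m K j) :
    ∃ κ, LocalMatch r m (fun p => ¬ ((rulerLevel K b % (m + 1) : ℕ) : ℤ) = p + 1)
      ((i / w : ℕ) - q) (i % w : ℕ) ((j / w : ℕ) - q) (j % w : ℕ) κ := by
  have hw : 0 < w := by omega
  have hb : i / w / (r + 1) ≤ j / w / (r + 1) :=
    Nat.div_le_div_right (Nat.div_le_div_right hij)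
  have hri := row_sub_eq_or hq hi
  have hrj := row_sub_eq_or hq hj
  have hsi := slotCell_conveyorSlot hw hr i (q := q) (by omega)
  have hsj := slotCell_conveyorSlot hw hr j (q := q) (by omega)
  have hτi := Nat.mod_lt (i / w) (by omega : 0 < r + 1)
  have hi' : ((i / w : ℕ) : ℤ) - q < 0 ↔ i / w / (r + 1) = b := by omega
  have hj' : 0 ≤ ((j / w : ℕ) : ℤ) - q ↔ j / w / (r + 1) = b + 1 := by
    have hτj := Nat.mod_lt (j / w) (by omega : 0 < r + 1)
    omega
  clear hri hrj hτi
  rcases conveyorWord_eq_cases hr hmw h with ⟨h1, h2⟩ | ⟨p, hp, hu, hu', hv, hv', hX⟩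
  · rw [← h1] at hsj
    refine hsi.localMatch_of_eq hsj fun p h5 h6 _ _ _ => ?_
    have := h2 p.toNat (by clear hi' hj' hi hj; omega)
    clear hi' hj' hi hj
    omega
  obtain ⟨hX1, hX2, -⟩ := cyclePosition_cases hu hu' hv hv' hX
  by_cases hflip : i / w / (r + 1) = b ∧ j / w / (r + 1) = b + 1 ∧
      ¬ rulerLevel K b % (m + 1) = p + 1
  · obtain ⟨hib, hjb, hF⟩ := hflip
    refine hsi.localMatch_of_rotation hsj hp (by exact_mod_cast hF) (hi'.2 hib) (hj'.2 hjb) (hX2 ?_)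
    rw [hib, hjb, rotationCount_succ, if_neg hF]
  · have hx : rotationCount K m (i / w / (r + 1)) p = rotationCount K m (j / w / (r + 1)) p := by
      rcases hi with hi | hi <;> rcases hj with hj | hj
      · rw [hi, hj]
      · rw [hi, hj, rotationCount_succ, if_pos (by_contra fun hc => hflip ⟨hi, hj, hc⟩), Nat.add_zero]
      · omega
      · rw [hi, hj]
    rw [← hX1 hx] at hsj
    refine hsi.localMatch_of_eq hsj fun p' h5 h6 h7 h8 h9 => ?_
    rintro ⟨h10, h11⟩
    obtain rfl : p' = p := by clear hi' hj' hi hj hb hX hX1 hX2; omega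
    exact hflip ⟨hi'.1 h8, hj'.1 h9, by exact_mod_cast h7⟩

/-- Short shifts produce only short overlaps. -/
theorem conveyorWord_short (hr : w = 2 * r ∨ w + 1 = 2 * r) (hmw : 6 * m + 2 ≤ w) (hm : 7 ≤ m)
    {s d E : ℕ} (hd : 0 < d) (hdw : d < 5 * w)
    (h : ∀ k < E, conveyorWord w r m K (s + k) = conveyorWord w r m K (s + k + d)) :
    E * w ≤ d := by
  have hw : 0 < w := by omega
  have hDe := Nat.div_add_mod d w
  have hew := Nat.mod_lt d hw
  have hD4 : d / w < 5 := (Nat.div_lt_iff_lt_mul hw).2 hdw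
  obtain ⟨b, hb⟩ : ∃ b, s / w / (r + 1) = b := ⟨_, rfl⟩
  have hτ := Nat.mod_lt (s / w) (by omega : 0 < r + 1)
  have hR := Nat.div_add_mod (s / w) (r + 1)
  rw [hb] at hR
  obtain ⟨q, hq⟩ : ∃ q : ℤ, q = ((b : ℤ) + 1) * (r + 1) := ⟨_, rfl⟩
  have hblock : ∀ x, x < 5 * w + 2 → (s + x) / w / (r + 1) = b ∨ (s + x) / w / (r + 1) = b + 1 := by
    intro x hx
    have h1 : s / w ≤ (s + x) / w := Nat.div_le_div_right (by omega)
    have h2 : (s + x) / w ≤ s / w + 6 := by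
      rw [← Nat.lt_add_one_iff, Nat.div_lt_iff_lt_mul hw]
      have := Nat.div_add_mod s w
      have := Nat.mod_lt s hw
      nlinarith
    have h3 : b ≤ (s + x) / w / (r + 1) := by
      rw [Nat.le_div_iff_mul_le (by omega), Nat.mul_comm]; omega
    have h4 : (s + x) / w / (r + 1) < b + 2 := by
      rw [Nat.div_lt_iff_lt_mul (by omega), Nat.mul_comm, Nat.mul_add]; omega
    omega
  have hmatch : ∀ k < 3, k < E → ∃ κ, LocalMatch r m
      (fun p => ¬ ((rulerLevel K b % (m + 1) : ℕ) : ℤ) = p + 1)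
      (((s + k) / w : ℕ) - q) ((s + k) % w : ℕ)
      (((s + k + d) / w : ℕ) - q) ((s + k + d) % w : ℕ) κ := by
    intro k hk hkE
    refine exists_localMatch hr hmw hq (hblock k (by omega)) ?_ (by omega) (h k hkE)
    rw [Nat.add_assoc]
    exact hblock _ (by omega)
  have hshift : ∀ k, CellShift w (d / w : ℕ) (d % w : ℕ)
      (((s + k) / w : ℕ) - q) ((s + k) % w : ℕ)
      (((s + k + d) / w : ℕ) - q) ((s + k + d) % w : ℕ) :=
    fun k => cellShift_add hw _ _ _
  have hsucc : ∀ k, CellSucc w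
      (((s + k) / w : ℕ) - q) ((s + k) % w : ℕ)
      (((s + (k + 1)) / w : ℕ) - q) ((s + (k + 1)) % w : ℕ) :=
    fun k => cellSucc_add_one (by omega) _ _
  have hsucc' : ∀ k, CellSucc w
      (((s + k + d) / w : ℕ) - q) ((s + k + d) % w : ℕ)
      (((s + (k + 1) + d) / w : ℕ) - q) ((s + (k + 1) + d) % w : ℕ) := by
    intro k
    rw [show s + (k + 1) + d = s + k + d + 1 by omega]
    exact cellSucc_add_one (by omega) _ _
  have hρ : ∀ k < 3, -((r : ℤ) + 1) ≤ ((s + k) / w : ℕ) - q ∧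
      ((s + k) / w : ℕ) - q + 5 ≤ r := by
    intro k hk
    have h1 := add_div_mod_cases_of_lt (by omega : k < w) s
    have h2 : q = ((r + 1) * b : ℕ) + (r + 1) := by rw [hq]; push_cast; ring
    omega
  have hrz : (w : ℤ) = 2 * r ∨ (w : ℤ) + 1 = 2 * r := by omega
  have hmz : 6 * (m : ℤ) + 2 ≤ w := by omega
  have hr5 : 5 ≤ (r : ℤ) := by omega
  have he : (0 : ℤ) ≤ (d % w : ℕ) := by omega
  have hewz : ((d % w : ℕ) : ℤ) < w := by omega
  have hD0 : (0 : ℤ) ≤ (d / w : ℕ) := Int.natCast_nonneg _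
  have hDez : (0 : ℤ) < (d / w : ℕ) + (d % w : ℕ) := by
    have : d / w = 0 → d % w = d := fun h => by rw [h] at hDe; omega
    omega
  rcases Nat.lt_or_ge E 1 with hE1 | hE1
  · obtain rfl : E = 0 := by omega
    omega
  obtain ⟨κ₀, h₀⟩ := hmatch 0 (by omega) (by omega)
  rcases Nat.lt_or_ge E 2 with hE2 | hE2
  · obtain rfl : E = 1 := by omega
    have := h₀.one_le hrz (hρ 0 (by omega)).1 hr5 hD0 hewz hDez (hshift 0)
    rw [← Nat.le_div_iff_mul_le hw]
    omega
  obtain ⟨κ₁, h₁⟩ := hmatch 1 (by omega) (by omega)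
  have hD2 := h₀.two_le hrz hmz (hρ 0 (by omega)).1 (hρ 0 (by omega)).2 hr5 hD0 he hewz hDez
    (hshift 0) (hshift 1) (hsucc 0) (hsucc' 0) h₁
  rcases Nat.lt_or_ge E 3 with hE3 | hE3
  · rw [← Nat.le_div_iff_mul_le hw]
    omega
  obtain ⟨κ₂, h₂⟩ := hmatch 2 (by omega) (by omega)
  exact (h₀.not_three hrz hmz (hρ 0 (by omega)).1 (hρ 0 (by omega)).2 hr5 he hewz hD2 (by omega)
    (hρ 1 (by omega)).2 (hshift 0) (hshift 1) (hsucc 0) (hsucc' 0) h₁ (hshift 2) (hsucc 1)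
    (hsucc' 1) h₂).elim

theorem conveyorSlot_eq_of_fixed (hr : w = 2 * r ∨ w + 1 = 2 * r) (hmw : 6 * m + 2 ≤ w) {i j : ℕ}
    (h : conveyorWord w r m K i = conveyorWord w r m K j)
    (hfix : conveyorSlot w r i % 6 ≤ 2 ∧ (conveyorSlot w r i % 6 = 0 → conveyorSlot w r i = 0) ∨
      6 * m < conveyorSlot w r i) :
    conveyorSlot w r i = conveyorSlot w r j := by
  rcases conveyorWord_eq_cases hr hmw h with ⟨h1, -⟩ | ⟨p, hp, hu, hu', -, -, -⟩
  · exact h1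
  · omega

theorem exists_fixed_odd (hmw : 6 * m + 2 ≤ w) (hm : 7 ≤ m)
    (s : ℕ) : ∃ k < 6, (s + k) % w % 2 = 1 ∧ ((s + k) % w % 6 = 1 ∨ 6 * m < (s + k) % w) := by
  have hw : 0 < w := by omega
  have hc := Nat.mod_lt s hw
  have key : ∀ k < 6, k < 6 ∧ _ := fun k hk =>
    ⟨hk, add_div_mod_cases_of_lt (by omega : k < w) s⟩
  have hlt : ∀ k, (s + k) % w < w := fun k => Nat.mod_lt _ hw
  rcases Nat.lt_or_ge w (s % w + 6) with h | h
  · have h1 := key (w + 1 - s % w)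
    have h2 := key (w - 1 - s % w)
    have h3 := key (w - 2 - s % w)
    have h4 := hlt (w + 1 - s % w)
    have h5 := hlt (w - 1 - s % w)
    have h6 := hlt (w - 2 - s % w)
    by_cases h7 : s % w + 5 = w
    · by_cases h8 : (w - 1) % 2 = 1
      · exact ⟨w - 1 - s % w, by omega⟩
      · exact ⟨w - 2 - s % w, by omega⟩
    · exact ⟨w + 1 - s % w, by omega⟩
  · have h1 := key ((7 - s % w % 6) % 6) (by omega)
    have h2 := hlt ((7 - s % w % 6) % 6)
    exact ⟨(7 - s % w % 6) % 6, by omega⟩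

theorem conveyorSlot_next_even (hr : w = 2 * r ∨ w + 1 = 2 * r) (hw : 5 ≤ w) {i : ℕ}
    (hi : i % w % 2 = 0) : ∃ k, 1 ≤ k ∧ k ≤ 2 ∧ (i + k) % w % 2 = 0 ∧
      conveyorSlot w r i ≤ 2 * r ∧ conveyorSlot w r i % 2 = 0 ∧
      (conveyorSlot w r (i + k) = conveyorSlot w r i + 2 ∧ conveyorSlot w r (i + k) ≤ 2 * r ∨
        conveyorSlot w r (i + k) = 0) := by
  have hw0 : 0 < w := by omega
  have hc := Nat.mod_lt i hw0
  have hs := conveyorSlot_spec hw0 hr i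
  have hτ := Nat.mod_lt (i / w) (by omega : 0 < r + 1)
  have hsucc : (i / w + 1) % (r + 1) = i / w % (r + 1) + 1 ∨
      (i / w + 1) % (r + 1) = 0 ∧ i / w % (r + 1) = r := by
    have := add_div_mod_cases_of_lt (by omega : 1 < r + 1) (i / w)
    have := Nat.mod_lt (i / w + 1) (by omega : 0 < r + 1)
    omega
  by_cases h : i % w + 2 < w
  · have h1 := add_div_mod_cases_of_lt (by omega : 2 < w) i
    have h2 := conveyorSlot_spec hw0 hr (i + 2)
    have h3 := Nat.mod_lt (i + 2) hw0
    have h4 : (i + 2) / w = i / w := by omega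
    rw [h4] at h2
    exact ⟨2, by omega⟩
  · have key : ∀ k, k = 1 ∨ k = 2 → i % w + k = w → ∃ k, 1 ≤ k ∧ k ≤ 2 ∧ (i + k) % w % 2 = 0 ∧
        conveyorSlot w r i ≤ 2 * r ∧ conveyorSlot w r i % 2 = 0 ∧
        (conveyorSlot w r (i + k) = conveyorSlot w r i + 2 ∧ conveyorSlot w r (i + k) ≤ 2 * r ∨
          conveyorSlot w r (i + k) = 0) := by
      intro k hk hkw
      have h1 := add_div_mod_cases_of_lt (by omega : k < w) i
      have h2 := conveyorSlot_spec hw0 hr (i + k)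
      have h3 := Nat.mod_lt (i + k) hw0
      have h4 : (i + k) / w = i / w + 1 := by omega
      rw [h4] at h2
      exact ⟨k, by omega⟩
    by_cases h5 : i % w + 1 = w
    · exact key 1 (by omega) h5
    · exact key 2 (by omega) (by omega)

theorem exists_fixed_even (hr : w = 2 * r ∨ w + 1 = 2 * r) (hw : 5 ≤ w) (s : ℕ) :
    ∃ k < 6, (s + k) % w % 2 = 0 ∧ conveyorSlot w r (s + k) % 6 ≤ 2 ∧
      (conveyorSlot w r (s + k) % 6 = 0 → conveyorSlot w r (s + k) = 0) := by
  obtain ⟨a, ha, hs⟩ : ∃ a ≤ 1, (s + a) % w % 2 = 0 := by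
    by_cases h : s % w % 2 = 0
    · exact ⟨0, by omega, h⟩
    · have h1 := add_div_mod_cases_of_lt (by omega : 1 < w) s
      have h2 := Nat.mod_lt s (by omega : 0 < w)
      exact ⟨1, le_rfl, by omega⟩
  obtain ⟨k, hk1, hk2, hk, h1, h2, h3⟩ := conveyorSlot_next_even hr hw hs
  obtain ⟨l, hl1, hl2, hl, h4, h5, h6⟩ := conveyorSlot_next_even hr hw hk
  rw [Nat.add_assoc s a k] at hk h3 h4 h5 h6 hl
  rw [Nat.add_assoc s, Nat.add_assoc a] at h6 hl
  by_cases h7 : conveyorSlot w r (s + a) % 6 = 2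
  · exact ⟨a, by omega⟩
  · by_cases h8 : conveyorSlot w r (s + (a + k)) % 6 = 2 ∨ conveyorSlot w r (s + (a + k)) = 0
    · exact ⟨a + k, by omega⟩
    · exact ⟨a + (k + l), by omega⟩

/-- Overlaps of length at least six only occur for shifts by a multiple of the block length. -/
theorem dvd_of_six_le (hr : w = 2 * r ∨ w + 1 = 2 * r) (hmw : 6 * m + 2 ≤ w) (hm : 7 ≤ m)
    {s d : ℕ} (h : ∀ k < 6, conveyorWord w r m K (s + k) = conveyorWord w r m K (s + k + d)) :
    (r + 1) * w ∣ d := by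
  have hw : 0 < w := by omega
  have hwd : w ∣ d := by
    obtain ⟨k, hk, hodd, hfix⟩ := exists_fixed_odd hmw hm s
    have h1 := conveyorSlot_spec hw hr (s + k)
    have h2 := conveyorSlot_spec hw hr (s + k + d)
    have h3 := conveyorSlot_eq_of_fixed hr hmw (h k hk) (by omega)
    have h4 := add_div_mod_cases hw (s + k) d
    have h5 := Nat.mod_lt d hw
    have h6 := Nat.mod_lt (s + k) hw
    exact Nat.dvd_of_mod_eq_zero (by omega)
  obtain ⟨d, rfl⟩ := hwd
  obtain ⟨k, hk, heven, hfix⟩ := exists_fixed_even hr (by omega) s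
  have h1 := conveyorSlot_spec hw hr (s + k)
  have h2 := conveyorSlot_spec hw hr (s + k + w * d)
  have h3 := conveyorSlot_eq_of_fixed hr hmw (h k hk) (Or.inl hfix)
  rw [Nat.add_mul_mod_self_left, Nat.add_mul_div_left _ _ hw] at h2
  have h4 := Nat.mod_lt ((s + k) / w) (by omega : 0 < r + 1)
  have h5 := Nat.mod_lt ((s + k) / w + d) (by omega : 0 < r + 1)
  have h6 : ((s + k) / w + d) % (r + 1) = ((s + k) / w) % (r + 1) := by omega
  have h7 := add_div_mod_cases (by omega : 0 < r + 1) ((s + k) / w) d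
  have h8 := Nat.mod_lt d (by omega : 0 < r + 1)
  rw [Nat.mul_comm w]
  exact Nat.mul_dvd_mul_right (Nat.dvd_of_mod_eq_zero (by omega)) w

theorem classCount_of_conveyorWord_eq (hr : w = 2 * r ∨ w + 1 = 2 * r) (hmw : 6 * m + 2 ≤ w)
    {i q p : ℕ} (hp : p < m) (hi : i % w = 6 * p + 3 ∨ i % w = 6 * p + 5)
    (h : conveyorWord w r m K i = conveyorWord w r m K (i + q * ((r + 1) * w))) :
    classCount K (m + 1) (p + 1) (i / w / (r + 1)) q % 4 = q % 4 := by
  have hw : 0 < w := by omega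
  have h1 := conveyorSlot_spec hw hr i
  have h2 := conveyorSlot_spec hw hr (i + q * ((r + 1) * w))
  have h3 := conveyorWord_eq_cases hr hmw h
  rw [← Nat.mul_assoc, Nat.add_mul_mod_self_right] at h2
  rw [← Nat.mul_assoc, Nat.add_mul_div_right _ _ hw,
    Nat.add_mul_div_right _ _ (by omega : 0 < r + 1)] at h3
  rcases h3 with ⟨-, h3⟩ | ⟨p', hp', hu, hu', hv, hv', hX⟩
  · have := h3 p hp
    omega
  · have h4 := (cyclePosition_cases hu hu' hv hv' hX).2.2 (by omega)
    obtain rfl : p' = p := by omega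
    have h5 := rotationCount_add K m (i / w / (r + 1)) q p'
    omega

theorem exists_column {c : ℕ} (hc : c < w) (a : ℕ) : ∃ k < w, (a + k) % w = c := by
  have ha := Nat.mod_lt a (by omega : 0 < w)
  rcases Nat.lt_or_ge c (a % w) with h | h
  · have h1 := add_div_mod_cases_of_lt (by omega : c + w - a % w < w) a
    have h2 := Nat.mod_lt (a + (c + w - a % w)) (by omega : 0 < w)
    exact ⟨c + w - a % w, by omega, by omega⟩
  · have h1 := add_div_mod_cases_of_lt (by omega : c - a % w < w) a
    exact ⟨c - a % w, by omega, by omega⟩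

theorem exists_adjacent_places (hmw : 6 * m + 2 ≤ w) (hmw' : w ≤ 6 * m + 7) (hm : 7 ≤ m) (s : ℕ) :
    ∃ k l p, k < 24 ∧ l < 24 ∧ p + 1 < m ∧ (s + k) % w = 6 * p + 5 ∧
      (s + l) % w = 6 * (p + 1) + 3 ∧ (s + k) / w = (s + l) / w := by
  have hw : 0 < w := by omega
  have hc := Nat.mod_lt s hw
  have hsame : ∀ k < 24, s % w + k < w → (s + k) % w = s % w + k ∧ (s + k) / w = s / w := by
    intro k hk hkw
    have := add_div_mod_cases_of_lt (by omega : k < w) s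
    have := Nat.mod_lt (s + k) hw
    omega
  have hnext : ∀ c, s % w + 23 ≥ c + w →
      (s + (c + w - s % w)) % w = c ∧ (s + (c + w - s % w)) / w = s / w + 1 := by
    intro c hk
    have := add_div_mod_cases_of_lt (by omega : c + w - s % w < w) s
    have := Nat.mod_lt (s + (c + w - s % w)) hw
    omega
  by_cases h1 : s % w + 23 < w
  · have h2 := hsame ((11 - s % w % 6) % 6) (by omega) (by omega)
    have h3 := hsame ((11 - s % w % 6) % 6 + 4) (by omega) (by omega)
    exact ⟨(11 - s % w % 6) % 6, (11 - s % w % 6) % 6 + 4, (s % w + (11 - s % w % 6) % 6 - 5) / 6,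
      by omega⟩
  · by_cases h2 : s % w + 23 ≥ 9 + w
    · have h3 := hnext 5 (by omega)
      have h4 := hnext 9 (by omega)
      exact ⟨5 + w - s % w, 9 + w - s % w, 0, by omega⟩
    · have h3 := hsame (6 * (m - 2) + 5 - s % w) (by omega) (by omega)
      have h4 := hsame (6 * (m - 2) + 9 - s % w) (by omega) (by omega)
      exact ⟨6 * (m - 2) + 5 - s % w, 6 * (m - 2) + 9 - s % w, m - 2, by omega⟩

theorem conveyorWord_block (hr : w = 2 * r ∨ w + 1 = 2 * r) (hmw : 6 * m + 2 ≤ w)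
    (hmw' : w ≤ 6 * m + 7) (hm : 7 ≤ m) {s : ℕ}
    (h : ∀ k < 24, conveyorWord w r m K (s + k) = conveyorWord w r m K (s + k + (r + 1) * w)) :
    False := by
  obtain ⟨k, l, p, hk, hl, hp, h1, h2, h3⟩ := exists_adjacent_places hmw hmw' hm s
  have h4 := classCount_of_conveyorWord_eq (q := 1) hr hmw (by omega : p < m) (Or.inr h1)
    (by rw [Nat.one_mul]; exact h k hk)
  have h5 := classCount_of_conveyorWord_eq (q := 1) hr hmw hp (Or.inl h2)
    (by rw [Nat.one_mul]; exact h l hl)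
  rw [h3] at h4
  unfold classCount at h4 h5
  rw [windowCount_succ] at h4 h5
  simp only [windowCount, Nat.add_zero, Finset.Ico_self, Finset.filter_empty,
    Finset.card_empty] at h4 h5
  split_ifs at h4 h5
  omega

theorem classCount_of_overlap (hr : w = 2 * r ∨ w + 1 = 2 * r) (hmw : 6 * m + 2 ≤ w)
    {s q E a b p : ℕ} (hp : p < m)
    (h : ∀ k < E, conveyorWord w r m K (s + k) =
      conveyorWord w r m K (s + k + q * ((r + 1) * w)))
    (hsa : s ≤ a) (haE : a + w ≤ s + E) (hba : b * ((r + 1) * w) ≤ a)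
    (hab : a + w ≤ (b + 1) * ((r + 1) * w)) :
    classCount K (m + 1) (p + 1) b q % 4 = q % 4 := by
  obtain ⟨k, hk, hak⟩ := exists_column (by omega : 6 * p + 3 < w) a
  have h1 := h (a + k - s) (by omega)
  rw [show s + (a + k - s) = a + k by omega] at h1
  have h2 := classCount_of_conveyorWord_eq hr hmw hp (Or.inl hak) h1
  have h3 : (a + k) / w / (r + 1) = b := by
    rw [Nat.div_div_eq_div_mul, Nat.mul_comm w]
    refine Nat.div_eq_of_lt_le (by omega) (by omega)
  rwa [h3] at h2

theorem not_classCount_of_small (hK : 1 ≤ K) {b q : ℕ} (hq : 2 ≤ q) (hq4 : q < 4)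
    (h : classCount K (m + 1) 1 b q % 4 = q % 4) : False := by
  have h1 : ∀ x, x % 2 = 1 → ¬ rulerLevel K x % (m + 1) = 1 := by
    intro x hx h2
    have h3 : rulerLevel K x = 0 := by
      by_contra h4
      have := (le_rulerLevel_iff hK).1 (by omega : 1 ≤ rulerLevel K x)
      omega
    rw [h3] at h2
    simp at h2
  obtain ⟨l, rfl⟩ : ∃ l, q = 2 + l := ⟨q - 2, by omega⟩
  have h2 : classCount K (m + 1) 1 b 2 ≤ 1 := by
    unfold classCount
    rw [windowCount_succ, windowCount_succ]
    simp only [windowCount, Nat.add_zero, Finset.Ico_self, Finset.filter_empty, Finset.card_empty]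
    have := h1 b
    have := h1 (b + 1)
    split_ifs <;> omega
  have h3 : classCount K (m + 1) 1 (b + 2) l ≤ l := by
    refine (Finset.card_filter_le _ _).trans ?_
    simp
  have h4 : classCount K (m + 1) 1 b (2 + l) = _ := windowCount_add _ b 2 l
  unfold classCount at *
  omega

theorem class_eq_of_classCount {b q : ℕ}
    (h : ∀ a, 1 ≤ a → a ≤ m → classCount K (m + 1) a b q % 4 = q % 4)
    (h' : ∀ a, 1 ≤ a → a ≤ m → classCount K (m + 1) a (b + 1) q % 4 = q % 4) :
    rulerLevel K b % (m + 1) = rulerLevel K (b + q) % (m + 1) := by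
  have h1 := Nat.mod_lt (rulerLevel K b) (by omega : 0 < m + 1)
  have h2 := Nat.mod_lt (rulerLevel K (b + q)) (by omega : 0 < m + 1)
  have key : ∀ a, 1 ≤ a → a ≤ m →
      (rulerLevel K b % (m + 1) = a ↔ rulerLevel K (b + q) % (m + 1) = a) := by
    intro a ha ham
    have h3 := h a ha ham
    have h4 := h' a ha ham
    have h5 : classCount K (m + 1) a b (1 + q) = _ := windowCount_add _ b 1 q
    have h6 : classCount K (m + 1) a b (q + 1) = _ := windowCount_succ (b := b) (q := q) _
    have h7 : classCount K (m + 1) a b (0 + 1) = _ := windowCount_succ (b := b) (q := 0) _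
    have h8 : classCount K (m + 1) a b 0 = 0 := by simp [classCount, windowCount]
    rw [Nat.add_comm 1 q] at h5
    unfold classCount at *
    simp only [Nat.add_zero, Nat.zero_add] at h7
    split_ifs at h6 h7 <;> first | tauto | omega
  by_cases h3 : rulerLevel K b % (m + 1) = 0
  · by_contra h4
    have := (key (rulerLevel K (b + q) % (m + 1)) (by omega) (by omega)).2 rfl
    omega
  · exact ((key _ (by omega) (by omega)).1 rfl).symm

theorem conveyorWord_blocks (hr : w = 2 * r ∨ w + 1 = 2 * r) (hmw : 6 * m + 2 ≤ w)
    (hm : 7 ≤ m) (hwm : 2 * w + 4 ≤ 2 ^ m) (hK : m + 1 ≤ K) (hKm : K % (m + 1) ≠ 0) {s q E : ℕ}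
    (hq : 2 ≤ q) (hqK : q < 4 * 2 ^ K)
    (h : ∀ k < E, conveyorWord w r m K (s + k) =
      conveyorWord w r m K (s + k + q * ((r + 1) * w))) :
    E ≤ q * (r + 1) := by
  by_contra! hE
  have hw : 0 < w := by omega
  obtain ⟨B, hB⟩ : ∃ B, B = (r + 1) * w := ⟨_, rfl⟩
  have hBw : 2 * w ≤ B := by rw [hB]; exact Nat.mul_le_mul_right w (by omega)
  have hB0 : 0 < B := by omega
  rw [← hB] at h
  have kernel : ∀ b, (s + w - 1) / B ≤ b → b ≤ (s + E - w) / B → s + w ≤ s + E →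
      ∀ a, 1 ≤ a → a ≤ m → classCount K (m + 1) a b q % 4 = q % 4 := by
    intro b hb hb' hEw a ha ham
    obtain ⟨p, rfl⟩ : ∃ p, a = p + 1 := ⟨a - 1, by omega⟩
    have h1 : b * B ≤ s + E - w := (Nat.le_div_iff_mul_le hB0).1 hb'
    have h2 : s + w - 1 < (b + 1) * B := (Nat.div_lt_iff_lt_mul hB0).1 (by omega)
    have h3 : (b + 1) * B = b * B + B := by ring
    subst hB
    exact classCount_of_overlap (a := max s (b * ((r + 1) * w))) hr hmw (by omega : p < m) h
      (by omega) (by omega) (by omega) (by omega)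
  have hq2 : 2 * (r + 1) ≤ q * (r + 1) := Nat.mul_le_mul_right _ hq
  rcases Nat.lt_or_ge q 4 with hq4 | hq4
  · obtain ⟨k, hk, hsk⟩ := exists_column (by omega : 3 < w) s
    have h1 := h k (by omega)
    rw [hB] at h1
    exact not_classCount_of_small (by omega) hq hq4
      (classCount_of_conveyorWord_eq (p := 0) hr hmw (by omega) (Or.inl hsk) h1)
  have hq3 : 4 * (r + 1) ≤ q * (r + 1) := Nat.mul_le_mul_right _ hq4
  have hb01 : (s + w - 1) / B ≤ (s + E - w) / B := Nat.div_le_div_right (by omega)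
  obtain ⟨e, he⟩ := Nat.exists_eq_add_of_le hb01
  refine not_long_kernel (b := (s + w - 1) / B) (e := e) hm hw hwm hK hKm hq4 hqK ?_
    (kernel _ le_rfl hb01 (by omega))
    fun x hx hx' => class_eq_of_classCount (kernel _ hx (by omega) (by omega))
      (kernel _ (by omega) (by omega) (by omega))
  have h1 : (s + w - 1) / B * B ≤ s + w - 1 := Nat.div_mul_le_self _ _
  have h2 : s + E - w < ((s + w - 1) / B + e + 1) * B :=
    (Nat.div_lt_iff_lt_mul hB0).1 (by omega)
  have h3 : ((s + w - 1) / B + e + 1) * B = (s + w - 1) / B * B + (e + 1) * w * (r + 1) := by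
    rw [hB]; ring
  have h4 : q * (r + 1) < ((e + 1) * w + 4) * (r + 1) := by
    rw [Nat.add_mul]
    omega
  have := Nat.lt_of_mul_lt_mul_right h4
  omega

/-- A repetition in the conveyor word has an overlap of at most its shift divided by `w`. -/
theorem conveyorWord_overlap (hr : w = 2 * r ∨ w + 1 = 2 * r) (hmw : 6 * m + 2 ≤ w)
    (hmw' : w ≤ 6 * m + 7) (hm : 7 ≤ m) (hw44 : 44 ≤ w) (hwm : 2 * w + 4 ≤ 2 ^ m) (hK : m + 1 ≤ K)
    (hKm : K % (m + 1) ≠ 0) {s d E : ℕ} (hd : 0 < d) (hE : 0 < E)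
    (hdE : d + E ≤ 4 * 2 ^ K * ((r + 1) * w))
    (h : ∀ k < E, conveyorWord w r m K (s + k) = conveyorWord w r m K (s + k + d)) :
    E * w ≤ d := by
  have hw : 0 < w := by omega
  rcases Nat.lt_or_ge d (5 * w) with h5 | h5
  · exact conveyorWord_short hr hmw hm hd h5 h
  rcases Nat.lt_or_ge E 6 with h6 | h6
  · exact (Nat.mul_le_mul_right w (by omega : E ≤ 5)).trans h5
  obtain ⟨q, rfl⟩ := dvd_of_six_le hr hmw hm fun k hk => h k (by omega)
  rw [Nat.mul_comm ((r + 1) * w) q] at *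
  have hB0 : 0 < (r + 1) * w := by positivity
  have hqK : q < 4 * 2 ^ K := Nat.lt_of_mul_lt_mul_right (a := (r + 1) * w) (by omega)
  have hq0 : 0 < q := Nat.pos_of_mul_pos_right hd
  rw [← Nat.mul_assoc]
  refine Nat.mul_le_mul_right w ?_
  rcases Nat.lt_or_ge q 2 with hq | hq
  · obtain rfl : q = 1 := by omega
    by_contra! hE'
    refine conveyorWord_block hr hmw hmw' hm (s := s) (K := K) fun k hk => ?_
    have := h k (by omega)
    rwa [Nat.one_mul] at this
  · exact conveyorWord_blocks hr hmw hm hwm hK hKm hq hqK h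

end letters

theorem exists_circularRFree {n : ℕ} (hn : 45 ≤ n) {r : ℝ} (hr : (n : ℝ) / ((n : ℝ) - 1) < r)
    (N : ℕ) : ∃ u : List (Fin n), N ≤ u.length ∧ CircularRFree r u := by
  obtain ⟨w, rfl⟩ : ∃ w, n = w + 1 := ⟨n - 1, by omega⟩
  obtain ⟨m, hmw, hmw'⟩ : ∃ m, 6 * m + 2 ≤ w ∧ w ≤ 6 * m + 7 := ⟨(w - 2) / 6, by omega, by omega⟩
  obtain ⟨l, hl⟩ : ∃ l, w = 2 * l ∨ w + 1 = 2 * l := ⟨(w + 1) / 2, by omega⟩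
  have hm : 7 ≤ m := by omega
  have hwm : 2 * w + 4 ≤ 2 ^ m := by
    have : ∀ k, 12 * (k + 7) + 18 ≤ 2 ^ (k + 7) := by
      intro k
      induction k with
      | zero => norm_num
      | succ k ih => rw [show k + 1 + 7 = k + 7 + 1 by omega, pow_succ]; omega
    obtain ⟨k, rfl⟩ := Nat.exists_eq_add_of_le hm
    have := this k
    rw [Nat.add_comm 7 k]
    omega
  obtain ⟨K, hK⟩ : ∃ K, K = (m + 1) * (N + 1) + 1 := ⟨_, rfl⟩
  have hKm : K % (m + 1) ≠ 0 := by
    rw [hK, Nat.mul_add_mod, Nat.mod_eq_of_lt (by omega)]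
    omega
  have hKN : m + 1 ≤ K ∧ N ≤ K := by
    have h1 : (m + 1) * 1 ≤ (m + 1) * (N + 1) := Nat.mul_le_mul_left _ (by omega)
    have h2 : 1 * (N + 1) ≤ (m + 1) * (N + 1) := Nat.mul_le_mul_right _ (by omega)
    omega
  refine ⟨_, ?_, circularRFree_of_periodic (n := w + 1) (T := 4 * 2 ^ K * ((l + 1) * w)) (by omega)
    (fun i => ⟨conveyorWord w l m K i, Nat.lt_succ_of_le (Nat.min_le_left _ _)⟩) ?_ ?_ hr⟩
  · rw [List.length_map, List.length_range]
    have h1 : K < 2 ^ K := Nat.lt_two_pow_self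
    have h2 : 0 < (l + 1) * w := Nat.mul_pos (by omega) (by omega)
    have h3 := Nat.le_mul_of_pos_right (4 * 2 ^ K) h2
    omega
  · intro i
    exact Fin.ext (conveyorWord_add (by omega) i)
  · intro s d E hd hE hdE h
    exact conveyorWord_overlap hl hmw hmw' hm (by omega) hwm hKN.1 hKm hd hE hdE
      fun k hk => congrArg Fin.val (h k hk)

/-- For `n ≥ 45`, the weak circular repetition threshold for `n` letters equals
`n/(n-1)`. -/
theorem weak_circular_repetition_threshold (n : ℕ) (hn : 45 ≤ n) :
    sInf {r : ℝ | 1 < r ∧ ∀ N : ℕ, ∃ w : List (Fin n),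
        N ≤ w.length ∧ CircularRFree r w} = (n : ℝ) / ((n : ℝ) - 1) := by
  have hn' : (45 : ℝ) ≤ n := by exact_mod_cast hn
  have hone : 1 < (n : ℝ) / ((n : ℝ) - 1) := by
    rw [lt_div_iff₀ (by linarith)]
    linarith
  have htwo : (n : ℝ) / ((n : ℝ) - 1) ≤ 2 := by
    rw [div_le_iff₀ (by linarith)]
    linarith
  have hmem : ∀ r : ℝ, (n : ℝ) / ((n : ℝ) - 1) < r → r ∈ {r : ℝ | 1 < r ∧ ∀ N : ℕ,
      ∃ w : List (Fin n), N ≤ w.length ∧ CircularRFree r w} := fun r hr =>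
    ⟨hone.trans hr, fun N => exists_circularRFree hn hr N⟩
  refine csInf_eq_of_forall_ge_of_forall_gt_exists_lt ⟨3, hmem 3 (by linarith)⟩ ?_ ?_
  · rintro r ⟨-, hr⟩
    rcases le_or_gt r 2 with h | h
    · obtain ⟨w, hw, hfree⟩ := hr (2 * n)
      exact le_of_circularRFree (by omega) h hw hfree
    · linarith
  · intro b hb
    obtain ⟨r, h1, h2⟩ := exists_between hb
    exact ⟨r, hmem r h1, h2⟩
end

section
/- Let n ≥ 45 be an integer, and set m = ⌊(n−3)/6⌋, ℓ = ⌊n/2⌋, and M = 4^{m−2}. Then for every integer t ≥ 1, there exists a word W over A_n of length M(n−1)(ℓ+1)t such that the circular word ⟨W⟩ is (n/(n−1))⁺-free, i.e., no factor of ⟨W⟩ has an exponent strictly greater than n/(n−1). -/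
/-- The track visited at column `c` of a row whose index modulo `n / 2 + 1` is `ρ`. -/
def track (n ρ c : ℕ) : ℕ :=
  if c % 2 = 1 then c
  else if 2 * ρ ≤ c then c - 2 * ρ
  else if c + 2 = 2 * ρ then n - 1
  else c + 2 * (n / 2 + 1) - 2 * ρ

/-- The letter on track `T`: if `T = 6 * a + 2 + o` with `a < m` and `1 ≤ o ≤ 4`, the offset `o` is
multiplied by `2 ^ N a` modulo `5`; otherwise it is `T`. -/
def letter (m : ℕ) (N : ℕ → ℕ) (T : ℕ) : ℕ :=
  if 2 ≤ T ∧ (T - 2) / 6 < m ∧ 1 ≤ (T - 2) % 6 ∧ (T - 2) % 6 ≤ 4 then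
    6 * ((T - 2) / 6) + 2 + (T - 2) % 6 * 2 ^ N ((T - 2) / 6) % 5
  else T

/-- The infinite word written row by row in rows of length `n - 1` and blocks of `n / 2 + 1` rows,
where region `a` has been modified `N a J` times in block `J`. -/
def word (n m : ℕ) (N : ℕ → ℕ → ℕ) (P : ℕ) : ℕ :=
  letter m (fun a => N a (P / (n - 1) / (n / 2 + 1)))
    (track n (P / (n - 1) % (n / 2 + 1)) (P % (n - 1)))

theorem word_apply {n : ℕ} (m : ℕ) (N : ℕ → ℕ → ℕ) {r c : ℕ} (hc : c < n - 1) :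
    word n m N (r * (n - 1) + c) =
      letter m (fun a => N a (r / (n / 2 + 1))) (track n (r % (n / 2 + 1)) c) := by
  have hdiv : (r * (n - 1) + c) / (n - 1) = r := by
    rw [mul_comm, Nat.mul_add_div (by omega), Nat.div_eq_of_lt hc, add_zero]
  have hmod : (r * (n - 1) + c) % (n - 1) = c := by
    rw [mul_comm, Nat.mul_add_mod, Nat.mod_eq_of_lt hc]
  rw [word, hdiv, hmod]

theorem letter_of_support {m a o : ℕ} (N : ℕ → ℕ) (ha : a < m) (ho : 1 ≤ o) (ho' : o ≤ 4) :
    letter m N (6 * a + 2 + o) = 6 * a + 2 + o * 2 ^ N a % 5 := by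
  have h1 : (6 * a + 2 + o - 2) / 6 = a := by omega
  have h2 : (6 * a + 2 + o - 2) % 6 = o := by omega
  unfold letter
  rw [if_pos (by omega), h1, h2]

theorem support_or_letter_eq (m : ℕ) (N : ℕ → ℕ) (T : ℕ) :
    (∃ a o, a < m ∧ 1 ≤ o ∧ o ≤ 4 ∧ T = 6 * a + 2 + o) ∨
      ((∀ a < m, ¬ (6 * a + 3 ≤ T ∧ T ≤ 6 * a + 6)) ∧ letter m N T = T) := by
  by_cases h : 2 ≤ T ∧ (T - 2) / 6 < m ∧ 1 ≤ (T - 2) % 6 ∧ (T - 2) % 6 ≤ 4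
  · exact Or.inl ⟨(T - 2) / 6, (T - 2) % 6, by omega⟩
  · refine Or.inr ⟨fun a ha h' => h (by omega), by rw [letter, if_neg h]⟩

theorem mul_two_pow_mod_five {o k : ℕ} (h1 : 1 ≤ o) (h4 : o ≤ 4) :
    1 ≤ o * 2 ^ k % 5 ∧ o * 2 ^ k % 5 ≤ 4 := by
  have hlt := Nat.mod_lt (o * 2 ^ k) (show 0 < 5 by norm_num)
  have : ¬ 5 ∣ o * 2 ^ k := by
    intro h
    rcases (Nat.Prime.dvd_mul Nat.prime_five).1 h with h | h
    · omega
    · have := Nat.Prime.dvd_of_dvd_pow Nat.prime_five h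
      omega
  omega

theorem two_pow_mod_five_cases (k : ℕ) :
    (k % 4 = 0 ∧ 2 ^ k % 5 = 1) ∨ (k % 4 = 1 ∧ 2 ^ k % 5 = 2) ∨
      (k % 4 = 2 ∧ 2 ^ k % 5 = 4) ∨ (k % 4 = 3 ∧ 2 ^ k % 5 = 3) := by
  induction k with
  | zero => simp
  | succ k ih => rw [pow_succ]; omega

/-- Two letters agree only if their tracks belong to the same region. -/
theorem letter_eq_cases {m : ℕ} {N N' : ℕ → ℕ} {T T' : ℕ} (h : letter m N T = letter m N' T') :
    (∃ a o o', a < m ∧ 1 ≤ o ∧ o ≤ 4 ∧ 1 ≤ o' ∧ o' ≤ 4 ∧ T = 6 * a + 2 + o ∧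
      T' = 6 * a + 2 + o' ∧ o * 2 ^ N a % 5 = o' * 2 ^ N' a % 5) ∨
      (T = T' ∧ ∀ a < m, ¬ (6 * a + 3 ≤ T ∧ T ≤ 6 * a + 6)) := by
  rcases support_or_letter_eq m N T with ⟨a, o, ha, ho, ho', rfl⟩ | ⟨hf, hT⟩ <;>
  rcases support_or_letter_eq m N' T' with ⟨a', u, ha', hu, hu', rfl⟩ | ⟨hf', hT'⟩
  · rw [letter_of_support N ha ho ho', letter_of_support N' ha' hu hu'] at h
    have h1 := mul_two_pow_mod_five (k := N a) ho ho'
    have h2 := mul_two_pow_mod_five (k := N' a') hu hu'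
    obtain rfl : a = a' := by omega
    exact Or.inl ⟨a, o, u, ha, ho, ho', hu, hu', rfl, rfl, by omega⟩
  · rw [letter_of_support N ha ho ho', hT'] at h
    have h1 := mul_two_pow_mod_five (k := N a) ho ho'
    exact absurd (by omega) (hf' a ha)
  · rw [letter_of_support N' ha' hu hu', hT] at h
    have h1 := mul_two_pow_mod_five (k := N' a') hu hu'
    exact absurd (by omega) (hf a' ha')
  · exact Or.inr ⟨by omega, hf⟩

/-- The letter on track `T` may be found on track `T'` in the next block, if `E a` says whether
region `a` is modified. -/
def Moves (m : ℕ) (E : ℕ → Prop) (T T' : ℕ) : Prop :=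
  (T = T' ∧ ∀ a < m, E a → ¬ (6 * a + 3 ≤ T ∧ T ≤ 6 * a + 6)) ∨
    ∃ a < m, E a ∧ ((T = 6 * a + 3 ∧ T' = 6 * a + 5) ∨ (T = 6 * a + 4 ∧ T' = 6 * a + 3) ∨
      (T = 6 * a + 5 ∧ T' = 6 * a + 6) ∨ (T = 6 * a + 6 ∧ T' = 6 * a + 4))

theorem moves_of_letter_eq {m : ℕ} {N N' : ℕ → ℕ} {T T' : ℕ}
    (hN : ∀ a, N' a = N a ∨ N' a = N a + 1) (h : letter m N T = letter m N' T') :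
    Moves m (fun a => N' a = N a + 1) T T' := by
  rcases letter_eq_cases h with ⟨a, o, o', ha, ho, ho4, ho', ho4', rfl, rfl, he⟩ | ⟨rfl, hf⟩
  · rw [Nat.mul_mod o, Nat.mul_mod o'] at he
    have hk := two_pow_mod_five_cases (N a)
    have hk' := two_pow_mod_five_cases (N' a)
    rcases hN a with hNa | hNa
    · refine Or.inl ⟨?_, fun b hb hE => ?_⟩
      · rw [hNa] at he
        rcases hk with ⟨-, hk⟩ | ⟨-, hk⟩ | ⟨-, hk⟩ | ⟨-, hk⟩ <;> rw [hk] at he <;> omega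
      · have : a ≠ b := by rintro rfl; change N' a = _ at hE; omega
        omega
    · refine Or.inr ⟨a, ha, hNa, ?_⟩
      rw [hNa, pow_succ, Nat.mul_mod (2 ^ N a)] at he
      rcases hk with ⟨-, hk⟩ | ⟨-, hk⟩ | ⟨-, hk⟩ | ⟨-, hk⟩ <;> rw [hk] at he <;>
        interval_cases o' <;> omega
  · exact Or.inl ⟨rfl, fun a ha _ => hf a ha⟩

theorem letter_eq_of_track_eq {m : ℕ} {N N' : ℕ → ℕ} {a o : ℕ} (ha : a < m) (ho : 1 ≤ o)
    (ho' : o ≤ 4) (h : letter m N (6 * a + 2 + o) = letter m N' (6 * a + 2 + o)) :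
    N a % 4 = N' a % 4 := by
  rw [letter_of_support N ha ho ho', letter_of_support N' ha ho ho', Nat.add_left_cancel_iff,
    Nat.mul_mod, Nat.mul_mod o (2 ^ N' a)] at h
  have hk := two_pow_mod_five_cases (N a)
  have hk' := two_pow_mod_five_cases (N' a)
  interval_cases o <;> omega

/-- The letter at column `c` of row `ρ` recurs `s` rows and `g` columns later. -/
def Recurs (n m : ℕ) (E : ℕ → Prop) (s g ρ c : ℕ) : Prop :=
  ∃ δ c' ρ', ((c' = c + g ∧ δ = s) ∨ (c' + (n - 1) = c + g ∧ δ = s + 1)) ∧ c' < n - 1 ∧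
    ρ' < n / 2 + 1 ∧
    ((ρ' = ρ + δ ∧ track n ρ c = track n ρ' c') ∨
      (ρ' + (n / 2 + 1) = ρ + δ ∧ Moves m E (track n ρ c) (track n ρ' c')))

theorem recurs_of_word_eq {n m : ℕ} {N : ℕ → ℕ → ℕ} (hn : 45 ≤ n)
    (hN : ∀ a J, N a (J + 1) = N a J ∨ N a (J + 1) = N a J + 1) {r c s g : ℕ} (hc : c < n - 1)
    (hg : g < n - 1) (hs : s ≤ 5)
    (h : word n m N (r * (n - 1) + c) = word n m N (r * (n - 1) + c + (s * (n - 1) + g))) :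
    Recurs n m (fun a => N a (r / (n / 2 + 1) + 1) = N a (r / (n / 2 + 1)) + 1) s g
      (r % (n / 2 + 1)) c := by
  obtain ⟨δ, c', hδ, hc', hQ⟩ : ∃ δ c', ((c' = c + g ∧ δ = s) ∨
      (c' + (n - 1) = c + g ∧ δ = s + 1)) ∧ c' < n - 1 ∧
      r * (n - 1) + c + (s * (n - 1) + g) = (r + δ) * (n - 1) + c' := by
    rcases lt_or_ge (c + g) (n - 1) with h | h
    · exact ⟨s, c + g, Or.inl ⟨rfl, rfl⟩, h, by ring⟩
    · refine ⟨s + 1, c + g - (n - 1), Or.inr ⟨by omega, rfl⟩, by omega, ?_⟩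
      rw [← add_assoc, add_mul, add_mul, one_mul]
      omega
  have hΛ : 0 < n / 2 + 1 := by omega
  rw [hQ] at h
  rw [word_apply m N hc, word_apply m N hc'] at h
  refine ⟨δ, c', (r + δ) % (n / 2 + 1), hδ, hc', Nat.mod_lt _ hΛ, ?_⟩
  have hr := Nat.div_add_mod r (n / 2 + 1)
  have hρ := Nat.mod_lt r hΛ
  set Λ := n / 2 + 1 with hΛdef
  rcases lt_or_ge (r % Λ + δ) Λ with hlt | hge
  · have e1 : (r + δ) / Λ = r / Λ := by
      rw [← hr, add_assoc, Nat.mul_add_div hΛ, Nat.div_eq_of_lt hlt, hr]; rfl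
    have e2 : (r + δ) % Λ = r % Λ + δ := by
      conv_lhs => rw [← hr, add_assoc, Nat.mul_add_mod, Nat.mod_eq_of_lt hlt]
    rw [e1, e2] at h
    rw [e2]
    refine Or.inl ⟨rfl, ?_⟩
    rcases moves_of_letter_eq (fun a => Or.inl rfl) h with h | ⟨a, -, h, -⟩
    · exact h.1
    · simp at h
  · have e0 : r + δ = Λ * (r / Λ + 1) + (r % Λ + δ - Λ) := by rw [mul_add]; omega
    have hlt : r % Λ + δ - Λ < Λ := by omega
    have e1 : (r + δ) / Λ = r / Λ + 1 := by
      rw [e0, Nat.mul_add_div hΛ, Nat.div_eq_of_lt hlt, add_zero]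
    have e2 : (r + δ) % Λ = r % Λ + δ - Λ := by
      rw [e0, Nat.mul_add_mod, Nat.mod_eq_of_lt hlt]
    rw [e1, e2] at h
    rw [e2]
    exact Or.inr ⟨by omega, moves_of_letter_eq (fun a => hN a _) h⟩

theorem Recurs.false_of_zero {n m : ℕ} {E : ℕ → Prop} {g ρ c : ℕ} (hn : 45 ≤ n)
    (hm : 6 * m + 3 ≤ n) (hρ : ρ < n / 2 + 1) (hc : c < n - 1) (hg : 0 < g) (hg' : g < n - 1)
    (h : Recurs n m E 0 g ρ c) : False := by
  obtain ⟨δ, c', ρ', hδ, hc', hρ', h⟩ := h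
  rcases h with ⟨h1, h2⟩ | ⟨h1, ⟨h2, -⟩ | ⟨a, ha, -, h2⟩⟩
  · unfold track at h2
    split_ifs at h2 <;> omega
  · unfold track at h2
    split_ifs at h2 <;> omega
  · unfold track at h2
    split_ifs at h2 <;> omega

/-- A short recurrence starting at an odd column: either the letter stays in its column, or
its region is modified in between. -/
theorem Recurs.odd {n m : ℕ} {E : ℕ → Prop} {s g ρ c : ℕ} (hn : 45 ≤ n)
    (hm : 6 * m + 3 ≤ n) (hρ : ρ < n / 2 + 1) (hc : c < n - 1) (hg : g < n - 1) (hs : 1 ≤ s)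
    (hs' : s ≤ 5) (hodd : c % 2 = 1) (h : Recurs n m E s g ρ c) :
    (g = 0 ∧ ∀ a < m, E a → n / 2 + 1 ≤ ρ + s → ¬ (6 * a + 3 ≤ c ∧ c ≤ 6 * a + 6)) ∨
      ∃ a < m, E a ∧ n / 2 + 1 ≤ ρ + s ∧
        ((c = 6 * a + 3 ∧ g = 2) ∨ (c = 6 * a + 5 ∧ g + 2 * (n / 2 + 1) = 1 + 2 * (ρ + s)) ∨
          (c = 6 * a + 5 ∧ g + 2 * (n / 2 + 1) = 2 * (ρ + s) ∧ n % 2 = 0 ∧ n - 1 ≤ c + g)) := by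
  obtain ⟨δ, c', ρ', hδ, hc', hρ', h⟩ := h
  have hT : track n ρ c = c := by simp [track, hodd]
  rw [hT] at h
  rcases h with ⟨h1, h2⟩ | ⟨h1, ⟨h2, h3⟩ | ⟨a, ha, hE, h2⟩⟩
  · refine Or.inl ⟨?_, fun a ha hE => ?_⟩
    · unfold track at h2
      split_ifs at h2 <;> omega
    · unfold track at h2
      split_ifs at h2 <;> omega
  · refine Or.inl ⟨?_, fun a ha hE _ => h3 a ha hE⟩
    unfold track at h2
    split_ifs at h2 <;> omega
  · refine Or.inr ⟨a, ha, hE, ?_⟩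
    unfold track at h2
    split_ifs at h2 <;> omega

theorem Recurs.even {n m : ℕ} {E : ℕ → Prop} {s g ρ c : ℕ} (hn : 45 ≤ n)
    (hm : 6 * m + 3 ≤ n) (hρ : ρ < n / 2 + 1) (hc : c < n - 1) (hg : g < n - 1) (hs : 1 ≤ s)
    (hs' : s ≤ 5) (heven : c % 2 = 0) (h : Recurs n m E s g ρ c) (hg0 : g = 0) :
    s = 1 ∧ ∃ a < m, E a ∧ n / 2 + 1 = ρ + 1 ∧ c = 6 * a + 4 := by
  obtain ⟨δ, c', ρ', hδ, hc', hρ', h⟩ := h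
  rcases h with ⟨h1, h2⟩ | ⟨h1, ⟨h2, h3⟩ | ⟨a, ha, hE, h2⟩⟩
  · unfold track at h2
    split_ifs at h2 <;> omega
  · unfold track at h2
    split_ifs at h2 <;> omega
  · have : s = 1 ∧ n / 2 + 1 = ρ + 1 ∧ c = 6 * a + 4 := by
      unfold track at h2
      split_ifs at h2 <;> omega
    exact ⟨this.1, a, ha, hE, this.2⟩

theorem track_even_cases (n : ℕ) {ρ c : ℕ} (hc : c % 2 = 0) :
    (2 * ρ ≤ c ∧ track n ρ c + 2 * ρ = c) ∨ (c + 2 = 2 * ρ ∧ track n ρ c = n - 1) ∨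
      (c + 2 < 2 * ρ ∧ track n ρ c + 2 * ρ = c + 2 * (n / 2 + 1)) ∨
        n / 2 + 1 < ρ := by
  unfold track
  split_ifs <;> omega

theorem track_odd (n : ℕ) {ρ c : ℕ} (hc : c % 2 = 1) : track n ρ c = c := if_pos hc

set_option maxHeartbeats 2000000 in
/-- A short recurrence starting at an even column. -/
theorem Recurs.even_cases {n m : ℕ} {E : ℕ → Prop} {s g ρ c : ℕ} (hn : 45 ≤ n)
    (hm : 6 * m + 3 ≤ n) (hρ : ρ < n / 2 + 1) (hc : c < n - 1) (hg : g < n - 1) (hs : 1 ≤ s)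
    (hs' : s ≤ 5) (heven : c % 2 = 0) (h : Recurs n m E s g ρ c) :
    ((∀ a < m, E a → n / 2 + 1 ≤ ρ + s → c + 2 * (n / 2 + 1) ≠ 6 * a + 4 + 2 * ρ ∧
        c + 2 * (n / 2 + 1) ≠ 6 * a + 6 + 2 * ρ) ∧
      (g = 2 * s ∨ n % 2 = 0 ∧ g + 1 = 2 * s ∧ n - 1 ≤ c + 2 * s)) ∨
    ∃ a < m, E a ∧ n / 2 + 1 ≤ ρ + s + 1 ∧
      ((c + 2 * (n / 2 + 1) = 6 * a + 4 + 2 * ρ ∧ g + 1 + 2 * ρ = 2 * (n / 2 + 1)) ∨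
        (c + 2 * (n / 2 + 1) = 6 * a + 6 + 2 * ρ ∧ (g + 2 = 2 * s ∨
          n % 2 = 0 ∧ g + 3 = 2 * s ∧ n - 1 ≤ c + 2 * s)) ∨
        (c = 6 * a + 4 + 2 * ρ ∧ c + g = n - 1 + 6 * a + 3) ∨
        (c = 6 * a + 6 + 2 * ρ ∧
          c + g + 2 * (n / 2 + 1) = n - 1 + 6 * a + 6 + 2 * (ρ + s))) := by
  obtain ⟨δ, c', ρ', hδ, hc', hρ', h⟩ := h
  rcases h with ⟨h1, h2⟩ | ⟨h1, ⟨h2, h3⟩ | ⟨a, ha, hE, h2⟩⟩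
  · refine Or.inl ⟨fun a ha hE => ?_, ?_⟩
    · unfold track at h2
      split_ifs at h2 <;> omega
    · unfold track at h2
      split_ifs at h2 <;> omega
  · refine Or.inl ⟨fun a ha hE h4 => ?_, ?_⟩
    · have := h3 a ha hE
      unfold track at h2 this
      split_ifs at h2 this <;> omega
    · unfold track at h2
      split_ifs at h2 <;> omega
  · refine Or.inr ⟨a, ha, hE, ?_⟩
    have hs1 := track_even_cases n (ρ := ρ) heven
    rcases Nat.mod_two_eq_zero_or_one c' with hc2 | hc2
    · have hs2 := track_even_cases n (ρ := ρ') hc2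
      generalize track n ρ c = T at *
      generalize track n ρ' c' = T' at *
      obtain ⟨rfl, rfl⟩ : T = 6 * a + 6 ∧ T' = 6 * a + 4 := by omega
      clear h2
      have hδs : δ ≤ s + 1 := by omega
      have hE' : n / 2 + 1 ≤ ρ + s + 1 := by omega
      refine ⟨hE', ?_⟩
      rcases hs1 with ⟨hs1, hs1'⟩ | hs1 | ⟨hs1, hs1'⟩ | hs1
      · refine Or.inr (Or.inr (Or.inr ⟨by omega, ?_⟩))
        rcases hs2 with ⟨hs2, hs2'⟩ | hs2 | ⟨hs2, hs2'⟩ | hs2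
        · rcases hδ with ⟨e1, e2⟩ | ⟨e1, e2⟩ <;> omega
        · omega
        · omega
        · omega
      · omega
      · refine Or.inr (Or.inl ⟨by omega, ?_⟩)
        rcases hs2 with ⟨hs2, hs2'⟩ | hs2 | ⟨hs2, hs2'⟩ | hs2
        · rcases hδ with ⟨e1, e2⟩ | ⟨e1, e2⟩ <;> omega
        · omega
        · omega
        · omega
      · omega
    · rw [track_odd n hc2] at h2
      generalize track n ρ c = T at *
      obtain ⟨rfl, rfl⟩ : T = 6 * a + 4 ∧ c' = 6 * a + 3 := by omega
      clear h2
      refine ⟨by omega, ?_⟩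
      rcases hs1 with hs1 | hs1 | hs1 | hs1
      · exact Or.inr (Or.inr (Or.inl (by omega)))
      · omega
      · exact Or.inl (by omega)
      · omega

/-- No short recurrence covers three consecutive columns the middle one of which is odd. -/
theorem Recurs.false_of_even_odd_even {n m : ℕ} {E : ℕ → Prop} {s g ρ c : ℕ} (hn : 45 ≤ n)
    (hm : 6 * m + 3 ≤ n) (hρ : ρ < n / 2 + 1) (hc : c + 2 < n - 1) (hg : g < n - 1) (hs : 2 ≤ s)
    (hs' : s ≤ 5) (heven : c % 2 = 0) (h0 : Recurs n m E s g ρ c)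
    (h1 : Recurs n m E s g ρ (c + 1)) (h2 : Recurs n m E s g ρ (c + 2)) : False := by
  have hg0 : g ≠ 0 := fun h => by
    have := h0.even hn hm hρ (by omega) hg (by omega) hs' heven h
    omega
  rcases h1.odd hn hm hρ (by omega) hg (by omega) hs' (by omega) with ⟨h, -⟩ | ⟨a, ha, hE, h3, h1⟩
  · exact hg0 h
  rcases h0.even_cases hn hm hρ (by omega) hg (by omega) hs' heven with
    ⟨h0, h0'⟩ | ⟨b, hb, -, h0', h0⟩ <;>
  rcases h2.even_cases hn hm hρ (by omega) hg (by omega) hs' (by omega) with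
    ⟨h2, h2'⟩ | ⟨d, hd, -, h2', h2⟩
  · have := h0 a ha hE h3
    have := h2 a ha hE h3
    omega
  · have := h0 a ha hE h3
    omega
  · have := h2 a ha hE h3
    omega
  · omega

/-- No recurrence with a gap between one and two rows covers an odd and an adjacent even column. -/
theorem Recurs.false_of_adjacent {n m : ℕ} {E : ℕ → Prop} {g ρ c d : ℕ} (hn : 45 ≤ n)
    (hm : 6 * m + 3 ≤ n) (hρ : ρ < n / 2 + 1) (hc : c < n - 1) (hd : d < n - 1) (hg : g < n - 1)
    (hodd : c % 2 = 1) (hcd : c = d + 1 ∨ d = c + 1) (h0 : Recurs n m E 1 g ρ c)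
    (h1 : Recurs n m E 1 g ρ d) : False := by
  have hd2 : d % 2 = 0 := by omega
  rcases h0.odd hn hm hρ (by omega) hg le_rfl (by norm_num) hodd with ⟨h, h'⟩ | ⟨a, ha, hE, h3, h0⟩
  · obtain ⟨-, a, ha, hE, h2, h3⟩ := h1.even hn hm hρ hd hg le_rfl (by norm_num) hd2 h
    have := h' a ha hE (by omega)
    omega
  · rcases h1.even_cases hn hm hρ hd hg le_rfl (by norm_num) hd2 with
      ⟨h1, h1'⟩ | ⟨b, hb, -, h1', h1⟩
    · have := h1 a ha hE h3
      omega
    · omega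

theorem Recurs.gap_eq_zero {n m : ℕ} {E : ℕ → Prop} {s g ρ c : ℕ} (hn : 45 ≤ n)
    (hm : 6 * m + 3 ≤ n) (hρ : ρ < n / 2 + 1) (hc : c < n - 1) (hg : g < n - 1) (hs : 1 ≤ s)
    (hs' : s ≤ 5) (hodd : c % 2 = 1) (hfree : c = 1 ∨ n - 3 ≤ c) (h : Recurs n m E s g ρ c) :
    g = 0 := by
  rcases h.odd hn hm hρ hc hg hs hs' hodd with h | ⟨a, ha, -, h⟩ <;> omega

theorem Recurs.gap_eq_one {n m : ℕ} {E : ℕ → Prop} {g ρ : ℕ} (hn : 45 ≤ n)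
    (hm : 6 * m + 3 ≤ n) (hρ : ρ < n / 2 + 1) (hn2 : n % 2 = 0) (hg : g < n - 1)
    (h : Recurs n m E 1 g ρ (n - 2)) : g = 1 := by
  obtain ⟨δ, c', ρ', hδ, hc', hρ', h⟩ := h
  rcases h with ⟨h1, h2⟩ | ⟨h1, ⟨h2, -⟩ | ⟨a, ha, -, h2⟩⟩ <;>
  · unfold track at h2
    split_ifs at h2 <;> omega

theorem Recurs.gap_ne_one {n m : ℕ} {E : ℕ → Prop} {g ρ : ℕ}
    (hm : 6 * m + 3 ≤ n) (hρ : ρ < n / 2 + 1) (hg : g < n - 1)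
    (h : Recurs n m E 1 g ρ 0) : g ≠ 1 := by
  rintro rfl
  obtain ⟨δ, c', ρ', hδ, hc', hρ', h⟩ := h
  rcases h with ⟨h1, h2⟩ | ⟨h1, ⟨h2, -⟩ | ⟨a, ha, -, h2⟩⟩ <;>
  · unfold track at h2
    split_ifs at h2 <;> omega

/-- There are no short repetitions with period less than `6 * (n - 1)`. -/
theorem false_of_word_eq_of_le_five {n m : ℕ} {N : ℕ → ℕ → ℕ} (hn : 45 ≤ n) (hm : 6 * m + 3 ≤ n)
    (hN : ∀ a J, N a (J + 1) = N a J ∨ N a (J + 1) = N a J + 1) {P s g : ℕ}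
    (hg : g < n - 1) (hs : s ≤ 5) (hpos : 0 < s * (n - 1) + g)
    (h : ∀ i ≤ s, word n m N (P + i) = word n m N (P + i + (s * (n - 1) + g))) : False := by
  obtain ⟨r, c, hc, rfl⟩ : ∃ r c, c < n - 1 ∧ P = r * (n - 1) + c :=
    ⟨P / (n - 1), P % (n - 1), Nat.mod_lt _ (by omega), (Nat.div_add_mod' _ _).symm⟩
  have hρ : ∀ r, r % (n / 2 + 1) < n / 2 + 1 := fun r => Nat.mod_lt _ (by omega)
  have hrow : ∀ i ≤ s, c + i < n - 1 →
      Recurs n m (fun a => N a (r / (n / 2 + 1) + 1) = N a (r / (n / 2 + 1)) + 1) s g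
        (r % (n / 2 + 1)) (c + i) := fun i hi hci =>
    recurs_of_word_eq hn hN hci hg hs (by rw [← add_assoc (r * (n - 1))]; exact h i hi)
  have hnext : ∀ i d, i ≤ s → c + i = n - 1 + d → d < n - 1 →
      Recurs n m (fun a => N a ((r + 1) / (n / 2 + 1) + 1) = N a ((r + 1) / (n / 2 + 1)) + 1) s g
        ((r + 1) % (n / 2 + 1)) d := fun i d hi hci hd =>
    recurs_of_word_eq hn hN hd hg hs (by
      have e : (r + 1) * (n - 1) + d = r * (n - 1) + c + i := by rw [add_mul, one_mul]; omega
      rw [e]; exact h i hi)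
  rcases Nat.eq_zero_or_pos s with rfl | hs0
  · exact (hrow 0 le_rfl hc).false_of_zero hn hm (hρ r) hc (by omega) hg
  rcases (show 1 ≤ s from hs0).eq_or_lt with rfl | hs1
  · rcases lt_or_ge (c + 1) (n - 1) with hc1 | hc1
    · rcases Nat.mod_two_eq_zero_or_one c with h2 | h2
      · exact (hrow 1 le_rfl hc1).false_of_adjacent hn hm (hρ r) hc1 hc hg (by omega)
          (Or.inl rfl) (hrow 0 (by norm_num) hc)
      · exact (hrow 0 (by norm_num) hc).false_of_adjacent hn hm (hρ r) hc hc1 hg h2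
          (Or.inr rfl) (hrow 1 le_rfl hc1)
    · obtain rfl : c = n - 2 := by omega
      have h0 := hrow 0 (by norm_num) hc
      have h1 := hnext 1 0 le_rfl (by omega) (by omega)
      rcases Nat.mod_two_eq_zero_or_one n with h2 | h2
      · exact h1.gap_ne_one hm (hρ _) hg (h0.gap_eq_one hn hm (hρ _) h2 hg)
      · have hg0 := h0.gap_eq_zero hn hm (hρ _) hc hg le_rfl (by norm_num) (by omega)
          (Or.inr (by omega))
        obtain ⟨-, a, -, -, -, h3⟩ :=
          h1.even hn hm (hρ _) (by omega) hg le_rfl (by norm_num) rfl hg0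
        omega
  have hs1' : 2 ≤ s := hs1
  have key : ∀ r' E, Recurs n m E s g (r' % (n / 2 + 1)) 0 → g ≠ 0 := fun r' E h0 hg0 => by
    have := h0.even hn hm (hρ _) (by omega) hg hs0 hs rfl hg0
    omega
  rcases lt_or_ge (c + 2) (n - 1) with hc2 | hc2
  · have h0 := hrow 0 (by omega) (by omega)
    have h1 := hrow 1 (by omega) (by omega)
    have h2 := hrow 2 (by omega) (by omega)
    rcases Nat.mod_two_eq_zero_or_one c with he | ho
    · exact h0.false_of_even_odd_even hn hm (hρ r) hc2 hg hs1' hs he h1 h2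
    · have hg0 : g ≠ 0 := fun h => by
        have := h1.even hn hm (hρ r) (by omega) hg hs0 hs (by omega) h
        omega
      rcases h0.odd hn hm (hρ r) (by omega) hg hs0 hs (by omega) with h0 | ⟨a, ha, -, -, h0⟩
      · omega
      rcases h2.odd hn hm (hρ r) (by omega) hg hs0 hs (by omega) with h2 | ⟨b, hb, -, -, h2⟩
      · omega
      omega
  · obtain rfl | rfl : c = n - 3 ∨ c = n - 2 := by omega
    · have h2 := hnext 2 0 (by omega) (by omega) (by omega)
      refine key _ _ h2 ?_
      rcases Nat.mod_two_eq_zero_or_one n with he | ho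
      · exact (hrow 0 (by omega) (by omega)).gap_eq_zero hn hm (hρ r) hc hg hs0 hs (by omega)
          (Or.inr (by omega))
      · exact (hrow 1 (by omega) (by omega)).gap_eq_zero hn hm (hρ r) (by omega) hg hs0 hs
          (by omega) (Or.inr (by omega))
    · have h1 := hnext 1 0 (by omega) (by omega) (by omega)
      have h2 := hnext 2 1 (by omega) (by omega) (by omega)
      exact key _ _ h1
        (h2.gap_eq_zero hn hm (hρ _) (by omega) hg hs0 hs (by omega) (Or.inl rfl))

theorem word_add_mul {n : ℕ} (m : ℕ) (N : ℕ → ℕ → ℕ) (hn : 45 ≤ n) (P q : ℕ) :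
    word n m N (P + q * (n / 2 + 1) * (n - 1)) =
      letter m (fun a => N a (P / (n - 1) / (n / 2 + 1) + q))
        (track n (P / (n - 1) % (n / 2 + 1)) (P % (n - 1))) := by
  rw [word, Nat.add_mul_div_right _ _ (by omega), Nat.add_mul_div_right _ _ (by omega),
    Nat.add_mul_mod_self_right, Nat.add_mul_mod_self_right]

/-- A letter in an odd column that is never modified determines its column. -/
theorem mod_eq_of_word_eq {n m : ℕ} {N : ℕ → ℕ → ℕ} (hn : 45 ≤ n) {P Q : ℕ}
    (hodd : P % (n - 1) % 6 = 1) (h : word n m N P = word n m N Q) :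
    Q % (n - 1) = P % (n - 1) := by
  have hP : P % (n - 1) < n - 1 := Nat.mod_lt _ (by omega)
  have hQ : Q % (n - 1) < n - 1 := Nat.mod_lt _ (by omega)
  have hρ : Q / (n - 1) % (n / 2 + 1) < n / 2 + 1 := Nat.mod_lt _ (by omega)
  rw [word, word, track_odd n (by omega)] at h
  have hT : P % (n - 1) = track n (Q / (n - 1) % (n / 2 + 1)) (Q % (n - 1)) := by
    rcases letter_eq_cases h with ⟨a, o, o', -, h1, h2, -, -, h3, -⟩ | ⟨h, -⟩
    · omega
    · exact h
  unfold track at hT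
  split_ifs at hT <;> omega

theorem exists_mod_six_eq_one {K : ℕ} (hK : 7 ≤ K) (P : ℕ) : ∃ i ≤ 6, (P + i) % K % 6 = 1 := by
  have hP : P % K < K := Nat.mod_lt _ (by omega)
  have hmod : ∀ i, (P + i) % K = (P % K + i) % K := fun i => by rw [Nat.mod_add_mod]
  rcases le_or_gt (P % K + 6) K with h | h
  · obtain ⟨i, hi, h6⟩ : ∃ i ≤ 5, (P % K + i) % 6 = 1 := ⟨(7 - P % K % 6) % 6, by omega, by omega⟩
    exact ⟨i, by omega, by rw [hmod, Nat.mod_eq_of_lt (show P % K + i < K by omega), h6]⟩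
  · refine ⟨K + 1 - P % K, by omega, ?_⟩
    rw [hmod, show P % K + (K + 1 - P % K) = 1 + K by omega, Nat.add_mod_right,
      Nat.mod_eq_of_lt (show 1 < K by omega)]

/-- A vertical shift preserving two consecutive even columns preserves all tracks. -/
theorem row_mod_eq_of_word_eq {n m : ℕ} {N : ℕ → ℕ → ℕ} (hn : 45 ≤ n) (hm : 6 * m + 3 ≤ n)
    {r r' c : ℕ} (heven : c % 2 = 0) (hc : c + 2 < n - 1)
    (h1 : word n m N (r * (n - 1) + c) = word n m N (r' * (n - 1) + c))
    (h2 : word n m N (r * (n - 1) + (c + 2)) = word n m N (r' * (n - 1) + (c + 2))) :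
    r' % (n / 2 + 1) = r % (n / 2 + 1) := by
  rw [word_apply m N (by omega), word_apply m N (by omega)] at h1 h2
  have hρ : r % (n / 2 + 1) < n / 2 + 1 := Nat.mod_lt _ (by omega)
  have hρ' : r' % (n / 2 + 1) < n / 2 + 1 := Nat.mod_lt _ (by omega)
  generalize r % (n / 2 + 1) = ρ at *
  generalize r' % (n / 2 + 1) = ρ' at *
  have e1 := track_even_cases n (ρ := ρ) heven
  have e2 := track_even_cases n (ρ := ρ') heven
  have e3 := track_even_cases n (ρ := ρ) (c := c + 2) (by omega)
  have e4 := track_even_cases n (ρ := ρ') (c := c + 2) (by omega)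
  generalize track n ρ c = T1 at *
  generalize track n ρ' c = T2 at *
  generalize track n ρ (c + 2) = T3 at *
  generalize track n ρ' (c + 2) = T4 at *
  have aux : ∀ T T' : ℕ, (∃ a o o', a < m ∧ 1 ≤ o ∧ o ≤ 4 ∧ 1 ≤ o' ∧ o' ≤ 4 ∧ T = 6 * a + 2 + o ∧
      T' = 6 * a + 2 + o') → T ≤ n - 3 ∧ T' ≤ n - 3 ∧ (T - 3) / 6 = (T' - 3) / 6 ∧ 3 ≤ T ∧
        3 ≤ T' ∧ (T - 3) % 6 ≤ 3 ∧ (T' - 3) % 6 ≤ 3 := by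
    rintro T T' ⟨a, o, o', h⟩
    omega
  have h1' : T1 = T2 ∨ T1 ≤ n - 3 ∧ T2 ≤ n - 3 ∧ (T1 - 3) / 6 = (T2 - 3) / 6 ∧ 3 ≤ T1 ∧
        3 ≤ T2 ∧ (T1 - 3) % 6 ≤ 3 ∧ (T2 - 3) % 6 ≤ 3 := by
    rcases letter_eq_cases h1 with ⟨a, o, o', h1, h2, h3, h4, h5, h6, h7, -⟩ | ⟨h, -⟩
    · exact Or.inr (aux _ _ ⟨a, o, o', h1, h2, h3, h4, h5, h6, h7⟩)
    · exact Or.inl h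
  have h2' : T3 = T4 ∨ T3 ≤ n - 3 ∧ T4 ≤ n - 3 ∧ (T3 - 3) / 6 = (T4 - 3) / 6 ∧ 3 ≤ T3 ∧
        3 ≤ T4 ∧ (T3 - 3) % 6 ≤ 3 ∧ (T4 - 3) % 6 ≤ 3 := by
    rcases letter_eq_cases h2 with ⟨a, o, o', h1, h2, h3, h4, h5, h6, h7, -⟩ | ⟨h, -⟩
    · exact Or.inr (aux _ _ ⟨a, o, o', h1, h2, h3, h4, h5, h6, h7⟩)
    · exact Or.inl h
  clear h1 h2 aux
  rcases e1 with e1 | e1 | e1 | e1 <;> rcases e2 with e2 | e2 | e2 | e2 <;> omega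

/-- A period of at least six rows is a whole number of blocks. -/
theorem exists_eq_mul_of_word_eq {n m : ℕ} {N : ℕ → ℕ → ℕ} (hn : 45 ≤ n) (hm : 6 * m + 3 ≤ n)
    {P p : ℕ} (h : ∀ i ≤ 6, word n m N (P + i) = word n m N (P + i + p)) :
    ∃ q, p = q * (n / 2 + 1) * (n - 1) := by
  obtain ⟨i, hi, hi6⟩ := exists_mod_six_eq_one (K := n - 1) (by omega) P
  have hmod : P + i ≡ P + i + p [MOD n - 1] := (mod_eq_of_word_eq hn hi6 (h i hi)).symm
  obtain ⟨s, rfl⟩ : n - 1 ∣ p := by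
    have := (Nat.modEq_iff_dvd' (Nat.le_add_right _ _)).1 hmod
    rwa [Nat.add_sub_cancel_left] at this
  obtain ⟨r, c, i, heven, hc, hi, hP⟩ : ∃ r c i, c % 2 = 0 ∧ c + 2 < n - 1 ∧ i ≤ 4 ∧
      P + i = r * (n - 1) + c := by
    have hd := Nat.div_add_mod' P (n - 1)
    have hlt : P % (n - 1) < n - 1 := Nat.mod_lt _ (by omega)
    rcases lt_or_ge (P % (n - 1) + 3) (n - 1) with h | h
    · exact ⟨P / (n - 1), P % (n - 1) + P % (n - 1) % 2, P % (n - 1) % 2, by omega, by omega,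
        by omega, by omega⟩
    · refine ⟨P / (n - 1) + 1, 0, n - 1 - P % (n - 1), rfl, by omega, by omega, ?_⟩
      rw [add_mul, one_mul]
      omega
  have h1 := h i (by omega)
  have h2 := h (i + 2) (by omega)
  rw [show P + (i + 2) = r * (n - 1) + (c + 2) by omega,
    show r * (n - 1) + (c + 2) + (n - 1) * s = (r + s) * (n - 1) + (c + 2) by ring] at h2
  rw [hP, show r * (n - 1) + c + (n - 1) * s = (r + s) * (n - 1) + c by ring] at h1
  have h3 : r ≡ r + s [MOD n / 2 + 1] := (row_mod_eq_of_word_eq hn hm heven hc h1 h2).symm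
  have h4 := (Nat.modEq_iff_dvd' (Nat.le_add_right _ _)).1 h3
  rw [Nat.add_sub_cancel_left] at h4
  obtain ⟨q, rfl⟩ := h4
  exact ⟨q, by ring⟩

theorem counter_mod_eq_of_word_eq {n m : ℕ} {N : ℕ → ℕ → ℕ} (hn : 45 ≤ n) {P q a : ℕ}
    (ha : a < m) (hc : P % (n - 1) = 6 * a + 3 ∨ P % (n - 1) = 6 * a + 5)
    (h : word n m N P = word n m N (P + q * (n / 2 + 1) * (n - 1))) :
    N a (P / (n - 1) / (n / 2 + 1)) % 4 = N a (P / (n - 1) / (n / 2 + 1) + q) % 4 := by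
  rw [word_add_mul m N hn, word, track_odd n (by omega)] at h
  rcases hc with hc | hc
  · rw [hc] at h
    exact letter_eq_of_track_eq (o := 1) ha (by norm_num) (by norm_num) h
  · rw [hc] at h
    exact letter_eq_of_track_eq (o := 3) ha (by norm_num) (by norm_num) h

theorem letter_congr {m : ℕ} {N N' : ℕ → ℕ} (h : ∀ a < m, N a % 4 = N' a % 4) (T : ℕ) :
    letter m N T = letter m N' T := by
  unfold letter
  split_ifs with hT
  · have h1 := h _ hT.2.1
    have hk := two_pow_mod_five_cases (N ((T - 2) / 6))
    have hk' := two_pow_mod_five_cases (N' ((T - 2) / 6))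
    rw [Nat.mul_mod, Nat.mul_mod _ (2 ^ N' _),
      show 2 ^ N ((T - 2) / 6) % 5 = 2 ^ N' ((T - 2) / 6) % 5 by omega]
  · rfl

theorem word_lt {n m : ℕ} (N : ℕ → ℕ → ℕ) (hn : 45 ≤ n) (hm : 6 * m + 3 ≤ n) (P : ℕ) :
    word n m N P < n := by
  have hP : P % (n - 1) < n - 1 := Nat.mod_lt _ (by omega)
  have hρ : P / (n - 1) % (n / 2 + 1) < n / 2 + 1 := Nat.mod_lt _ (by omega)
  have hT : track n (P / (n - 1) % (n / 2 + 1)) (P % (n - 1)) < n := by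
    unfold track
    split_ifs <;> omega
  rw [word]
  rcases support_or_letter_eq m (fun a => N a (P / (n - 1) / (n / 2 + 1)))
    (track n (P / (n - 1) % (n / 2 + 1)) (P % (n - 1))) with ⟨a, o, ha, ho, ho', h⟩ | ⟨-, h⟩
  · rw [h, letter_of_support _ ha ho ho']
    have := mul_two_pow_mod_five (k := N a (P / (n - 1) / (n / 2 + 1))) ho ho'
    omega
  · rwa [h]

section Counting

variable {V ι : Type*} [Fintype V] [DecidableEq V]

open Classical in
/-- The colourings vanishing outside `S` that violate no event of `Ev` lying inside `S` -/
noncomputable def goodColorings (Ev : Finset ι) (I : ι → Finset V) (viol : ι → (V → Bool) → Prop)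
    (S : Finset V) : Finset (V → Bool) :=
  {f | (∀ x ∉ S, f x = false) ∧ ∀ e ∈ Ev, I e ⊆ S → ¬ viol e f}

variable {Ev : Finset ι} {I : ι → Finset V} {viol : ι → (V → Bool) → Prop} {k : ι → ℕ}

theorem mem_goodColorings {S : Finset V} {f : V → Bool} :
    f ∈ goodColorings Ev I viol S ↔
      (∀ x ∉ S, f x = false) ∧ ∀ e ∈ Ev, I e ⊆ S → ¬ viol e f := by
  simp [goodColorings]

open Classical in
/-- The bad extensions of good colourings of `S` to `insert v S` are determined by their values
outside one half of a violated event. -/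
theorem card_filter_viol_le {S : Finset V} {v : V} {X : Finset (V → Bool)} {e : ι} {B : Finset V}
    (hX : ∀ f ∈ X, (∀ x ∉ insert v S, f x = false) ∧ ∀ e ∈ Ev, I e ⊆ S → ¬ viol e f)
    (hviol : ∀ e f f', (∀ x ∈ I e, f x = f' x) → viol e f → viol e f')
    (hvB : v ∈ B) (hvS : v ∉ S)
    (hB : ∀ x ∈ B, ∃ y ∈ I e, y ∉ B ∧ ∀ f, viol e f → f x = f y) :
    (X.filter (viol e)).card ≤ (goodColorings Ev I viol (S \ B.erase v)).card := by
  refine Finset.card_le_card_of_injOn (fun f x => if x ∈ S \ B.erase v then f x else false)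
    (fun f hf => ?_) (fun f hf f' hf' h => ?_)
  · have hf1 := hX f (Finset.mem_filter.1 hf).1
    refine mem_goodColorings.2 ⟨fun x hx => if_neg hx, fun e' he' hs hv' => ?_⟩
    refine hf1.2 e' he' (hs.trans Finset.sdiff_subset) (hviol e' _ _ (fun x hx => ?_) hv')
    exact if_pos (hs hx)
  · have hf1 := Finset.mem_filter.1 hf
    have hf1' := Finset.mem_filter.1 hf'
    have key : ∀ x ∉ B, f x = f' x := fun x hx => by
      by_cases hxS : x ∈ insert v S
      · have hxv : x ≠ v := by rintro rfl; exact hx hvB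
        have hm : x ∈ S \ B.erase v := by
          rw [Finset.mem_sdiff, Finset.mem_erase]
          exact ⟨Finset.mem_of_mem_insert_of_ne hxS hxv, fun h => hx h.2⟩
        have := congrFun h x
        simpa only [if_pos hm] using this
      · rw [(hX f hf1.1).1 x hxS, (hX f' hf1'.1).1 x hxS]
    funext x
    by_cases hx : x ∈ B
    · obtain ⟨y, -, hyB, hy⟩ := hB x hx
      rw [hy f hf1.2, hy f' hf1'.2, key y hyB]
    · exact key x hx

open Classical in
theorem two_mul_card_goodColorings_le
    (hviol : ∀ e f f', (∀ x ∈ I e, f x = f' x) → viol e f → viol e f')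
    (hI : ∀ e ∈ Ev, ∀ v ∈ I e, ∃ B ⊆ I e, v ∈ B ∧ k e ≤ B.card ∧
      ∀ x ∈ B, ∃ y ∈ I e, y ∉ B ∧ ∀ f, viol e f → f x = f y)
    {S : Finset V} {v : V} (hv : v ∉ S) :
    ∃ D : ι → Finset V, (∀ e ∈ Ev, v ∈ I e → I e ⊆ insert v S → k e ≤ (D e).card + 1) ∧
      (∀ e, D e ⊆ S) ∧
      2 * (goodColorings Ev I viol S).card ≤ (goodColorings Ev I viol (insert v S)).card +
        ∑ e ∈ Ev with v ∈ I e ∧ I e ⊆ insert v S, (goodColorings Ev I viol (S \ D e)).card := by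
  set X : Finset (V → Bool) := (goodColorings Ev I viol S ×ˢ (Finset.univ : Finset Bool)).image
    fun fb => Function.update fb.1 v fb.2 with hXdef
  have hX : ∀ f ∈ X, (∀ x ∉ insert v S, f x = false) ∧ ∀ e ∈ Ev, I e ⊆ S → ¬ viol e f := by
    intro f hf
    obtain ⟨⟨f, b⟩, hfb, rfl⟩ := Finset.mem_image.1 hf
    obtain ⟨hf1, hf2⟩ := mem_goodColorings.1 (Finset.mem_product.1 hfb).1
    refine ⟨fun x hx => ?_, fun e he hs hv' => hf2 e he hs (hviol e _ _ (fun x hx => ?_) hv')⟩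
    · rw [Finset.mem_insert, not_or] at hx
      exact (Function.update_of_ne hx.1 _ _).trans (hf1 x hx.2)
    · exact Function.update_of_ne (fun h : x = v => hv (h ▸ hs hx)) _ _
  have hXcard : X.card = 2 * (goodColorings Ev I viol S).card := by
    rw [hXdef, Finset.card_image_of_injOn, Finset.card_product, Finset.card_univ,
      Fintype.card_bool, mul_comm]
    rintro ⟨f, b⟩ hf ⟨f', b'⟩ hf' h
    have hf1 := mem_goodColorings.1 (Finset.mem_product.1 hf).1
    have hf1' := mem_goodColorings.1 (Finset.mem_product.1 hf').1
    have hb : b = b' := by simpa using congrFun h v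
    refine Prod.ext (funext fun x => ?_) hb
    by_cases hx : x = v
    · subst hx
      exact (hf1.1 x hv).trans (hf1'.1 x hv).symm
    · simpa [Function.update_of_ne hx] using congrFun h x
  have hD : ∀ e, ∃ D ⊆ S, e ∈ Ev → v ∈ I e → I e ⊆ insert v S → k e ≤ D.card + 1 ∧
      (X.filter (viol e)).card ≤ (goodColorings Ev I viol (S \ D)).card := by
    intro e
    by_cases he : e ∈ Ev ∧ v ∈ I e ∧ I e ⊆ insert v S
    · obtain ⟨B, hBI, hvB, hk, hB⟩ := hI e he.1 v he.2.1
      refine ⟨B.erase v, fun x hx => ?_, fun _ _ _ => ⟨?_, ?_⟩⟩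
      · rw [Finset.mem_erase] at hx
        exact Finset.mem_of_mem_insert_of_ne (he.2.2 (hBI hx.2)) hx.1
      · rwa [Finset.card_erase_add_one hvB]
      · exact card_filter_viol_le hX hviol hvB hv hB
    · exact ⟨∅, Finset.empty_subset _, fun h1 h2 h3 => absurd ⟨h1, h2, h3⟩ he⟩
  choose D hDS hD using hD
  refine ⟨D, fun e h1 h2 h3 => (hD e h1 h2 h3).1, hDS, ?_⟩
  have hsub : X ⊆ goodColorings Ev I viol (insert v S) ∪
      (Ev.filter fun e => v ∈ I e ∧ I e ⊆ insert v S).biUnion fun e => X.filter (viol e) := by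
    intro f hf
    rw [Finset.mem_union, mem_goodColorings, or_iff_not_imp_left]
    intro h
    rw [not_and] at h
    have h := h (hX f hf).1
    push Not at h
    obtain ⟨e, he, hs, hve⟩ := h
    refine Finset.mem_biUnion.2 ⟨e, Finset.mem_filter.2 ⟨he, ?_, hs⟩,
      Finset.mem_filter.2 ⟨hf, hve⟩⟩
    by_contra hvI
    refine (hX f hf).2 e he (fun x hx => ?_) hve
    exact Finset.mem_of_mem_insert_of_ne (hs hx) fun h => hvI (h ▸ hx)
  rw [← hXcard]
  refine (Finset.card_le_card hsub).trans ((Finset.card_union_le _ _).trans ?_)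
  refine Nat.add_le_add_left (Finset.card_biUnion_le.trans (Finset.sum_le_sum fun e he => ?_)) _
  rw [Finset.mem_filter] at he
  exact (hD e he.1 he.2.1 he.2.2).2

theorem card_goodColorings_growth
    (hviol : ∀ e f f', (∀ x ∈ I e, f x = f' x) → viol e f → viol e f')
    (hI : ∀ e ∈ Ev, ∀ v ∈ I e, ∃ B ⊆ I e, v ∈ B ∧ k e ≤ B.card ∧
      ∀ x ∈ B, ∃ y ∈ I e, y ∉ B ∧ ∀ f, viol e f → f x = f y)
    (hk : ∀ v, ∑ e ∈ Ev with v ∈ I e, (2 / 3 : ℚ) ^ (k e - 1) ≤ 1 / 2) (N : ℕ) :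
    ∀ S : Finset V, S.card = N → ∀ B ⊆ S,
      ((goodColorings Ev I viol (S \ B)).card : ℚ) ≤
        (2 / 3) ^ B.card * (goodColorings Ev I viol S).card := by
  induction N with
  | zero =>
    intro S hS B hB
    obtain rfl := Finset.card_eq_zero.1 hS
    obtain rfl := Finset.subset_empty.1 hB
    simp
  | succ N ih =>
    intro S hS B hB
    rcases B.eq_empty_or_nonempty with rfl | ⟨v, hvB⟩
    · simp
    have hvS := hB hvB
    have hcard : (S.erase v).card = N := by rw [Finset.card_erase_of_mem hvS, hS]; rfl
    have hSB : S \ B = S.erase v \ B.erase v := by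
      ext x
      simp only [Finset.mem_sdiff, Finset.mem_erase]
      by_cases hx : x = v
      · subst hx; simp [hvB]
      · simp [hx]
    have h1 := ih _ hcard (B.erase v) (Finset.erase_subset_erase v hB)
    rw [← hSB] at h1
    obtain ⟨D, hD1, hD2, hD3⟩ := two_mul_card_goodColorings_le (Ev := Ev) (k := k) hviol hI
      (Finset.notMem_erase v S)
    rw [Finset.insert_erase hvS] at hD1 hD3
    set C := ((goodColorings Ev I viol (S.erase v)).card : ℚ) with hC
    have hC0 : 0 ≤ C := Nat.cast_nonneg _
    have h2 : (∑ e ∈ Ev with v ∈ I e ∧ I e ⊆ S,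
        ((goodColorings Ev I viol (S.erase v \ D e)).card : ℚ)) ≤ 1 / 2 * C := by
      refine le_trans ?_ (mul_le_mul_of_nonneg_right (hk v) hC0)
      rw [Finset.sum_mul]
      refine (Finset.sum_le_sum fun e he => ?_).trans
        (Finset.sum_le_sum_of_subset_of_nonneg ?_ fun e _ _ => by positivity)
      · rw [Finset.mem_filter] at he
        refine (ih _ hcard (D e) (hD2 e)).trans (mul_le_mul_of_nonneg_right ?_ hC0)
        exact pow_le_pow_of_le_one (by norm_num) (by norm_num)
          (Nat.sub_le_of_le_add (hD1 e he.1 he.2.1 he.2.2))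
      · intro e he
        rw [Finset.mem_filter] at he ⊢
        exact ⟨he.1, he.2.1⟩
    have h3 : 2 * C ≤ (goodColorings Ev I viol S).card + ∑ e ∈ Ev with v ∈ I e ∧ I e ⊆ S,
        ((goodColorings Ev I viol (S.erase v \ D e)).card : ℚ) := by
      rw [hC]; exact_mod_cast hD3
    have h4 : C ≤ 2 / 3 * (goodColorings Ev I viol S).card := by linarith
    have hB1 : B.card = (B.erase v).card + 1 := (Finset.card_erase_add_one hvB).symm
    rw [hB1, pow_succ, mul_assoc]
    exact h1.trans (mul_le_mul_of_nonneg_left h4 (by positivity))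

/-- If events are large compared to their number, some colouring avoids them all. -/
theorem exists_coloring
    (hviol : ∀ e f f', (∀ x ∈ I e, f x = f' x) → viol e f → viol e f')
    (hI : ∀ e ∈ Ev, ∀ v ∈ I e, ∃ B ⊆ I e, v ∈ B ∧ k e ≤ B.card ∧
      ∀ x ∈ B, ∃ y ∈ I e, y ∉ B ∧ ∀ f, viol e f → f x = f y)
    (hk : ∀ v, ∑ e ∈ Ev with v ∈ I e, (2 / 3 : ℚ) ^ (k e - 1) ≤ 1 / 2)
    (hne : ∀ e ∈ Ev, (I e).Nonempty) :
    ∃ f : V → Bool, ∀ e ∈ Ev, ¬ viol e f := by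
  have h := card_goodColorings_growth hviol hI hk _ Finset.univ rfl Finset.univ subset_rfl
  have h0 : (fun _ => false) ∈ goodColorings Ev I viol (Finset.univ \ Finset.univ) := by
    rw [mem_goodColorings]
    refine ⟨fun _ _ => rfl, fun e he h => ?_⟩
    obtain ⟨x, hx⟩ := hne e he
    simpa using h hx
  have h1 : 0 < ((goodColorings Ev I viol (Finset.univ \ Finset.univ)).card : ℚ) := by
    exact_mod_cast Finset.card_pos.2 ⟨_, h0⟩
  have h2 : 0 < ((goodColorings Ev I viol Finset.univ).card : ℚ) :=
    pos_of_mul_pos_right (h1.trans_le h) (by positivity)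
  obtain ⟨f, hf⟩ := Finset.card_pos.1 (by exact_mod_cast h2)
  exact ⟨f, fun e he => (mem_goodColorings.1 hf).2 e he (Finset.subset_univ _)⟩

end Counting

theorem sum_mul_pow_le (R : ℕ) :
    ∑ d ∈ Finset.Icc 1 R, (38 * d : ℚ) * (2 / 3) ^ (13 * d - 1) ≤ 1 / 2 := by
  have h1 : ∀ d : ℕ, (38 * ((d + 1 : ℕ) : ℚ)) * (2 / 3) ^ (13 * (d + 1) - 1) ≤ (1 / 3) ^ (d + 1) := by
    intro d
    induction d with
    | zero => norm_num
    | succ d ih =>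
      have e : 13 * (d + 1 + 1) - 1 = 13 * (d + 1) - 1 + 13 := by omega
      rw [e, pow_add, pow_succ (1 / 3 : ℚ) (d + 1)]
      push_cast at ih ⊢
      have h2 : (0 : ℚ) ≤ (2 / 3) ^ (13 * (d + 1) - 1) := by positivity
      have h3 : (2 / 3 : ℚ) ^ 13 ≤ 1 / 6 := by norm_num
      have h4 : (0 : ℚ) ≤ d := Nat.cast_nonneg d
      calc (38 * ((d : ℚ) + 1 + 1)) * ((2 / 3) ^ (13 * (d + 1) - 1) * (2 / 3) ^ 13)
          ≤ (38 * (2 * ((d : ℚ) + 1))) * ((2 / 3) ^ (13 * (d + 1) - 1) * (1 / 6)) := by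
            gcongr
            linarith
        _ = 38 * ((d : ℚ) + 1) * (2 / 3) ^ (13 * (d + 1) - 1) * (1 / 3) := by ring
        _ ≤ _ := by gcongr
  have h2 : ∀ R : ℕ, ∑ d ∈ Finset.Icc 1 R, (38 * d : ℚ) * (2 / 3) ^ (13 * d - 1) ≤
      1 / 2 - 1 / 2 * (1 / 3) ^ R := by
    intro R
    induction R with
    | zero => simp
    | succ R ih =>
      rw [Finset.sum_Icc_succ_top (by omega)]
      have := h1 R
      rw [pow_succ] at this ⊢
      linarith
  exact (h2 R).trans (by linarith [show (0 : ℚ) ≤ (1 / 3) ^ R by positivity])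

/-- There is a circular binary word all of whose factors of length `19 * d` differ from the
factors `M * d` positions later, outside a prescribed small set. -/
theorem exists_coloring_zmod {M t T : ℕ} [NeZero T] (hM : 20 ≤ M) (hT : T = M * t)
    (Z : Finset (ZMod T)) (hZ : Z.card ≤ 3) :
    ∃ f : ZMod T → Bool, ∀ d, 1 ≤ d → 2 * d ≤ t → ∀ j : ZMod T,
      ∃ u < 19 * d, j + (u : ℕ) ∉ Z ∧ j + (u : ℕ) + (M * d : ℕ) ∉ Z ∧
        f (j + (u : ℕ)) ≠ f (j + (u : ℕ) + (M * d : ℕ)) := by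
  let A : ℕ × ZMod T → Finset (ZMod T) := fun e =>
    ((Finset.range (19 * e.1)).image fun u : ℕ => e.2 + (u : ZMod T)).filter
      fun x => x ∉ Z ∧ x + (M * e.1 : ℕ) ∉ Z
  let A' : ℕ × ZMod T → Finset (ZMod T) := fun e => (A e).image (· + ((M * e.1 : ℕ) : ZMod T))
  let viol : ℕ × ZMod T → (ZMod T → Bool) → Prop := fun e f =>
    ∀ x ∈ A e, f x = f (x + (M * e.1 : ℕ))
  let Ev : Finset (ℕ × ZMod T) := Finset.Icc 1 (t / 2) ×ˢ Finset.univ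
  have hEv : ∀ e ∈ Ev, 1 ≤ e.1 ∧ 40 * e.1 ≤ T ∧ 2 * (M * e.1) ≤ T ∧ 20 * e.1 ≤ M * e.1 := by
    intro e he
    have h1 := Finset.mem_Icc.1 (Finset.mem_product.1 he).1
    have h2 : M * (2 * e.1) ≤ M * t := Nat.mul_le_mul_left M (by omega)
    have h3 : 20 * e.1 ≤ M * e.1 := Nat.mul_le_mul_right _ hM
    have h4 : 2 * (M * e.1) = M * (2 * e.1) := by ring
    exact ⟨h1.1, by omega, by omega, h3⟩
  have hAcard : ∀ e ∈ Ev, 13 * e.1 ≤ (A e).card := by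
    intro e he
    obtain ⟨h1, h2, h3, h4⟩ := hEv e he
    have hinj : ((Finset.range (19 * e.1)).image fun u : ℕ => e.2 + (u : ZMod T)).card
        = 19 * e.1 := by
      rw [Finset.card_image_of_injOn, Finset.card_range]
      intro u hu w hw h
      have hu' := Finset.mem_range.1 hu
      have hw' := Finset.mem_range.1 hw
      have := (ZMod.natCast_eq_natCast_iff' u w T).1 (add_left_cancel h)
      rwa [Nat.mod_eq_of_lt (by omega), Nat.mod_eq_of_lt (by omega)] at this
    have hsub : (((Finset.range (19 * e.1)).image fun u : ℕ => e.2 + (u : ZMod T)) \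
        (Z ∪ Z.image (· - ((M * e.1 : ℕ) : ZMod T)))) ⊆ A e := by
      intro x hx
      rw [Finset.mem_sdiff, Finset.mem_union, not_or] at hx
      refine Finset.mem_filter.2 ⟨hx.1, hx.2.1, fun h => hx.2.2 ?_⟩
      exact Finset.mem_image.2 ⟨_, h, add_sub_cancel_right _ _⟩
    have h5 := Finset.card_le_card hsub
    have h6 := Finset.le_card_sdiff (Z ∪ Z.image (· - ((M * e.1 : ℕ) : ZMod T)))
      ((Finset.range (19 * e.1)).image fun u : ℕ => e.2 + (u : ZMod T))
    have h7 := Finset.card_union_le Z (Z.image (· - ((M * e.1 : ℕ) : ZMod T)))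
    have h8 := Finset.card_image_le (s := Z) (f := (· - ((M * e.1 : ℕ) : ZMod T)))
    omega
  have hA'card : ∀ e, (A' e).card = (A e).card := fun e =>
    Finset.card_image_of_injective _ (add_left_injective _)
  have hdisj : ∀ e ∈ Ev, ∀ x ∈ A e, x + (M * e.1 : ℕ) ∉ A e := by
    intro e he x hx hx'
    obtain ⟨h1, h2, h3, h4⟩ := hEv e he
    obtain ⟨u, hu, rfl⟩ := Finset.mem_image.1 (Finset.mem_filter.1 hx).1
    obtain ⟨w, hw, h⟩ := Finset.mem_image.1 (Finset.mem_filter.1 hx').1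
    rw [Finset.mem_range] at hu hw
    rw [add_assoc] at h
    have h := add_left_cancel h
    rw [← Nat.cast_add] at h
    have := (ZMod.natCast_eq_natCast_iff' w (u + M * e.1) T).1 h
    rw [Nat.mod_eq_of_lt (by omega), Nat.mod_eq_of_lt (by omega)] at this
    omega
  have key := exists_coloring (Ev := Ev) (I := fun e => A e ∪ A' e) (viol := viol)
    (k := fun e => 13 * e.1) ?_ ?_ ?_ ?_
  · obtain ⟨f, hf⟩ := key
    refine ⟨f, fun d hd1 hd2 j => ?_⟩
    have h := hf (d, j) (Finset.mem_product.2 ⟨Finset.mem_Icc.2 ⟨hd1, by omega⟩, Finset.mem_univ _⟩)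
    simp only [viol] at h
    push Not at h
    obtain ⟨x, hx, hne⟩ := h
    obtain ⟨hx1, hx2, hx3⟩ := Finset.mem_filter.1 hx
    obtain ⟨u, hu, rfl⟩ := Finset.mem_image.1 hx1
    exact ⟨u, Finset.mem_range.1 hu, hx2, hx3, hne⟩
  · intro e f f' hff' h x hx
    rw [← hff' x (Finset.mem_union_left _ hx), ← hff' _ (Finset.mem_union_right _
      (Finset.mem_image_of_mem _ hx))]
    exact h x hx
  · intro e he v hv
    rcases Finset.mem_union.1 hv with hv | hv
    · refine ⟨A e, Finset.subset_union_left, hv, hAcard e he, fun x hx => ⟨_,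
        Finset.mem_union_right _ (Finset.mem_image_of_mem _ hx), hdisj e he x hx,
        fun f hf => hf x hx⟩⟩
    · refine ⟨A' e, Finset.subset_union_right, hv, (hA'card e).symm ▸ hAcard e he, fun x hx => ?_⟩
      obtain ⟨y, hy, rfl⟩ := Finset.mem_image.1 hx
      refine ⟨y, Finset.mem_union_left _ hy, fun h => ?_, fun f hf => (hf y hy).symm⟩
      obtain ⟨z, hz, rfl⟩ := Finset.mem_image.1 h
      exact hdisj e he z hz hy
  · intro v
    refine le_trans ?_ (sum_mul_pow_le (t / 2))
    rw [Finset.sum_filter, Finset.sum_product]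
    refine Finset.sum_le_sum fun d hd => ?_
    rw [← Finset.sum_filter]
    change ∑ _a with _, (2 / 3 : ℚ) ^ (13 * d - 1) ≤ _
    rw [Finset.sum_const, nsmul_eq_mul]
    refine mul_le_mul_of_nonneg_right ?_ (by positivity)
    have hsub : (Finset.univ.filter fun j : ZMod T => v ∈ A (d, j) ∪ A' (d, j)) ⊆
        ((Finset.range (19 * d)).image fun u : ℕ => v - (u : ZMod T)) ∪
          (Finset.range (19 * d)).image fun u : ℕ => v - ((M * d : ℕ) : ZMod T) - (u : ZMod T) := by
      intro j hj
      rcases Finset.mem_union.1 (Finset.mem_filter.1 hj).2 with h | h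
      · obtain ⟨u, hu, rfl⟩ := Finset.mem_image.1 (Finset.mem_filter.1 h).1
        exact Finset.mem_union_left _ (Finset.mem_image.2 ⟨u, hu, add_sub_cancel_right _ _⟩)
      · obtain ⟨x, hx, rfl⟩ := Finset.mem_image.1 h
        obtain ⟨u, hu, rfl⟩ := Finset.mem_image.1 (Finset.mem_filter.1 hx).1
        exact Finset.mem_union_right _ (Finset.mem_image.2 ⟨u, hu, by ring⟩)
    have h1 := (Finset.card_le_card hsub).trans (Finset.card_union_le _ _)
    have h2 := Finset.card_image_le (s := Finset.range (19 * d)) (f := fun u : ℕ => v - (u : ZMod T))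
    have h3 := Finset.card_image_le (s := Finset.range (19 * d))
      (f := fun u : ℕ => v - ((M * d : ℕ) : ZMod T) - (u : ZMod T))
    rw [Finset.card_range] at h2 h3
    have h4 := h1.trans (Nat.add_le_add h2 h3)
    calc _ ≤ ((19 * d + 19 * d : ℕ) : ℚ) := by exact_mod_cast h4
      _ = 38 * d := by push_cast; ring
  · intro e he
    have := hAcard e he
    have := (hEv e he).1
    exact (Finset.card_pos.1 (by omega)).mono Finset.subset_union_left

/-- A circular binary word of length `M * t`, with number of ones divisible by `4`, all of whose
factors of length `19 * d` differ from the factors `M * d` positions later. -/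
theorem exists_bits {M t : ℕ} (hM : 20 ≤ M) (ht : 1 ≤ t) :
    ∃ b : ℕ → ℕ, (∀ j, b j ≤ 1) ∧ (∀ j, b (j + M * t) = b j) ∧
      4 ∣ ∑ j ∈ Finset.range (M * t), b j ∧
      ∀ d, 1 ≤ d → d < t → ∀ j, ∃ u < 19 * d, b (j + u) ≠ b (j + u + M * d) := by
  obtain ⟨T, hT⟩ : ∃ T, T = M * t := ⟨_, rfl⟩
  have hT20 : 20 ≤ T := hT ▸ hM.trans (Nat.le_mul_of_pos_right M ht)
  have : NeZero T := ⟨by omega⟩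
  have hZ : ((Finset.range 3).image fun u : ℕ => (u : ZMod T)).card ≤ 3 :=
    Finset.card_image_le.trans (Finset.card_range 3).le
  obtain ⟨f, hf⟩ := exists_coloring_zmod (M := M) (t := t) hM hT _ hZ
  set Z := (Finset.range 3).image fun u : ℕ => (u : ZMod T)
  let e : ℕ → ℕ := fun j => if f (j : ZMod T) then 1 else 0
  let c : ℕ := (4 - (∑ j ∈ Finset.range (T - 3), e (3 + j)) % 4) % 4
  let b : ℕ → ℕ := fun j => if j % T < 3 then if j % T < c then 1 else 0 else e j
  have hbZ : ∀ j : ℕ, (j : ZMod T) ∉ Z → b j = if f (j : ZMod T) then 1 else 0 := fun j hj => by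
    refine if_neg fun h => hj (Finset.mem_image.2 ⟨j % T, Finset.mem_range.2 h, ?_⟩)
    simp
  have hper : ∀ j, b (j + T) = b j := fun j => by simp [b, e]
  have hhalf : ∀ d, 1 ≤ d → 2 * d ≤ t → ∀ j, ∃ u < 19 * d, b (j + u) ≠ b (j + u + M * d) := by
    intro d hd1 hd2 j
    obtain ⟨u, hu, h1, h2, h3⟩ := hf d hd1 hd2 (j : ZMod T)
    refine ⟨u, hu, fun h => h3 ?_⟩
    rw [← Nat.cast_add] at h1 h2 ⊢
    rw [← Nat.cast_add] at h2 ⊢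
    rw [hbZ _ h1, hbZ _ h2] at h
    revert h
    cases f ((j + u : ℕ) : ZMod T) <;> cases f ((j + u + M * d : ℕ) : ZMod T) <;> simp
  rw [← hT]
  refine ⟨b, fun j => ?_, hper, ?_, fun d hd1 hd2 j => ?_⟩
  · simp only [b, e]
    split_ifs <;> norm_num
  · have h3 : T = 3 + (T - 3) := by omega
    have hsum : ∑ j ∈ Finset.range T, b j = c + ∑ j ∈ Finset.range (T - 3), e (3 + j) := by
      conv_lhs => rw [h3, Finset.sum_range_add]
      congr 1
      · have hc : c < 4 := Nat.mod_lt _ (by norm_num)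
        simp only [Finset.sum_range_succ, Finset.sum_range_zero, b,
          Nat.mod_eq_of_lt (show 0 < T by omega), Nat.mod_eq_of_lt (show 1 < T by omega),
          Nat.mod_eq_of_lt (show 2 < T by omega)]
        interval_cases c <;> simp
      · refine Finset.sum_congr rfl fun j hj => ?_
        rw [Finset.mem_range] at hj
        refine if_neg ?_
        rw [Nat.mod_eq_of_lt (by omega)]
        omega
    rw [hsum]
    simp only [c]
    omega
  · rcases le_or_gt (2 * d) t with h | h
    · exact hhalf d hd1 h j
    · obtain ⟨u, hu, hne⟩ := hhalf (t - d) (by omega) (by omega) (j + M * d)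
      refine ⟨u, by omega, fun h => hne ?_⟩
      have e1 : j + M * d + u + M * (t - d) = j + u + T := by
        rw [hT, show M * t = M * d + M * (t - d) by rw [← mul_add]; congr 1; omega]
        ring
      rw [e1, hper, h, add_right_comm]

/-- Region `a` is modified in every block that is a multiple of `4 ^ level A a`. -/
def level (A a : ℕ) : ℕ := if a = 0 ∨ a = A then 0 else if a < A then a else a - 1

/-- The number of modifications of region `a` up to block `J`; the modifications of the last
region are prescribed by `b`. -/
def counter (A m : ℕ) (b : ℕ → ℕ) (a J : ℕ) : ℕ :=
  if a + 1 = m then ∑ j ∈ Finset.range J, b j else J / 4 ^ level A a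

theorem counter_of_ne {A m : ℕ} (b : ℕ → ℕ) {a : ℕ} (ha : a + 1 ≠ m) (J : ℕ) :
    counter A m b a J = J / 4 ^ level A a := if_neg ha

theorem counter_succ {A m : ℕ} {b : ℕ → ℕ} (hb : ∀ j, b j ≤ 1) (a J : ℕ) :
    counter A m b a (J + 1) = counter A m b a J ∨
      counter A m b a (J + 1) = counter A m b a J + 1 := by
  unfold counter
  split_ifs
  · rw [Finset.sum_range_succ]
    have := hb J
    omega
  · rw [Nat.succ_div]
    split_ifs
    · exact Or.inr rfl
    · exact Or.inl rfl

theorem exists_level_eq {A m i : ℕ} (hi : i + 2 < m) :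
    ∃ a, a + 1 < m ∧ level A a = i := by
  unfold level
  rcases Nat.eq_zero_or_pos i with rfl | h0
  · exact ⟨0, by omega, by simp⟩
  rcases lt_or_ge i A with h | h
  · exact ⟨i, by omega, by rw [if_neg (by omega), if_pos h]⟩
  · exact ⟨i + 1, by omega, by rw [if_neg (by omega), if_neg (by omega)]; rfl⟩

theorem level_le {A m a : ℕ} (hA : 1 ≤ A) (hAm : A + 1 < m) (ha : a + 1 < m) :
    level A a + 3 ≤ m := by
  unfold level
  split_ifs <;> omega

theorem counter_add_mod_eq {A m t : ℕ} {b : ℕ → ℕ} (hA : 1 ≤ A) (hAm : A + 1 < m)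
    (hper : ∀ j, b (j + 4 ^ (m - 2) * t) = b j)
    (hsum : 4 ∣ ∑ j ∈ Finset.range (4 ^ (m - 2) * t), b j) {a : ℕ} (ha : a < m) (J : ℕ) :
    counter A m b a (J + 4 ^ (m - 2) * t) % 4 = counter A m b a J % 4 := by
  unfold counter
  split_ifs with h
  · rw [add_comm J, Finset.sum_range_add]
    have : ∑ x ∈ Finset.range J, b (4 ^ (m - 2) * t + x) = ∑ x ∈ Finset.range J, b x :=
      Finset.sum_congr rfl fun x _ => by rw [add_comm, hper]
    omega
  · have hl := level_le hA hAm (show a + 1 < m by omega)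
    obtain ⟨k, hk⟩ : ∃ k, m - 2 = level A a + 1 + k := ⟨m - 2 - (level A a + 1), by omega⟩
    rw [hk, pow_add, pow_succ, show 4 ^ level A a * 4 * 4 ^ k * t
      = 4 * (4 ^ k * t) * 4 ^ level A a by ring, Nat.add_mul_div_right _ _ (by positivity)]
    omega

theorem word_add_period {n m A t : ℕ} {b : ℕ → ℕ} (hn : 45 ≤ n) (hA : 1 ≤ A) (hAm : A + 1 < m)
    (hper : ∀ j, b (j + 4 ^ (m - 2) * t) = b j)
    (hsum : 4 ∣ ∑ j ∈ Finset.range (4 ^ (m - 2) * t), b j) (P : ℕ) :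
    word n m (counter A m b) (P + 4 ^ (m - 2) * t * (n / 2 + 1) * (n - 1)) =
      word n m (counter A m b) P := by
  rw [word_add_mul m _ hn, word]
  exact letter_congr (fun a ha => counter_add_mod_eq hA hAm hper hsum ha _) _

theorem exists_add_mod_eq {K c : ℕ} (hc : c < K) (P : ℕ) : ∃ i < K, (P + i) % K = c := by
  have hP : P % K < K := Nat.mod_lt _ (by omega)
  have hmod : ∀ i, (P + i) % K = (P % K + i) % K := fun i => by rw [Nat.mod_add_mod]
  rcases le_or_gt (P % K) c with h | h
  · exact ⟨c - P % K, by omega, by rw [hmod, Nat.add_sub_cancel' h, Nat.mod_eq_of_lt hc]⟩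
  · refine ⟨c + K - P % K, by omega, ?_⟩
    rw [hmod, show P % K + (c + K - P % K) = c + K by omega, Nat.add_mod_right,
      Nat.mod_eq_of_lt hc]

/-- A period is not a single block, because of the regions modified in every block. -/
theorem one_lt_of_word_eq {n m A : ℕ} {b : ℕ → ℕ} (hn : 45 ≤ n) (hm : m = (n - 3) / 6)
    (hA : A = (n / 2 + 4) / 6) {P q : ℕ} (hq : 0 < q)
    (h : ∀ i ≤ q * (n / 2 + 1), word n m (counter A m b) (P + i) =
      word n m (counter A m b) (P + i + q * (n / 2 + 1) * (n - 1))) : 1 < q := by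
  by_contra hq'
  obtain rfl : q = 1 := by omega
  have hlt : P % (n - 1) < n - 1 := Nat.mod_lt _ (by omega)
  obtain ⟨c, hc, i, hi, hP⟩ : ∃ c, (c = 3 ∨ c = 5 ∨ c = 6 * A + 3 ∨ c = 6 * A + 5) ∧
      ∃ i ≤ n / 2 + 1, P % (n - 1) + i = c ∨ P % (n - 1) + i = c + (n - 1) := by
    rcases le_or_gt (P % (n - 1)) 3 with h | h
    · exact ⟨3, by simp, 3 - P % (n - 1), by omega, by omega⟩
    rcases le_or_gt (P % (n - 1)) 5 with h | h
    · exact ⟨5, by simp, 5 - P % (n - 1), by omega, by omega⟩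
    rcases le_or_gt (P % (n - 1)) (6 * A + 3) with h | h
    · exact ⟨6 * A + 3, by simp, 6 * A + 3 - P % (n - 1), by omega, by omega⟩
    rcases le_or_gt (P % (n - 1)) (6 * A + 5) with h | h
    · exact ⟨6 * A + 5, by simp, 6 * A + 5 - P % (n - 1), by omega, by omega⟩
    · exact ⟨3, by simp, n + 2 - P % (n - 1), by omega, by omega⟩
  have hmod : (P + i) % (n - 1) = c := by
    rw [← Nat.mod_add_mod]
    rcases hP with hP | hP <;> rw [hP]
    · exact Nat.mod_eq_of_lt (by omega)
    · rw [Nat.add_mod_right]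
      exact Nat.mod_eq_of_lt (by omega)
  obtain ⟨a, ha, hca⟩ : ∃ a, (a = 0 ∨ a = A) ∧ (c = 6 * a + 3 ∨ c = 6 * a + 5) := by
    rcases hc with rfl | rfl | rfl | rfl
    · exact ⟨0, by simp⟩
    · exact ⟨0, by simp⟩
    · exact ⟨A, by simp⟩
    · exact ⟨A, by simp⟩
  have := counter_mod_eq_of_word_eq hn (show a < m by omega) (hmod ▸ hca) (h i (by omega))
  rw [counter_of_ne b (by omega), counter_of_ne b (by omega), level, if_pos ha] at this
  omega

/-- A long period is a multiple of `4 ^ (m - 2)` blocks. -/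
theorem pow_dvd_of_word_eq {n m A : ℕ} {b : ℕ → ℕ} (hn : 45 ≤ n) (hm : m = (n - 3) / 6)
    {P q : ℕ} (hq : 1 < q)
    (h : ∀ i ≤ q * (n / 2 + 1), word n m (counter A m b) (P + i) =
      word n m (counter A m b) (P + i + q * (n / 2 + 1) * (n - 1))) (i : ℕ) (hi : i + 2 ≤ m) :
    4 ^ i ∣ q := by
  induction i with
  | zero => exact one_dvd q
  | succ i ih =>
    obtain ⟨d, rfl⟩ := ih (by omega)
    obtain ⟨a, ha, hl⟩ := exists_level_eq (A := A) (show i + 2 < m by omega)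
    obtain ⟨k, hk, hc⟩ := exists_add_mod_eq (K := n - 1) (c := 6 * a + 3) (by omega) P
    have hle : 2 * (n / 2 + 1) ≤ 4 ^ i * d * (n / 2 + 1) := Nat.mul_le_mul_right _ hq
    have := counter_mod_eq_of_word_eq hn (show a < m by omega) (Or.inl hc) (h k (by omega))
    rw [counter_of_ne b (by omega), counter_of_ne b (by omega), hl,
      Nat.add_mul_div_left _ _ (by positivity)] at this
    rw [pow_succ]
    exact mul_dvd_mul_left _ (by omega)

theorem mul_le_pow {m : ℕ} (hm : 7 ≤ m) : 20 * (6 * m + 7) ≤ 4 ^ (m - 2) := by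
  induction m, hm using Nat.le_induction with
  | base => norm_num
  | succ m hm ih =>
    rw [show m + 1 - 2 = m - 2 + 1 by omega, pow_succ]
    omega

theorem false_of_word_eq_blocks {n m A t : ℕ} {b : ℕ → ℕ} (hn : 45 ≤ n) (hm : m = (n - 3) / 6)
    (hA : A = (n / 2 + 4) / 6) (hb : ∀ j, b j ≤ 1)
    (hbits : ∀ d, 1 ≤ d → d < t → ∀ j, ∃ u < 19 * d, b (j + u) ≠ b (j + u + 4 ^ (m - 2) * d))
    {P q : ℕ} (hq : 0 < q) (hqt : q < 4 ^ (m - 2) * t)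
    (h : ∀ i ≤ q * (n / 2 + 1), word n m (counter A m b) (P + i) =
      word n m (counter A m b) (P + i + q * (n / 2 + 1) * (n - 1))) : False := by
  have hq1 := one_lt_of_word_eq hn hm hA hq h
  obtain ⟨d, rfl⟩ := pow_dvd_of_word_eq hn hm hq1 h (m - 2) (by omega)
  have hd1 : 1 ≤ d := Nat.pos_of_mul_pos_left hq
  have hdt : d < t := Nat.lt_of_mul_lt_mul_left hqt
  obtain ⟨i, hi, hc⟩ := exists_add_mod_eq (K := n - 1) (c := 6 * (m - 1) + 3) (by omega) P
  set J := (P + i) / (n - 1) / (n / 2 + 1) with hJ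
  have hM : 20 * (n - 1) ≤ 4 ^ (m - 2) :=
    (Nat.mul_le_mul_left 20 (by omega)).trans (mul_le_pow (by omega))
  have hsum : ∀ u ≤ 19 * d, (∑ j ∈ Finset.range (J + u), b j) % 4 =
      (∑ j ∈ Finset.range (J + u + 4 ^ (m - 2) * d), b j) % 4 := by
    intro u hu
    have hle : i + u * (n / 2 + 1) * (n - 1) ≤ 4 ^ (m - 2) * d * (n / 2 + 1) := by
      calc i + u * (n / 2 + 1) * (n - 1)
          ≤ 1 * (n / 2 + 1) * (n - 1) + 19 * d * (n / 2 + 1) * (n - 1) := by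
            gcongr
            rw [one_mul]
            exact hi.le.trans (Nat.le_mul_of_pos_left _ (by omega))
        _ ≤ d * (n / 2 + 1) * (n - 1) + 19 * d * (n / 2 + 1) * (n - 1) := by gcongr
        _ = 20 * (n - 1) * d * (n / 2 + 1) := by ring
        _ ≤ _ := by gcongr
    have h1 := h _ hle
    rw [← add_assoc] at h1
    have h2 : (P + i + u * (n / 2 + 1) * (n - 1)) % (n - 1) = 6 * (m - 1) + 3 := by
      rw [Nat.add_mul_mod_self_right, hc]
    have := counter_mod_eq_of_word_eq hn (show m - 1 < m by omega) (Or.inl h2) h1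
    rw [Nat.add_mul_div_right _ _ (by omega), Nat.add_mul_div_right _ _ (by omega)] at this
    unfold counter at this
    rwa [if_pos (by omega), if_pos (by omega)] at this
  obtain ⟨u, hu, hne⟩ := hbits d hd1 hdt J
  have h1 := hsum u hu.le
  have h2 := hsum (u + 1) hu
  rw [show J + (u + 1) + 4 ^ (m - 2) * d = J + u + 4 ^ (m - 2) * d + 1 by ring, ← add_assoc J,
    Finset.sum_range_succ, Finset.sum_range_succ] at h2
  have h3 := hb (J + u)
  have h4 := hb (J + u + 4 ^ (m - 2) * d)
  omega

theorem false_of_word_eq {n m A t : ℕ} {b : ℕ → ℕ} (hn : 45 ≤ n) (hm : m = (n - 3) / 6)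
    (hA : A = (n / 2 + 4) / 6) (hb : ∀ j, b j ≤ 1)
    (hbits : ∀ d, 1 ≤ d → d < t → ∀ j, ∃ u < 19 * d, b (j + u) ≠ b (j + u + 4 ^ (m - 2) * d))
    {P p k : ℕ} (hp : 0 < p) (hpt : p < 4 ^ (m - 2) * t * (n / 2 + 1) * (n - 1))
    (hk : p < k * (n - 1))
    (h : ∀ i < k, word n m (counter A m b) (P + i) = word n m (counter A m b) (P + i + p)) :
    False := by
  have hdiv := Nat.div_add_mod' p (n - 1)
  have hg : p % (n - 1) < n - 1 := Nat.mod_lt _ (by omega)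
  have hsk : p / (n - 1) < k := Nat.div_lt_of_lt_mul (by rwa [mul_comm] at hk)
  rcases le_or_gt (p / (n - 1)) 5 with hs | hs
  · exact false_of_word_eq_of_le_five hn (show 6 * m + 3 ≤ n by omega) (counter_succ hb) hg hs (by omega)
      fun i hi => by rw [hdiv]; exact h i (by omega)
  · obtain ⟨q, rfl⟩ := exists_eq_mul_of_word_eq hn (show 6 * m + 3 ≤ n by omega) (P := P) (p := p)
      fun i hi => h i (by omega)
    rw [Nat.mul_div_cancel _ (by omega)] at hsk
    refine false_of_word_eq_blocks hn hm hA hb hbits (P := P) (q := q) ?_ ?_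
      fun i hi => h i (by omega)
    · exact Nat.pos_of_ne_zero fun h0 => by simp [h0] at hp
    · exact Nat.lt_of_mul_lt_mul_right (Nat.lt_of_mul_lt_mul_right hpt)

theorem IsCircularFactor.exists_getElem_eq {α : Type*} {u w : List α} (h : IsCircularFactor u w) :
    u.length ≤ w.length ∧
      ∃ P, ∀ i < u.length, u[i]? = w[(P + i) % w.length]? := by
  obtain ⟨x, y, rfl, s, r, h⟩ := h
  have hlen := congrArg List.length h
  simp only [List.length_append] at hlen
  refine ⟨by rw [List.length_append]; omega, s.length + x.length, fun i hi => ?_⟩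
  have h1 : (y ++ x)[s.length + i]? = u[i]? := by
    rw [← h, List.append_assoc, List.getElem?_append_right (by omega), Nat.add_sub_cancel_left,
      List.getElem?_append_left hi]
  rw [← h1, ← List.rotate_append_length_eq, List.getElem?_rotate (by rw [List.length_append]; omega)]
  congr 2
  omega

/-- For `n ≥ 45`, with `m = ⌊(n-3)/6⌋`, `ℓ = ⌊n/2⌋` and `M = 4^(m-2)`, for every `t ≥ 1`
there is a word `W` over `A_n` of length `M(n-1)(ℓ+1)t` whose circular word `⟨W⟩` is
`(n/(n-1))⁺`-free, i.e. no factor of `⟨W⟩` has an exponent strictly greater than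
`n/(n-1)`. -/
theorem exists_circular_free_word (n : ℕ) (hn : 45 ≤ n) (t : ℕ) (ht : 1 ≤ t) :
    ∃ W : List (Fin n),
      W.length = 4 ^ ((n - 3) / 6 - 2) * (n - 1) * (n / 2 + 1) * t ∧
      ∀ u : List (Fin n), ∀ p : ℕ, IsCircularFactor u W → HasPeriod u p →
        (u.length : ℝ) / (p : ℝ) ≤ (n : ℝ) / ((n : ℝ) - 1) := by
  obtain ⟨m, hm⟩ : ∃ m, m = (n - 3) / 6 := ⟨_, rfl⟩
  obtain ⟨A, hA⟩ : ∃ A, A = (n / 2 + 4) / 6 := ⟨_, rfl⟩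
  rw [← hm]
  have hM : 20 ≤ 4 ^ (m - 2) :=
    (Nat.le_mul_of_pos_right 20 (by omega)).trans (mul_le_pow (show 7 ≤ m by omega))
  obtain ⟨b, hb, hper, hsum, hbits⟩ := exists_bits hM ht
  obtain ⟨L, hL⟩ : ∃ L, L = 4 ^ (m - 2) * t * (n / 2 + 1) * (n - 1) := ⟨_, rfl⟩
  have hperiodic : Function.Periodic (word n m (counter A m b)) L := fun P => by
    rw [hL]
    exact word_add_period hn (by omega) (by omega) hper hsum P
  refine ⟨List.ofFn fun i : Fin L => ⟨word n m (counter A m b) i, word_lt _ hn (by omega) _⟩,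
    by rw [List.length_ofFn, hL]; ring, fun u p hu hp => ?_⟩
  obtain ⟨hlen, P, hP⟩ := hu.exists_getElem_eq
  rw [List.length_ofFn] at hlen hP
  have hget : ∀ i < u.length, (u[i]?).map Fin.val = some (word n m (counter A m b) (P + i)) := by
    intro i hi
    have hlt : (P + i) % L < L := Nat.mod_lt _ (by omega)
    rw [hP i hi, List.getElem?_ofFn, dif_pos hlt]
    simp [hperiodic.map_mod_nat]
  obtain ⟨hp0, hp⟩ := hp
  have hn1 : (0 : ℝ) < (n : ℝ) - 1 := by
    have : (45 : ℝ) ≤ n := by exact_mod_cast hn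
    linarith
  rw [div_le_div_iff₀ (by exact_mod_cast hp0) hn1]
  by_contra! hlt
  have hlt' : n * p < u.length * (n - 1) := by
    have : ((n * p : ℕ) : ℝ) < ((u.length * (n - 1) : ℕ) : ℝ) := by
      push_cast [Nat.cast_sub (show 1 ≤ n by omega)]
      exact hlt
    exact_mod_cast this
  obtain ⟨k, rfl⟩ : ∃ k, n = k + 1 := ⟨n - 1, by omega⟩
  rw [Nat.add_sub_cancel] at hlt'
  have hpu : p < u.length := by
    by_contra! h
    nlinarith
  obtain ⟨e, he⟩ : ∃ e, u.length = e + p := ⟨u.length - p, by omega⟩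
  refine false_of_word_eq hn hm hA hb hbits (P := P) (p := p) (k := e) hp0 (by omega) ?_
    fun i hi => ?_
  · rw [Nat.add_sub_cancel]
    rw [he] at hlt'
    linarith
  · have h1 := hget i (by omega)
    rw [hp i (by omega), hget (i + p) (by omega), ← add_assoc] at h1
    exact (Option.some.inj h1).symm
end

section
/- Let n ≥ 2 be an integer and let u ∈ B*. If some factor of γ_n(u) has an exponent larger than n/(n−1), then u has a factor v satisfying one of the following conditions: (i) v is a k-stabilizing word of order n with 0 < |v| < k(n−1) for some 1 ≤ k ≤ n−1; or (ii) v is a kernel repetition of order n. -/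
/-- The equivalence between `Fin (n-1)` and the elements of `Fin n` of value `< n - 1`. -/
def finTruncEquiv (n : ℕ) : Fin (n - 1) ≃ {x : Fin n // (x : ℕ) < n - 1} where
  toFun a := ⟨⟨a.1, lt_of_lt_of_le a.2 (Nat.sub_le n 1)⟩, a.2⟩
  invFun x := ⟨x.1.1, x.2⟩
  left_inv a := rfl
  right_inv x := rfl

/-- The permutation of `A_n = {1,…,n}` (modelled as `Fin n`, with letter `i` being
`⟨i-1⟩`) associated to a letter of `B = {0,1}`: letter `0` maps to the `(n-1)`-cycle
`(1 2 ⋯ n-1)` and letter `1` maps to the `n`-cycle `(1 2 ⋯ n)`. -/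
def stepPerm (n : ℕ) (b : Fin 2) : Equiv.Perm (Fin n) :=
  if b = 0 then (finRotate (n - 1)).extendDomain (finTruncEquiv n)
  else finRotate n

/-- `phiRight n u` is the permutation `x ↦ x · φ_n(u)`, the right action of
`φ_n(u) = φ_n(b_1)φ_n(b_2)⋯φ_n(b_k)` on `A_n` (so the letters of `u` act in order,
leftmost first).  In particular `φ_n(u)` is the identity iff `phiRight n u = 1`, and
`φ_n(u)` fixes a point iff `phiRight n u` does. -/
def phiRight (n : ℕ) (u : List (Fin 2)) : Equiv.Perm (Fin n) :=
  (u.reverse.map (stepPerm n)).prod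

/-- Pansiot's encoding `γ_n : B* → A_n*`: the `i`-th letter `a_i` of `γ_n(u)` is the
unique letter with `a_i · φ_n(b_1⋯b_i) = 1` (letter `1` is `⟨0, _⟩ : Fin n`). -/
def gammaWord (n : ℕ) (hn : 0 < n) (u : List (Fin 2)) : List (Fin n) :=
  (List.range u.length).map (fun i => (phiRight n (u.take (i + 1)))⁻¹ ⟨0, hn⟩)

/-- `v` is a `k`-stabilizing word of order `n`: `v` is nonempty and `φ_n(v)` fixes the
points `1, 2, …, k` (i.e. `⟨0⟩, …, ⟨k-1⟩ : Fin n`). -/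
def IsStabilizing (n k : ℕ) (v : List (Fin 2)) : Prop :=
  v ≠ [] ∧ ∀ j : Fin n, (j : ℕ) < k → phiRight n v j = j

/-- `v` is a kernel repetition of order `n`: `v` has a period `p` and a factor `v'` of
length `p` with `φ_n(v')` the identity and `|v| > np/(n-1) - (n-1)`. -/
def IsKernelRep (n : ℕ) (v : List (Fin 2)) : Prop :=
  ∃ p : ℕ, HasPeriod v p ∧ ∃ v' : List (Fin 2), v' <:+: v ∧ v'.length = p ∧
    phiRight n v' = 1 ∧
    (n : ℝ) * (p : ℝ) / ((n : ℝ) - 1) - ((n : ℝ) - 1) < (v.length : ℝ)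

theorem stepPerm_val_of_lt (n : ℕ) (b : Fin 2) (x : Fin n) (hx : (x : ℕ) + 1 < n - 1) :
    (stepPerm n b x : ℕ) = x + 1 := by
  unfold stepPerm
  split_ifs with hb
  · have h := Equiv.Perm.extendDomain_apply_image (finRotate (n - 1)) (finTruncEquiv n)
      ⟨x, by omega⟩
    obtain ⟨m, hm⟩ : ∃ m, n - 1 = m + 1 := ⟨n - 2, by omega⟩
    have hr : ∀ (k : ℕ) (_ : k = m + 1) (y : Fin k), (y : ℕ) < m →
        (finRotate k y : ℕ) = y + 1 := by
      rintro _ rfl y hy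
      exact coe_finRotate_of_ne_last (by intro h; simp [h] at hy)
    exact (congrArg Fin.val h).trans (hr _ hm _ (by simp; omega))
  · obtain ⟨m, rfl⟩ : ∃ m, n = m + 1 := ⟨n - 1, by omega⟩
    exact coe_finRotate_of_ne_last (by intro h; simp [h] at hx)

/-- The letter in position `n - 1` moves to the front exactly under the step `0`. -/
theorem stepPerm_penultimate_eq_zero_iff (n : ℕ) (hn : 2 ≤ n) (b : Fin 2) :
    stepPerm n b ⟨n - 2, by omega⟩ = ⟨0, Nat.zero_lt_of_lt hn⟩ ↔ b = 0 := by
  obtain ⟨m, rfl⟩ : ∃ m, n = m + 2 := ⟨n - 2, by omega⟩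
  unfold stepPerm
  split_ifs with hb
  · have h := Equiv.Perm.extendDomain_apply_image (finRotate (m + 1)) (finTruncEquiv (m + 2))
      (Fin.last m)
    rw [finRotate_last] at h
    exact iff_of_true h hb
  · refine iff_of_false (fun h => ?_) hb
    have h' : ((finRotate (m + 2) ⟨m, by omega⟩ : Fin (m + 2)) : ℕ) = m + 1 :=
      coe_finRotate_of_ne_last (by simp [Fin.ext_iff])
    have := congrArg Fin.val h
    simp only [Nat.add_sub_cancel] at this
    omega

theorem phiRight_append (n : ℕ) (x y : List (Fin 2)) :
    phiRight n (x ++ y) = phiRight n y * phiRight n x := by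
  simp [phiRight]

theorem phiRight_take_succ (n : ℕ) (u : List (Fin 2)) (i : ℕ) (hi : i < u.length) :
    phiRight n (u.take (i + 1)) = stepPerm n u[i] * phiRight n (u.take i) := by
  rw [List.take_succ_eq_append_getElem hi, phiRight_append]
  simp [phiRight]

theorem phiRight_take_add (n : ℕ) (u : List (Fin 2)) (i l : ℕ) :
    phiRight n (u.take (i + l)) =
      phiRight n ((u.drop i).take l) * phiRight n (u.take i) := by
  rw [List.take_add, phiRight_append]

/-- The `i`-th letter (counted from `1`) of Pansiot's encoding of `u`. -/
def gammaLetter (n : ℕ) (hn : 0 < n) (u : List (Fin 2)) (i : ℕ) : Fin n :=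
  (phiRight n (u.take i))⁻¹ ⟨0, hn⟩

/-- Positions `1, …, n - 1` hold the most recent letters of the encoding. -/
theorem phiRight_take_gammaLetter (n : ℕ) (hn : 0 < n) (u : List (Fin 2)) (i x : ℕ)
    (hx : x < n - 1) (hl : i + x ≤ u.length) :
    phiRight n (u.take (i + x)) (gammaLetter n hn u i) = ⟨x, by omega⟩ := by
  induction x with
  | zero => simp [gammaLetter]
  | succ x ih =>
    rw [← add_assoc, phiRight_take_succ n u (i + x) (by omega), Equiv.Perm.mul_apply,
      ih (by omega) (by omega)]
    exact Fin.ext (stepPerm_val_of_lt n _ _ hx)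

theorem gammaLetter_eq_iff (n : ℕ) (hn : 2 ≤ n) (u : List (Fin 2)) (i : ℕ)
    (hl : i + (n - 2) < u.length) :
    gammaLetter n (Nat.zero_lt_of_lt hn) u i =
      gammaLetter n (Nat.zero_lt_of_lt hn) u (i + (n - 2) + 1) ↔
      u[i + (n - 2)] = 0 := by
  rw [← stepPerm_penultimate_eq_zero_iff n hn,
    ← phiRight_take_gammaLetter n (Nat.zero_lt_of_lt hn) u i (n - 2) (by omega) hl.le,
    ← Equiv.Perm.mul_apply, ← phiRight_take_succ n u _ hl]
  conv_lhs => rhs; unfold gammaLetter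
  exact Equiv.Perm.eq_inv_iff_eq

/-- A repeated block of `k` letters at distance `l` is witnessed by a stabilizing factor. -/
theorem phiRight_segment_fixes (n : ℕ) (hn : 0 < n) (u : List (Fin 2)) (s k l : ℕ)
    (hk : k ≤ n - 1) (hl : s + k + l ≤ u.length)
    (hrep : ∀ i < k, gammaLetter n hn u (s + 1 + i) = gammaLetter n hn u (s + 1 + i + l))
    (j : Fin n) (hj : (j : ℕ) < k) :
    phiRight n ((u.drop (s + k)).take l) j = j := by
  have h1 := phiRight_take_gammaLetter n hn u (s + k - j) j (by omega) (by omega)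
  have h2 := phiRight_take_gammaLetter n hn u (s + k - j + l) j (by omega) (by omega)
  have h3 := hrep (k - 1 - j) (by omega)
  rw [show s + 1 + (k - 1 - j) = s + k - j by omega] at h3
  rw [← h3, show s + k - j + l + j = s + k + l by omega, phiRight_take_add,
    Equiv.Perm.mul_apply] at h2
  rw [show s + k - j + j = s + k by omega] at h1
  rwa [h1] at h2

theorem perm_eq_one_of_fixes_lt (n : ℕ) (σ : Equiv.Perm (Fin n))
    (h : ∀ j : Fin n, (j : ℕ) < n - 1 → σ j = j) : σ = 1 := by
  ext1 x
  by_contra hx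
  rw [Equiv.Perm.one_apply] at hx
  have hy : ¬ (σ x : ℕ) < n - 1 := fun hy => hx (σ.injective (h _ hy))
  have hx' : ¬ (x : ℕ) < n - 1 := fun hx' => hx (h _ hx')
  exact hx (Fin.ext (by omega))

theorem exists_gammaLetter_of_infix (n : ℕ) (hn : 0 < n) (u : List (Fin 2)) (w : List (Fin n))
    (hw : w <:+: gammaWord n hn u) :
    ∃ s, s + w.length ≤ u.length ∧
      ∀ i < w.length, w[i]? = some (gammaLetter n hn u (s + 1 + i)) := by
  obtain ⟨x, y, hxy⟩ := hw
  have hlen := congrArg List.length hxy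
  simp only [List.length_append, gammaWord, List.length_map, List.length_range] at hlen
  refine ⟨x.length, by omega, fun i hi => ?_⟩
  have h := congrArg (fun l => l[x.length + i]?) hxy
  simp only [gammaWord, List.append_assoc] at h
  rw [List.getElem?_append_right (by omega), Nat.add_sub_cancel_left,
    List.getElem?_append_left hi, List.getElem?_map,
    List.getElem?_range (by omega)] at h
  rw [h, show x.length + 1 + i = x.length + i + 1 by omega]
  rfl

theorem take_drop_infix {α : Type*} (u : List α) (i l : ℕ) : (u.drop i).take l <:+: u :=
  (List.take_prefix _ _).isInfix.trans (List.drop_suffix _ _).isInfix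

/-- Periodicity of the encoding passes to the encoded word. -/
theorem hasPeriod_segment (n : ℕ) (hn : 2 ≤ n) (u : List (Fin 2)) (s m p : ℕ) (hp : 0 < p)
    (hs : s + m ≤ u.length)
    (hper : ∀ i, i + p < m → gammaLetter n (Nat.zero_lt_of_lt hn) u (s + 1 + i) =
      gammaLetter n (Nat.zero_lt_of_lt hn) u (s + 1 + i + p)) :
    HasPeriod ((u.drop (s + (n - 1))).take (m - (n - 1))) p := by
  refine ⟨hp, fun i hi => ?_⟩
  simp only [List.length_take, List.length_drop] at hi
  rw [List.getElem?_take_of_lt (by omega), List.getElem?_take_of_lt (by omega),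
    List.getElem?_drop, List.getElem?_drop]
  have e1 := gammaLetter_eq_iff n hn u (s + 1 + i) (by omega)
  have e2 := gammaLetter_eq_iff n hn u (s + 1 + i + p) (by omega)
  rw [← hper i (by omega),
    show s + 1 + i + p + (n - 2) + 1 = s + 1 + (i + (n - 1)) + p by omega,
    ← hper (i + (n - 1)) (by omega),
    show s + 1 + (i + (n - 1)) = s + 1 + i + (n - 2) + 1 by omega, e1] at e2
  rw [show s + (n - 1) + i = s + 1 + i + (n - 2) by omega,
    show s + (n - 1) + (i + p) = s + 1 + i + p + (n - 2) by omega,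
    List.getElem?_eq_getElem (by omega), List.getElem?_eq_getElem (by omega)]
  have key : ∀ a b : Fin 2, (a = 0 ↔ b = 0) → a = b := by decide
  exact congrArg some (key _ _ e2)

/-- Carpi's reformulation of Pansiot's result: if a factor of `γ_n(u)` has an exponent
larger than `n/(n-1)`, then `u` has a factor `v` which is either a `k`-stabilizing word
with `0 < |v| < k(n-1)` for some `1 ≤ k ≤ n-1`, or a kernel repetition of order `n`. -/
theorem carpi_reformulation (n : ℕ) (hn : 2 ≤ n) (u : List (Fin 2))
    (h : ∃ w : List (Fin n), ∃ p : ℕ, w <:+: gammaWord n (by omega) u ∧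
      HasPeriod w p ∧ (n : ℝ) / ((n : ℝ) - 1) < (w.length : ℝ) / (p : ℝ)) :
    ∃ v : List (Fin 2), v <:+: u ∧
      ((∃ k : ℕ, 1 ≤ k ∧ k ≤ n - 1 ∧ IsStabilizing n k v ∧
          0 < v.length ∧ v.length < k * (n - 1)) ∨
        IsKernelRep n v) := by
  obtain ⟨w, p, hw, ⟨hp, hper⟩, hexp⟩ := h
  obtain ⟨s, hs, hlet⟩ := exists_gammaLetter_of_infix n (by omega) u w hw
  set m := w.length
  have hrep : ∀ i, i + p < m → gammaLetter n (by omega) u (s + 1 + i) =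
      gammaLetter n (by omega) u (s + 1 + i + p) := by
    intro i hi
    have h := hper i hi
    rw [hlet i (by omega), hlet (i + p) hi, ← add_assoc] at h
    exact Option.some.inj h
  have hn1 : (0 : ℝ) < (n : ℝ) - 1 := by
    have : (2 : ℝ) ≤ n := by exact_mod_cast hn
    linarith
  have hp' : (0 : ℝ) < p := by exact_mod_cast hp
  have hlen : (n : ℝ) * p < m * ((n : ℝ) - 1) := (div_lt_div_iff₀ hn1 hp').mp hexp
  have hpm : p < m := by
    have : (p : ℝ) < m := by nlinarith
    exact_mod_cast this
  rcases le_or_gt (m - p) (n - 1) with hk | hk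
  · have hvlen : ((u.drop (s + (m - p))).take p).length = p := by
      simp only [List.length_take, List.length_drop]
      omega
    refine ⟨_, take_drop_infix u (s + (m - p)) p,
      Or.inl ⟨m - p, by omega, hk, ⟨?_, ?_⟩, ?_, ?_⟩⟩
    · exact List.ne_nil_of_length_pos (by omega)
    · exact phiRight_segment_fixes n (by omega) u s (m - p) p hk (by omega)
        fun i hi => hrep i (by omega)
    · omega
    · rw [hvlen]
      have : (p : ℝ) < ((m - p : ℕ) : ℝ) * ((n - 1 : ℕ) : ℝ) := by
        rw [Nat.cast_sub hpm.le, Nat.cast_sub (by omega : 1 ≤ n), Nat.cast_one]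
        linarith
      exact_mod_cast this
  · refine ⟨_, take_drop_infix u (s + (n - 1)) (m - (n - 1)), Or.inr ⟨p,
      hasPeriod_segment n hn u s m p hp hs hrep, (u.drop (s + (n - 1))).take p, ?_, ?_, ?_, ?_⟩⟩
    · exact (List.take_prefix_take_left (by omega)).isInfix
    · simp only [List.length_take, List.length_drop]
      omega
    · exact perm_eq_one_of_fixes_lt n _ (phiRight_segment_fixes n (by omega) u s (n - 1) p le_rfl
        (by omega) fun i hi => hrep i (by omega))
    · rw [show ((u.drop (s + (n - 1))).take (m - (n - 1))).length = m - (n - 1) by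
        simp only [List.length_take, List.length_drop]; omega,
        Nat.cast_sub (by omega), Nat.cast_sub (by omega : 1 ≤ n), Nat.cast_one]
      have := (div_lt_iff₀ hn1).mpr hlen
      linarith
end
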